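/- Let n ≥ 2, Ω a bounded domain with B₁ ⋐ Ω, and let f : Ω × ℝⁿ → ℝ be a Carathéodory function, convex in the second variable for a.e. x, satisfying for some 1 ≤ L < ∞, μ ≥ 0 and nonnegative g: |z|^p − g(x)^{p/(p−1)} ≤ f(x,z) ≤ L|z|^q + g(x)^{p/(p−1)} and f(x,2z) ≤ μ + L·f(x,z), where 1 ≤ p < min{q,n}, q < ∞, ε := min{1/q + 1/(n−1), 1} − 1/p > 0, and g^{1/(p−1)} ∈ L^{n,1}(B₁). Then there exists c = c(L,n,p,q,Q) ∈ [1,∞) such that every Q-minimizer u of F[u,A] = ∫_A f(x,∇u) dx satisfies sup_{B_{1/2}} u ≤ c ( ‖u₊‖_{W^{1,p}(B₁)} + ‖u₊‖_{W^{1,p}(B₁)}^{1 + (1/p − 1/n)(1 − p/q)/ε} + ‖g^{1/(p−1)}‖_{L^{n,1}(B₁)} ). -/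

import Mathlib

open MeasureTheory Metric Set
open scoped ENNReal NNReal Topology

noncomputable section

/-- `du` is the weak gradient of `u` on the open set `Ω ⊆ ℝⁿ`, in the sense of
integration by parts against smooth compactly supported test functions. -/
def IsWeakGradOn (n : ℕ) (Ω : Set (EuclideanSpace ℝ (Fin n)))
    (u : EuclideanSpace ℝ (Fin n) → ℝ)
    (du : EuclideanSpace ℝ (Fin n) → EuclideanSpace ℝ (Fin n)) : Prop :=
  ∀ φ : EuclideanSpace ℝ (Fin n) → ℝ,
    ContDiff ℝ (⊤ : ℕ∞) φ → HasCompactSupport φ → tsupport φ ⊆ Ω →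
    ∀ i : Fin n,
      (∫ x in Ω, u x * (fderiv ℝ φ x (EuclideanSpace.single i (1 : ℝ))))
        = - ∫ x in Ω, du x i * φ x

/-- `u ∈ W^{1,1}_loc(Ω)` (with weak gradient `du`) is a `Q`-minimizer of the functional
`F[v,A] = ∫_A f(x, ∇v(x)) dx`: for every `φ ∈ W^{1,1}(Ω)` (with weak gradient `dφ`)
whose support is compactly contained in `Ω`, `F[u, supp φ] < ∞` (encoded as
integrability of `x ↦ f x (du x)` on `supp φ`) and
`F[u, supp φ] ≤ Q · F[u + φ, supp φ]`. -/
def IsQMinimizer (n : ℕ) (Ω : Set (EuclideanSpace ℝ (Fin n)))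
    (f : EuclideanSpace ℝ (Fin n) → EuclideanSpace ℝ (Fin n) → ℝ) (Q : ℝ)
    (u : EuclideanSpace ℝ (Fin n) → ℝ)
    (du : EuclideanSpace ℝ (Fin n) → EuclideanSpace ℝ (Fin n)) : Prop :=
  IsWeakGradOn n Ω u du ∧ LocallyIntegrableOn u Ω ∧ LocallyIntegrableOn du Ω ∧
  ∀ (φ : EuclideanSpace ℝ (Fin n) → ℝ)
    (dφ : EuclideanSpace ℝ (Fin n) → EuclideanSpace ℝ (Fin n)),
    IsWeakGradOn n Ω φ dφ → IntegrableOn φ Ω → IntegrableOn dφ Ω →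
    IsCompact (tsupport φ) → tsupport φ ⊆ Ω →
    IntegrableOn (fun x => f x (du x)) (tsupport φ) ∧
    (IntegrableOn (fun x => f x (du x + dφ x)) (tsupport φ) →
      (∫ x in tsupport φ, f x (du x)) ≤ Q * ∫ x in tsupport φ, f x (du x + dφ x))

/-- The nonincreasing rearrangement `h*(t) = inf {σ > 0 : |{|h| > σ}| ≤ t}` of a
function `h : ℝⁿ → ℝ`. -/
def rearr (n : ℕ) (h : EuclideanSpace ℝ (Fin n) → ℝ) (t : ℝ) : ℝ :=
  sInf {σ : ℝ | 0 < σ ∧ volume {x | σ < |h x|} ≤ ENNReal.ofReal t}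

/-- The Lorentz `L^{n,1}(Ω)` norm `∫_0^{|Ω|} t^{1/n} (h·χ_Ω)*(t) dt/t`. -/
def lorentzN1 (n : ℕ) (Ω : Set (EuclideanSpace ℝ (Fin n)))
    (h : EuclideanSpace ℝ (Fin n) → ℝ) : ℝ≥0∞ :=
  ∫⁻ t in Ioo (0 : ℝ) (volume Ω).toReal,
    ENNReal.ofReal (t ^ (1 / (n : ℝ)) * rearr n (Ω.indicator h) t / t)

local notation "𝔼[" n "]" => EuclideanSpace ℝ (Fin n)

/-- Almost everywhere convergence without gain of mass implies convergence in `L¹`. -/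
theorem tendsto_lintegral_enorm_sub_of_ae_of_le {α F : Type*} [MeasurableSpace α] {μ : Measure α}
    [NormedAddCommGroup F] {G : ℕ → α → F} {g : α → F} (hG : ∀ j, Integrable (G j) μ)
    (hg : Integrable g μ) (hle : ∀ j, ∫⁻ x, ‖G j x‖ₑ ∂μ ≤ ∫⁻ x, ‖g x‖ₑ ∂μ)
    (hlim : ∀ᵐ x ∂μ, Filter.Tendsto (fun j => G j x) Filter.atTop (𝓝 (g x))) :
    Filter.Tendsto (fun j => ∫⁻ x, ‖G j x - g x‖ₑ ∂μ) Filter.atTop (𝓝 0) := by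
  set I := ∫⁻ x, ‖g x‖ₑ ∂μ with hI
  have hIfin : I ≠ ∞ := hg.2.ne
  set Φ : ℕ → α → ℝ≥0∞ := fun j x => ENNReal.ofReal (‖G j x‖ + ‖g x‖ - ‖G j x - g x‖) with hΦ
  have hmeas : ∀ j, AEMeasurable (Φ j) μ := fun j =>
    (((hG j).1.norm.aemeasurable.add hg.1.norm.aemeasurable).sub
      ((hG j).1.sub hg.1).norm.aemeasurable).ennreal_ofReal
  have hadd : ∀ j, ∫⁻ x, Φ j x ∂μ + ∫⁻ x, ‖G j x - g x‖ₑ ∂μ ≤ I + I := by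
    intro j
    rw [← lintegral_add_left' (hmeas j)]
    calc ∫⁻ x, (Φ j x + ‖G j x - g x‖ₑ) ∂μ = ∫⁻ x, (‖G j x‖ₑ + ‖g x‖ₑ) ∂μ := by
          refine lintegral_congr fun x => ?_
          have h0 : 0 ≤ ‖G j x‖ + ‖g x‖ - ‖G j x - g x‖ := by
            have := norm_sub_le (G j x) (g x); linarith
          rw [hΦ, ← ofReal_norm, ← ofReal_norm, ← ofReal_norm, ← ENNReal.ofReal_add h0 (norm_nonneg _),
            ← ENNReal.ofReal_add (norm_nonneg _) (norm_nonneg _)]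
          congr 1; ring
      _ = ∫⁻ x, ‖G j x‖ₑ ∂μ + I := lintegral_add_left' (hG j).1.enorm _
      _ ≤ I + I := by gcongr; exact hle j
  have hfatou : I + I ≤ Filter.liminf (fun j => ∫⁻ x, Φ j x ∂μ) Filter.atTop := by
    calc I + I = ∫⁻ x, (‖g x‖ₑ + ‖g x‖ₑ) ∂μ := by rw [lintegral_add_left' hg.1.enorm]
      _ = ∫⁻ x, Filter.liminf (fun j => Φ j x) Filter.atTop ∂μ := by
          refine lintegral_congr_ae ?_
          filter_upwards [hlim] with x hx
          refine (Filter.Tendsto.liminf_eq ?_).symm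
          have h1 : Filter.Tendsto (fun j => ‖G j x‖ + ‖g x‖ - ‖G j x - g x‖) Filter.atTop
              (𝓝 (‖g x‖ + ‖g x‖ - ‖g x - g x‖)) :=
            ((hx.norm.add tendsto_const_nhds).sub (hx.sub tendsto_const_nhds).norm)
          have h2 := ENNReal.tendsto_ofReal h1
          rwa [sub_self, norm_zero, sub_zero, ENNReal.ofReal_add (norm_nonneg _) (norm_nonneg _),
            ofReal_norm] at h2
      _ ≤ _ := lintegral_liminf_le' hmeas
  rw [ENNReal.tendsto_nhds_zero]
  intro ε hε
  by_cases hI0 : I + I = 0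
  · refine Filter.Eventually.of_forall fun j => ?_
    have := hadd j
    rw [hI0] at this
    exact (le_add_self.trans this).trans (zero_le)
  have hlt : I + I - ε < Filter.liminf (fun j => ∫⁻ x, Φ j x ∂μ) Filter.atTop :=
    (ENNReal.sub_lt_self (by simp [hIfin]) hI0 hε.ne').trans_le hfatou
  filter_upwards [Filter.eventually_lt_of_lt_liminf hlt] with j hj
  have h1 := hadd j
  have h2 : I + I ≤ ∫⁻ x, Φ j x ∂μ + ε := by
    rw [← tsub_le_iff_right]; exact hj.le
  have h3 : ∫⁻ x, Φ j x ∂μ ≠ ∞ := ne_top_of_le_ne_top (by simp [hIfin]) (le_self_add.trans h1)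
  exact (ENNReal.add_le_add_iff_left h3).1 (h1.trans h2)

/-- Jensen's inequality for mollification. -/
theorem lintegral_enorm_mollify_rpow_le {n : ℕ} {F : Type*} [NormedAddCommGroup F]
    [NormedSpace ℝ F] (ρ : ContDiffBump (0 : 𝔼[n])) {g : 𝔼[n] → F}
    (hg : AEStronglyMeasurable g volume) {t : ℝ} (ht : 1 ≤ t) :
    ∫⁻ x, ‖convolution (ρ.normed volume) g (ContinuousLinearMap.lsmul ℝ ℝ) volume x‖ₑ ^ t
      ≤ ∫⁻ x, ‖g x‖ₑ ^ t := by
  have ht0 : 0 < t := by linarith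
  set r : 𝔼[n] → ℝ≥0∞ := fun y => ENNReal.ofReal (ρ.normed volume y) with hr
  have hrm : Measurable r := (ρ.continuous_normed.measurable).ennreal_ofReal
  have hr1 : ∫⁻ y, r y = 1 := by
    rw [← ofReal_integral_eq_lintegral_ofReal ρ.integrable_normed
      (Filter.Eventually.of_forall ρ.nonneg_normed), ρ.integral_normed, ENNReal.ofReal_one]
  set ν : Measure 𝔼[n] := volume.withDensity r with hν
  have hνp : IsProbabilityMeasure ν := ⟨by rw [hν, withDensity_apply _ MeasurableSet.univ,
    Measure.restrict_univ, hr1]⟩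
  have hνac : ν ≪ volume := withDensity_absolutelyContinuous _ _
  have hshift : ∀ x, AEStronglyMeasurable (fun y => g (x - y)) volume := fun x =>
    hg.comp_measurePreserving (Measure.measurePreserving_sub_left volume x)
  have key : ∀ x, ‖convolution (ρ.normed volume) g (ContinuousLinearMap.lsmul ℝ ℝ) volume x‖ₑ ^ t
      ≤ ∫⁻ y, r y * ‖g (x - y)‖ₑ ^ t := by
    intro x
    have h1 : ‖convolution (ρ.normed volume) g (ContinuousLinearMap.lsmul ℝ ℝ) volume x‖ₑ
        ≤ ∫⁻ y, ‖g (x - y)‖ₑ ∂ν := by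
      rw [convolution_def, hν, lintegral_withDensity_eq_lintegral_mul₀ hrm.aemeasurable
        (hshift x).enorm]
      refine (enorm_integral_le_lintegral_enorm _).trans (le_of_eq (lintegral_congr fun y => ?_))
      simp only [ContinuousLinearMap.lsmul_apply, enorm_smul, Pi.mul_apply, hr]
      rw [Real.enorm_of_nonneg (ρ.nonneg_normed y)]
    have h2 := eLpNorm'_le_eLpNorm'_of_exponent_le zero_lt_one ht ν ((hshift x).mono_ac hνac)
    simp only [eLpNorm'_eq_lintegral_enorm, ENNReal.rpow_one, div_one] at h2
    calc _ ≤ ((∫⁻ y, ‖g (x - y)‖ₑ ^ t ∂ν) ^ (1 / t)) ^ t := by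
          gcongr; exact h1.trans h2
      _ = ∫⁻ y, ‖g (x - y)‖ₑ ^ t ∂ν := by
          rw [← ENNReal.rpow_mul, one_div_mul_cancel ht0.ne', ENNReal.rpow_one]
      _ = _ := by
          rw [hν, lintegral_withDensity_eq_lintegral_mul₀ hrm.aemeasurable
            ((hshift x).enorm.pow_const t)]
          rfl
  calc _ ≤ ∫⁻ x, ∫⁻ y, r y * ‖g (x - y)‖ₑ ^ t := lintegral_mono key
    _ = ∫⁻ y, ∫⁻ x, r y * ‖g (x - y)‖ₑ ^ t := by
        refine lintegral_lintegral_swap ?_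
        refine AEMeasurable.mul (hrm.comp measurable_snd).aemeasurable ?_
        refine AEMeasurable.pow_const (AEStronglyMeasurable.enorm ?_) t
        exact hg.comp_quasiMeasurePreserving (quasiMeasurePreserving_sub volume volume)
    _ = ∫⁻ y, r y * ∫⁻ x, ‖g x‖ₑ ^ t := by
        refine lintegral_congr fun y => ?_
        rw [lintegral_const_mul' _ _ ENNReal.ofReal_ne_top]
        congr 1
        exact lintegral_sub_right_eq_self (fun x => ‖g x‖ₑ ^ t) y
    _ = _ := by rw [lintegral_mul_const _ hrm, hr1, one_mul]

/-- `w` is integrable with integrable weak gradient `dw` on the whole space. -/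
structure HasWeakGrad {n : ℕ} (w : 𝔼[n] → ℝ) (dw : 𝔼[n] → 𝔼[n]) : Prop where
  int : Integrable w
  int_grad : Integrable dw
  ibp : ∀ φ : 𝔼[n] → ℝ, ContDiff ℝ (⊤ : ℕ∞) φ → HasCompactSupport φ → ∀ i : Fin n,
    ∫ x, w x * fderiv ℝ φ x (EuclideanSpace.single i (1 : ℝ)) = - ∫ x, dw x i * φ x

/-- A standard sequence of mollifiers. -/
def mollBump (n : ℕ) (j : ℕ) : ContDiffBump (0 : 𝔼[n]) where
  rIn := 1 / (2 * ((j : ℝ) + 1))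
  rOut := 1 / ((j : ℝ) + 1)
  rIn_pos := by positivity
  rIn_lt_rOut := by
    have : (0 : ℝ) < (j : ℝ) + 1 := by positivity
    gcongr; linarith

/-- Mollification at scale `1 / (j + 1)`. -/
def moll {n : ℕ} {F : Type*} [NormedAddCommGroup F] [NormedSpace ℝ F] (g : 𝔼[n] → F) (j : ℕ) :
    𝔼[n] → F :=
  convolution ((mollBump n j).normed volume) g (ContinuousLinearMap.lsmul ℝ ℝ) volume

section moll

variable {n : ℕ} {F : Type*} [NormedAddCommGroup F] [NormedSpace ℝ F] {g : 𝔼[n] → F}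

theorem integrable_moll (hg : Integrable g) (j : ℕ) : Integrable (moll g j) :=
  Integrable.integrable_convolution _ (mollBump n j).integrable_normed hg

theorem tendsto_moll_ae [CompleteSpace F] (hg : Integrable g) :
    ∀ᵐ x, Filter.Tendsto (fun j => moll g j x) Filter.atTop (𝓝 (g x)) := by
  refine ContDiffBump.ae_convolution_tendsto_right_of_locallyIntegrable (K := 2) ?_ ?_
    hg.locallyIntegrable
  · exact tendsto_one_div_add_atTop_nhds_zero_nat
  · refine Filter.Eventually.of_forall fun j => le_of_eq ?_
    change 1 / ((j : ℝ) + 1) = 2 * (1 / (2 * ((j : ℝ) + 1)))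
    field_simp

theorem lintegral_moll_rpow_le (hg : Integrable g) (j : ℕ) {t : ℝ} (ht : 1 ≤ t) :
    ∫⁻ x, ‖moll g j x‖ₑ ^ t ≤ ∫⁻ x, ‖g x‖ₑ ^ t :=
  lintegral_enorm_mollify_rpow_le _ hg.1 ht

theorem tendsto_lintegral_moll_sub [CompleteSpace F] (hg : Integrable g) :
    Filter.Tendsto (fun j => ∫⁻ x, ‖moll g j x - g x‖ₑ) Filter.atTop (𝓝 0) :=
  tendsto_lintegral_enorm_sub_of_ae_of_le (fun j => integrable_moll hg j) hg
    (fun j => by simpa using lintegral_moll_rpow_le hg j le_rfl) (tendsto_moll_ae hg)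

theorem support_moll_subset (g : 𝔼[n] → F) (j : ℕ) :
    Function.support (moll g j) ⊆ thickening (1 / ((j : ℝ) + 1)) (Function.support g) := by
  refine (support_convolution_subset (ContinuousLinearMap.lsmul ℝ ℝ)).trans ?_
  rintro x ⟨a, ha, b, hb, rfl⟩
  rw [ContDiffBump.support_normed_eq] at ha
  refine mem_thickening_iff.2 ⟨b, hb, ?_⟩
  rw [mem_ball_zero_iff] at ha
  rw [dist_eq_norm]
  simpa using ha.trans_eq (show (mollBump n j).rOut = 1 / ((j : ℝ) + 1) from rfl)

theorem contDiff_moll (hg : Integrable g) (j : ℕ) : ContDiff ℝ (⊤ : ℕ∞) (moll g j) :=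
  HasCompactSupport.contDiff_convolution_left _ (mollBump n j).hasCompactSupport_normed
    (mollBump n j).contDiff_normed hg.locallyIntegrable

end moll

theorem HasWeakGrad.fderiv_moll {n : ℕ} {w : 𝔼[n] → ℝ} {dw : 𝔼[n] → 𝔼[n]} (h : HasWeakGrad w dw)
    (j : ℕ) (x : 𝔼[n]) : fderiv ℝ (moll w j) x = innerSL ℝ (moll dw j x) := by
  set ρ := (mollBump n j).normed (volume : Measure 𝔼[n]) with hρ
  have hρs : ContDiff ℝ (⊤ : ℕ∞) ρ := (mollBump n j).contDiff_normed
  have hρc : HasCompactSupport ρ := (mollBump n j).hasCompactSupport_normed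
  have h1 : HasFDerivAt (moll w j) _ x :=
    HasCompactSupport.hasFDerivAt_convolution_left (ContinuousLinearMap.lsmul ℝ ℝ) hρc
      (hρs.of_le (by norm_cast)) h.int.locallyIntegrable x
  rw [h1.fderiv]
  have hconv : Integrable (fun y => ρ (x - y) • dw y) := by
    refine h.int_grad.bdd_smul (φ := fun y => ρ (x - y)) (sSup (Set.range fun y => ‖ρ y‖))
      ((hρs.continuous.comp (continuous_const.sub continuous_id)).aestronglyMeasurable) ?_
    refine Filter.Eventually.of_forall fun y => ?_
    exact le_csSup (hρs.continuous.norm.bddAbove_range_of_hasCompactSupport hρc.norm) ⟨x - y, rfl⟩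
  have hmoll : moll dw j x = ∫ y, ρ (x - y) • dw y := by
    rw [moll, convolution_eq_swap]; rfl
  refine ContinuousLinearMap.coe_injective
    ((EuclideanSpace.basisFun (Fin n) ℝ).toBasis.ext fun i => ?_)
  simp only [OrthonormalBasis.coe_toBasis, EuclideanSpace.basisFun_apply,
    ContinuousLinearMap.coe_coe]
  rw [convolution_eq_swap]
  have hInt : Integrable (fun t => ((ContinuousLinearMap.lsmul ℝ ℝ).precompL 𝔼[n])
      (fderiv ℝ ρ (x - t)) (w t)) := by
    have := HasCompactSupport.convolutionExists_left ((ContinuousLinearMap.lsmul ℝ ℝ).precompL 𝔼[n])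
      (hρc.fderiv ℝ) (hρs.continuous_fderiv (by simp)) h.int.locallyIntegrable x
    exact this.integrable_swap
  rw [ContinuousLinearMap.integral_apply hInt]
  have hibp := h.ibp (fun y => ρ (x - y)) (hρs.comp (contDiff_const.sub contDiff_id))
    (hρc.comp_homeomorph (Homeomorph.subLeft x)) i
  have hder : ∀ y, fderiv ℝ (fun y => ρ (x - y)) y = - fderiv ℝ ρ (x - y) := by
    intro y
    have h2 : HasFDerivAt ρ (fderiv ℝ ρ (x - y)) (x - y) :=
      (hρs.differentiable (by simp) _).hasFDerivAt
    have := h2.comp y ((hasFDerivAt_const x y).sub (hasFDerivAt_id y))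
    rw [show (fun y => ρ (x - y)) = ρ ∘ (fun y => x - y) from rfl]
    refine (HasFDerivAt.fderiv this).trans ?_
    ext; simp
  simp only [hder, neg_apply, mul_neg, integral_neg, neg_inj] at hibp
  have h3 : (innerSL ℝ (moll dw j x)) (EuclideanSpace.single i (1 : ℝ)) = moll dw j x i := by
    simp [EuclideanSpace.inner_single_right]
  rw [h3, hmoll]
  have h4 : (∫ y, ρ (x - y) • dw y) i = ∫ y, dw y i * ρ (x - y) := by
    have h5 : ∫ y, (ρ (x - y) • dw y) i = (∫ y, ρ (x - y) • dw y) i :=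
      (EuclideanSpace.proj (𝕜 := ℝ) i).integral_comp_comm hconv
    rw [← h5]
    refine integral_congr_ae (Filter.Eventually.of_forall fun y => ?_)
    simp [mul_comm]
  rw [h4, ← hibp]
  refine integral_congr_ae (Filter.Eventually.of_forall fun y => ?_)
  simp [ContinuousLinearMap.precompL_apply, mul_comm]

theorem tendsto_integral_bdd_mul {α : Type*} [MeasurableSpace α] {μ : Measure α} {b : α → ℝ}
    {G : ℕ → α → ℝ} {g : α → ℝ} (M : ℝ) (hb : AEStronglyMeasurable b μ) (hbM : ∀ x, |b x| ≤ M)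
    (hG : ∀ j, Integrable (G j) μ) (hg : Integrable g μ)
    (hlim : Filter.Tendsto (fun j => ∫⁻ x, ‖G j x - g x‖ₑ ∂μ) Filter.atTop (𝓝 0)) :
    Filter.Tendsto (fun j => ∫ x, b x * G j x ∂μ) Filter.atTop (𝓝 (∫ x, b x * g x ∂μ)) := by
  have hM : ∀ᵐ x ∂μ, ‖b x‖ ≤ M := Filter.Eventually.of_forall hbM
  refine tendsto_integral_of_L1 _ (hb.mul hg.1)
    (Filter.Eventually.of_forall fun j => (hG j).bdd_mul hb hM) ?_
  have h1 : Filter.Tendsto (fun j => ENNReal.ofReal M * ∫⁻ x, ‖G j x - g x‖ₑ ∂μ) Filter.atTop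
      (𝓝 0) := by
    simpa using ENNReal.Tendsto.const_mul hlim (Or.inr ENNReal.ofReal_ne_top)
  refine tendsto_of_tendsto_of_tendsto_of_le_of_le tendsto_const_nhds h1 (fun _ => zero_le)
    fun j => ?_
  rw [← lintegral_const_mul' _ _ ENNReal.ofReal_ne_top]
  refine lintegral_mono fun x => ?_
  rw [Pi.mul_apply, ← mul_sub, enorm_mul]
  gcongr
  rw [Real.enorm_eq_ofReal_abs]
  exact ENNReal.ofReal_le_ofReal (hbM x)

theorem integrable_coord {n : ℕ} {μ : Measure 𝔼[n]} {G : 𝔼[n] → 𝔼[n]} (hG : Integrable G μ)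
    (i : Fin n) : Integrable (fun x => G x i) μ :=
  (EuclideanSpace.proj (𝕜 := ℝ) i).integrable_comp hG

theorem enorm_coord_le {n : ℕ} (x : 𝔼[n]) (i : Fin n) : ‖x i‖ₑ ≤ ‖x‖ₑ := by
  rw [← ofReal_norm, ← ofReal_norm]
  exact ENNReal.ofReal_le_ofReal (PiLp.norm_apply_le x i)

theorem tendsto_lintegral_moll_coord_sub {n : ℕ} {G : 𝔼[n] → 𝔼[n]} (hG : Integrable G)
    (i : Fin n) :
    Filter.Tendsto (fun j => ∫⁻ x, ‖moll G j x i - G x i‖ₑ) Filter.atTop (𝓝 0) :=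
  tendsto_of_tendsto_of_tendsto_of_le_of_le tendsto_const_nhds (tendsto_lintegral_moll_sub hG)
    (fun _ => zero_le) fun j => lintegral_mono fun x => enorm_coord_le (moll G j x - G x) i

theorem norm_gradient {n : ℕ} (τ : 𝔼[n] → ℝ) (x : 𝔼[n]) : ‖gradient τ x‖ = ‖fderiv ℝ τ x‖ := by
  simp [gradient]

theorem measurable_gradient {n : ℕ} (τ : 𝔼[n] → ℝ) : Measurable (gradient τ) :=
  (InnerProductSpace.toDual ℝ 𝔼[n]).symm.continuous.measurable.comp (measurable_fderiv ℝ τ)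

theorem gradient_apply_coord {n : ℕ} (τ : 𝔼[n] → ℝ) (x : 𝔼[n]) (i : Fin n) :
    gradient τ x i = fderiv ℝ τ x (EuclideanSpace.single i (1 : ℝ)) := by
  have h : inner ℝ (gradient τ x) (EuclideanSpace.single i (1 : ℝ)) =
      fderiv ℝ τ x (EuclideanSpace.single i (1 : ℝ)) := by
    rw [gradient, InnerProductSpace.toDual_symm_apply]
  rw [← h, EuclideanSpace.inner_single_right]
  simp

/-- Product rule for a weakly differentiable function and a bounded Lipschitz function. -/
theorem HasWeakGrad.lipschitz_mul {n : ℕ} {w : 𝔼[n] → ℝ} {dw : 𝔼[n] → 𝔼[n]}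
    (h : HasWeakGrad w dw) {τ : 𝔼[n] → ℝ} {K : ℝ≥0} {M : ℝ} (hτ : LipschitzWith K τ)
    (hM : ∀ x, |τ x| ≤ M) :
    HasWeakGrad (fun x => τ x * w x) (fun x => τ x • dw x + w x • gradient τ x) := by
  have hτm : AEStronglyMeasurable τ volume := hτ.continuous.aestronglyMeasurable
  have hgK : ∀ x, ‖gradient τ x‖ ≤ K := fun x => by
    rw [norm_gradient]; exact norm_fderiv_le_of_lipschitz ℝ hτ
  have hi1 : Integrable (fun x => τ x • dw x) :=
    h.int_grad.bdd_smul M hτm (Filter.Eventually.of_forall hM)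
  have hi2 : Integrable (fun x => w x • gradient τ x) := by
    refine Integrable.mono' (h.int.norm.const_mul (K : ℝ))
      (h.int.1.smul (measurable_gradient τ).aestronglyMeasurable)
      (Filter.Eventually.of_forall fun x => ?_)
    rw [norm_smul, mul_comm]
    gcongr
    exact hgK x
  refine ⟨h.int.bdd_mul hτm (Filter.Eventually.of_forall hM), hi1.add hi2, fun φ hφ hφc i => ?_⟩
  set e : 𝔼[n] := EuclideanSpace.single i (1 : ℝ) with he
  obtain ⟨Mφ, hMφ⟩ := hφ.continuous.bounded_above_of_compact_support hφc
  have hdφ : Continuous fun x => fderiv ℝ φ x e :=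
    (hφ.continuous_fderiv (by simp)).clm_apply continuous_const
  have hdφc : HasCompactSupport fun x => fderiv ℝ φ x e := hφc.fderiv_apply ℝ e
  obtain ⟨Md, hMd⟩ := hdφ.bounded_above_of_compact_support hdφc
  have hM0 : 0 ≤ M := (abs_nonneg _).trans (hM 0)
  have hMφ0 : 0 ≤ Mφ := (norm_nonneg _).trans (hMφ 0)
  -- the identity for the mollified functions
  have hj : ∀ j, ∫ x, (gradient τ x i * φ x) * moll w j x =
      - ((∫ x, (τ x * φ x) * moll dw j x i) + ∫ x, (τ x * fderiv ℝ φ x e) * moll w j x) := by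
    intro j
    have hW := contDiff_moll h.int j
    have hg : ContDiff ℝ (⊤ : ℕ∞) (fun x => moll w j x * φ x) := hW.mul hφ
    have hgc : HasCompactSupport (fun x => moll w j x * φ x) := hφc.mul_left
    obtain ⟨D, hD⟩ := ContDiff.lipschitzWith_of_hasCompactSupport hgc hg (by simp)
    have := hτ.integral_lineDeriv_mul_eq (μ := volume) hD hgc e
    have hl : ∫ x, lineDeriv ℝ τ x e * (moll w j x * φ x) =
        ∫ x, (gradient τ x i * φ x) * moll w j x := by
      refine integral_congr_ae ?_
      filter_upwards [hτ.ae_differentiableAt (μ := volume)] with x hx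
      rw [hx.lineDeriv_eq_fderiv, gradient_apply_coord]; ring
    have hb1 : Integrable fun x => (τ x * φ x) * moll dw j x i := by
      refine (integrable_coord (integrable_moll h.int_grad j) i).bdd_mul (c := M * Mφ)
        (hτm.mul hφ.continuous.aestronglyMeasurable) (Filter.Eventually.of_forall fun x => ?_)
      rw [norm_mul]; exact mul_le_mul (hM x) (hMφ x) (norm_nonneg _) hM0
    have hb2 : Integrable fun x => (τ x * fderiv ℝ φ x e) * moll w j x := by
      refine (integrable_moll h.int j).bdd_mul (c := M * Md)
        (hτm.mul hdφ.aestronglyMeasurable) (Filter.Eventually.of_forall fun x => ?_)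
      rw [norm_mul]; exact mul_le_mul (hM x) (hMd x) (norm_nonneg _) hM0
    rw [← hl, this, ← integral_add hb1 hb2, ← integral_neg]
    refine integral_congr_ae (Filter.Eventually.of_forall fun x => ?_)
    simp only
    have hd : HasFDerivAt (fun x => moll w j x * φ x)
        (moll w j x • fderiv ℝ φ x + φ x • fderiv ℝ (moll w j) x) x :=
      ((hW.differentiable (by simp) x).hasFDerivAt).mul
        ((hφ.differentiable (by simp) x).hasFDerivAt)
    rw [hd.differentiableAt.lineDeriv_eq_fderiv, hd.fderiv, h.fderiv_moll j x]
    simp [he, EuclideanSpace.inner_single_right]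
    ring
  have hK0 : ∀ x, |gradient τ x i| ≤ K := fun x => (PiLp.norm_apply_le (gradient τ x) i).trans (hgK x)
  have hgm : AEStronglyMeasurable (fun x => gradient τ x i) volume :=
    (EuclideanSpace.proj (𝕜 := ℝ) i).continuous.comp_aestronglyMeasurable
      (measurable_gradient τ).aestronglyMeasurable
  have hφm : AEStronglyMeasurable φ volume := hφ.continuous.aestronglyMeasurable
  have l1 := tendsto_integral_bdd_mul (K * Mφ) (hgm.mul hφm)
    (fun x => by
      simp only [Pi.mul_apply, abs_mul]
      exact mul_le_mul (hK0 x) (hMφ x) (abs_nonneg _) K.2)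
    (fun j => integrable_moll h.int j) h.int (tendsto_lintegral_moll_sub h.int)
  have l2 := tendsto_integral_bdd_mul (M * Mφ) (hτm.mul hφm)
    (fun x => by
      simp only [Pi.mul_apply, abs_mul]
      exact mul_le_mul (hM x) (hMφ x) (abs_nonneg _) hM0)
    (fun j => integrable_coord (integrable_moll h.int_grad j) i) (integrable_coord h.int_grad i)
    (tendsto_lintegral_moll_coord_sub h.int_grad i)
  have l3 := tendsto_integral_bdd_mul (M * Md) (hτm.mul hdφ.aestronglyMeasurable)
    (fun x => by
      simp only [Pi.mul_apply, abs_mul]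
      exact mul_le_mul (hM x) (hMd x) (abs_nonneg _) hM0)
    (fun j => integrable_moll h.int j) h.int (tendsto_lintegral_moll_sub h.int)
  have hfin := tendsto_nhds_unique l1 (((l2.add l3).neg).congr fun j => (hj j).symm)
  simp only [Pi.mul_apply] at hfin
  have e1 : ∫ x, (τ x • dw x + w x • gradient τ x) i * φ x =
      (∫ x, (τ x * φ x) * dw x i) + ∫ x, (gradient τ x i * φ x) * w x := by
    rw [← integral_add]
    · refine integral_congr_ae (Filter.Eventually.of_forall fun x => ?_)
      simp; ring
    · refine (integrable_coord h.int_grad i).bdd_mul (c := M * Mφ)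
        (hτm.mul hφm) (Filter.Eventually.of_forall fun x => ?_)
      rw [norm_mul]; exact mul_le_mul (hM x) (hMφ x) (norm_nonneg _) hM0
    · refine h.int.bdd_mul (c := K * Mφ)
        (hgm.mul hφm) (Filter.Eventually.of_forall fun x => ?_)
      rw [norm_mul]; exact mul_le_mul (hK0 x) (hMφ x) (norm_nonneg _) K.2
  rw [e1, hfin]
  have e2 : ∫ x, τ x * w x * fderiv ℝ φ x e = ∫ x, (τ x * fderiv ℝ φ x e) * w x :=
    integral_congr_ae (Filter.Eventually.of_forall fun x => by simp only; ring)
  rw [e2]; ring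

/-- Continuous ramp approximating the Heaviside function. -/
def ramp (δ s : ℝ) : ℝ := max 0 (min (s / δ) 1)

theorem continuous_ramp (δ : ℝ) : Continuous (ramp δ) := by unfold ramp; fun_prop

theorem ramp_nonneg (δ s : ℝ) : 0 ≤ ramp δ s := le_max_left _ _

theorem ramp_le_one (δ s : ℝ) : ramp δ s ≤ 1 := max_le zero_le_one (min_le_right _ _)

theorem abs_ramp_le_one (δ s : ℝ) : |ramp δ s| ≤ 1 := by
  rw [abs_of_nonneg (ramp_nonneg _ _)]; exact ramp_le_one _ _

theorem tendsto_ramp (s : ℝ) :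
    Filter.Tendsto (fun N : ℕ => ramp (1 / ((N : ℝ) + 1)) s) Filter.atTop
      (𝓝 ((Ioi (0 : ℝ)).indicator (fun _ => (1 : ℝ)) s)) := by
  by_cases hs : 0 < s
  · rw [indicator_of_mem (show s ∈ Ioi (0 : ℝ) from hs)]
    refine tendsto_const_nhds.congr' ?_
    obtain ⟨N, hN⟩ := exists_nat_gt (1 / s)
    filter_upwards [Filter.eventually_ge_atTop N] with m hm
    have h1 : (1 : ℝ) ≤ s / (1 / ((m : ℝ) + 1)) := by
      rw [div_div_eq_mul_div, div_one]
      have : (N : ℝ) ≤ m := by exact_mod_cast hm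
      have h2 : 1 / s < (m : ℝ) + 1 := by linarith
      rw [div_lt_iff₀ hs] at h2
      linarith
    rw [ramp, min_eq_right h1, max_eq_right zero_le_one]
  · rw [indicator_of_notMem (show s ∉ Ioi (0 : ℝ) from hs)]
    refine tendsto_const_nhds.congr fun m => ?_
    have h1 : s / (1 / ((m : ℝ) + 1)) ≤ 0 :=
      div_nonpos_of_nonpos_of_nonneg (not_lt.1 hs) (by positivity)
    rw [ramp, max_eq_left ((min_le_left _ _).trans h1)]

/-- Primitive of `ramp`, approximating the positive part. -/
def rampInt (δ s : ℝ) : ℝ := ∫ r in (0 : ℝ)..s, ramp δ r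

theorem hasDerivAt_rampInt (δ s : ℝ) : HasDerivAt (rampInt δ) (ramp δ s) s :=
  ((continuous_ramp δ).integral_hasStrictDerivAt 0 s).hasDerivAt

theorem abs_rampInt_sub_le (δ a b : ℝ) : |rampInt δ a - rampInt δ b| ≤ |a - b| := by
  have h : rampInt δ a - rampInt δ b = ∫ r in b..a, ramp δ r :=
    intervalIntegral.integral_interval_sub_left ((continuous_ramp δ).intervalIntegrable _ _)
      ((continuous_ramp δ).intervalIntegrable _ _)
  rw [h]
  simpa using intervalIntegral.norm_integral_le_of_norm_le_const (a := b) (b := a)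
    (f := ramp δ) (C := 1) (fun x _ => abs_ramp_le_one δ x)

theorem continuous_rampInt (δ : ℝ) : Continuous (rampInt δ) :=
  continuous_iff_continuousAt.2 fun s => (hasDerivAt_rampInt δ s).continuousAt

theorem rampInt_of_nonpos {δ s : ℝ} (hδ : 0 < δ) (hs : s ≤ 0) : rampInt δ s = 0 := by
  rw [rampInt]
  refine intervalIntegral.integral_zero_ae (Filter.Eventually.of_forall fun r hr => ?_)
  rw [uIoc_of_ge hs] at hr
  rw [ramp, max_eq_left ((min_le_left _ _).trans (div_nonpos_of_nonpos_of_nonneg hr.2 hδ.le))]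

theorem abs_rampInt_le {δ : ℝ} (hδ : 0 < δ) (s : ℝ) : |rampInt δ s| ≤ max s 0 := by
  rcases le_total s 0 with hs | hs
  · simp [rampInt_of_nonpos hδ hs]
  · have := abs_rampInt_sub_le δ s 0
    rw [rampInt_of_nonpos hδ le_rfl, sub_zero, sub_zero, abs_of_nonneg hs] at this
    exact this.trans (le_max_left _ _)

theorem tendsto_rampInt (s : ℝ) :
    Filter.Tendsto (fun N : ℕ => rampInt (1 / ((N : ℝ) + 1)) s) Filter.atTop (𝓝 (max s 0)) := by
  rcases le_total s 0 with hs | hs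
  · rw [max_eq_right hs]
    exact tendsto_const_nhds.congr fun N => (rampInt_of_nonpos (by positivity) hs).symm
  · have h : ∫ r in (0 : ℝ)..s, (Ioi (0 : ℝ)).indicator (fun _ => (1 : ℝ)) r = max s 0 := by
      rw [max_eq_left hs]
      have : ∫ r in (0 : ℝ)..s, (Ioi (0 : ℝ)).indicator (fun _ => (1 : ℝ)) r =
          ∫ r in (0 : ℝ)..s, (1 : ℝ) := by
        refine intervalIntegral.integral_congr_ae (Filter.Eventually.of_forall fun r hr => ?_)
        rw [uIoc_of_le hs] at hr
        exact indicator_of_mem (show r ∈ Ioi (0 : ℝ) from hr.1) _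
      rw [this]; simp
    rw [← h]
    refine intervalIntegral.tendsto_integral_filter_of_dominated_convergence (fun _ => 1)
      (Filter.Eventually.of_forall fun N => (continuous_ramp _).aestronglyMeasurable)
      (Filter.Eventually.of_forall fun N => Filter.Eventually.of_forall fun r _ =>
        abs_ramp_le_one _ r) (by simp) (Filter.Eventually.of_forall fun r _ => tendsto_ramp r)

theorem HasWeakGrad.integral_rampInt {n : ℕ} {w : 𝔼[n] → ℝ} {dw : 𝔼[n] → 𝔼[n]}
    (h : HasWeakGrad w dw) (k δ : ℝ) {φ : 𝔼[n] → ℝ} (hφ : ContDiff ℝ (⊤ : ℕ∞) φ)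
    (hφc : HasCompactSupport φ) (i : Fin n) :
    ∫ x, rampInt δ (w x - k) * fderiv ℝ φ x (EuclideanSpace.single i (1 : ℝ)) =
      - ∫ x, ramp δ (w x - k) * (dw x i * φ x) := by
  set e : 𝔼[n] := EuclideanSpace.single i (1 : ℝ) with he
  obtain ⟨Mφ, hMφ⟩ := hφ.continuous.bounded_above_of_compact_support hφc
  have hdφ : Continuous fun x => fderiv ℝ φ x e :=
    (hφ.continuous_fderiv (by simp)).clm_apply continuous_const
  have hdφc : HasCompactSupport fun x => fderiv ℝ φ x e := hφc.fderiv_apply ℝ e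
  obtain ⟨Md, hMd⟩ := hdφ.bounded_above_of_compact_support hdφc
  have hcB : ∀ j, Continuous fun x => rampInt δ (moll w j x - k) := fun j =>
    (continuous_rampInt δ).comp ((contDiff_moll h.int j).continuous.sub continuous_const)
  have hcr : ∀ j, Continuous fun x => ramp δ (moll w j x - k) := fun j =>
    (continuous_ramp δ).comp ((contDiff_moll h.int j).continuous.sub continuous_const)
  have hcd : ∀ j, Continuous fun x => moll dw j x i := fun j => by
    have : Continuous fun x => fderiv ℝ (moll w j) x e :=
      ((contDiff_moll h.int j).continuous_fderiv (by simp)).clm_apply continuous_const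
    refine this.congr fun x => ?_
    rw [h.fderiv_moll j x]
    simp [he, EuclideanSpace.inner_single_right]
  have hwm : AEStronglyMeasurable (fun x => w x - k) volume := h.int.1.sub aestronglyMeasurable_const
  have hj : ∀ j, ∫ x, rampInt δ (moll w j x - k) * fderiv ℝ φ x e =
      - ∫ x, ramp δ (moll w j x - k) * (moll dw j x i * φ x) := by
    intro j
    have hd : ∀ x, HasFDerivAt (fun x => rampInt δ (moll w j x - k))
        (ramp δ (moll w j x - k) • fderiv ℝ (moll w j) x) x := fun x =>
      (hasDerivAt_rampInt δ _).comp_hasFDerivAt x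
        ((((contDiff_moll h.int j).differentiable (by simp) x).hasFDerivAt).sub_const k)
    have hd' : ∀ x, fderiv ℝ (fun x => rampInt δ (moll w j x - k)) x e * φ x =
        ramp δ (moll w j x - k) * (moll dw j x i * φ x) := by
      intro x
      rw [(hd x).fderiv, h.fderiv_moll j x]
      simp [he, EuclideanSpace.inner_single_right, mul_assoc]
    rw [integral_mul_fderiv_eq_neg_fderiv_mul_of_integrable]
    · simp only [hd']
    · simp only [hd']
      exact ((hcr j).mul ((hcd j).mul hφ.continuous)).integrable_of_hasCompactSupport
        (hφc.mul_left.mul_left)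
    · exact ((hcB j).mul hdφ).integrable_of_hasCompactSupport hdφc.mul_left
    · exact ((hcB j).mul hφ.continuous).integrable_of_hasCompactSupport hφc.mul_left
    · exact fun x _ => (hd x).differentiableAt
    · exact fun x _ => hφ.differentiable (by simp) x
  have l1 : Filter.Tendsto (fun j => ∫ x, rampInt δ (moll w j x - k) * fderiv ℝ φ x e) Filter.atTop
      (𝓝 (∫ x, rampInt δ (w x - k) * fderiv ℝ φ x e)) := by
    refine tendsto_integral_of_L1 _
      (((continuous_rampInt δ).comp_aestronglyMeasurable hwm).mul hdφ.aestronglyMeasurable)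
      (Filter.Eventually.of_forall fun j =>
        ((hcB j).mul hdφ).integrable_of_hasCompactSupport hdφc.mul_left) ?_
    have h1 : Filter.Tendsto (fun j => ENNReal.ofReal Md * ∫⁻ x, ‖moll w j x - w x‖ₑ) Filter.atTop
        (𝓝 0) := by
      simpa using ENNReal.Tendsto.const_mul (tendsto_lintegral_moll_sub h.int)
        (Or.inr ENNReal.ofReal_ne_top)
    refine tendsto_of_tendsto_of_tendsto_of_le_of_le tendsto_const_nhds h1 (fun _ => zero_le)
      fun j => ?_
    rw [← lintegral_const_mul' _ _ ENNReal.ofReal_ne_top]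
    refine lintegral_mono fun x => ?_
    rw [Pi.mul_apply, ← sub_mul, enorm_mul, mul_comm]
    gcongr
    · rw [← ofReal_norm]; exact ENNReal.ofReal_le_ofReal (hMd x)
    · rw [← ofReal_norm, ← ofReal_norm]
      refine ENNReal.ofReal_le_ofReal ?_
      have := abs_rampInt_sub_le δ (moll w j x - k) (w x - k)
      rwa [sub_sub_sub_cancel_right] at this
  have hrm : ∀ j, AEStronglyMeasurable (fun x => ramp δ (moll w j x - k)) volume :=
    fun j => (hcr j).aestronglyMeasurable
  have hdwφ : Integrable fun x => dw x i * φ x := by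
    simpa only [mul_comm] using (integrable_coord h.int_grad i).bdd_mul (c := Mφ)
      hφ.continuous.aestronglyMeasurable (Filter.Eventually.of_forall hMφ)
  have l2 : Filter.Tendsto (fun j => ∫ x, ramp δ (moll w j x - k) * (dw x i * φ x)) Filter.atTop
      (𝓝 (∫ x, ramp δ (w x - k) * (dw x i * φ x))) := by
    refine tendsto_integral_of_dominated_convergence (fun x => ‖dw x i * φ x‖)
      (fun j => (hrm j).mul hdwφ.1) hdwφ.norm (fun j => Filter.Eventually.of_forall fun x => ?_) ?_
    · rw [norm_mul]
      exact mul_le_of_le_one_left (norm_nonneg _) (abs_ramp_le_one _ _)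
    · filter_upwards [tendsto_moll_ae h.int] with x hx
      exact (((continuous_ramp δ).tendsto _).comp (hx.sub_const k)).mul_const _
  have l3 : Filter.Tendsto (fun j => ∫ x, ramp δ (moll w j x - k) * ((moll dw j x i - dw x i) * φ x))
      Filter.atTop (𝓝 0) := by
    have h1 : Filter.Tendsto (fun j => ENNReal.ofReal Mφ * ∫⁻ x, ‖moll dw j x i - dw x i‖ₑ)
        Filter.atTop (𝓝 0) := by
      simpa using ENNReal.Tendsto.const_mul (tendsto_lintegral_moll_coord_sub h.int_grad i)
        (Or.inr ENNReal.ofReal_ne_top)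
    have h2 := tendsto_of_tendsto_of_tendsto_of_le_of_le (f := fun j =>
      ‖∫ x, ramp δ (moll w j x - k) * ((moll dw j x i - dw x i) * φ x)‖ₑ) tendsto_const_nhds h1
      (fun _ => zero_le) fun j => ?_
    · rw [tendsto_zero_iff_norm_tendsto_zero]
      have := (ENNReal.tendsto_toReal ENNReal.zero_ne_top).comp h2
      simpa [Function.comp_def] using this
    · refine (enorm_integral_le_lintegral_enorm _).trans ?_
      rw [← lintegral_const_mul' _ _ ENNReal.ofReal_ne_top]
      refine lintegral_mono fun x => ?_
      have a1 : ‖ramp δ (moll w j x - k)‖ₑ ≤ 1 := by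
        rw [← ofReal_norm]; exact ENNReal.ofReal_le_one.2 (abs_ramp_le_one _ _)
      have a2 : ‖φ x‖ₑ ≤ ENNReal.ofReal Mφ := by
        rw [← ofReal_norm]; exact ENNReal.ofReal_le_ofReal (hMφ x)
      calc _ = ‖ramp δ (moll w j x - k)‖ₑ * (‖moll dw j x i - dw x i‖ₑ * ‖φ x‖ₑ) := by
            rw [enorm_mul, enorm_mul]
        _ ≤ 1 * (‖moll dw j x i - dw x i‖ₑ * ENNReal.ofReal Mφ) := by gcongr
        _ = _ := by rw [one_mul, mul_comm]
  have l4 := (l2.add l3).neg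
  rw [add_zero] at l4
  refine tendsto_nhds_unique (l1.congr hj) (l4.congr fun j => ?_)
  rw [← integral_add]
  · congr 1
    refine integral_congr_ae (Filter.Eventually.of_forall fun x => ?_)
    simp only; ring
  · exact hdwφ.bdd_mul (hrm j) (Filter.Eventually.of_forall fun x => abs_ramp_le_one _ _)
  · refine Integrable.bdd_mul (c := 1) ?_ (hrm j)
      (Filter.Eventually.of_forall fun x => abs_ramp_le_one _ _)
    simpa only [mul_comm, Pi.sub_apply] using ((integrable_coord (integrable_moll h.int_grad j) i).sub
      (integrable_coord h.int_grad i)).bdd_mul (c := Mφ) hφ.continuous.aestronglyMeasurable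
      (Filter.Eventually.of_forall hMφ)

/-- Weak gradient of the truncation `(w - k)₊`. -/
theorem HasWeakGrad.posPart {n : ℕ} {w : 𝔼[n] → ℝ} {dw : 𝔼[n] → 𝔼[n]}
    (h : HasWeakGrad w dw) {k : ℝ} (hk : 0 ≤ k) :
    HasWeakGrad (fun x => max (w x - k) 0) ({x | k < w x}.indicator dw) := by
  have hwm : AEStronglyMeasurable (fun x => w x - k) volume := h.int.1.sub aestronglyMeasurable_const
  have hset : NullMeasurableSet {x | k < w x} volume :=
    nullMeasurableSet_lt aemeasurable_const h.int.1.aemeasurable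
  have hle : ∀ x, |max (w x - k) 0| ≤ |w x| := fun x => by
    rw [abs_of_nonneg (le_max_right _ _)]
    exact max_le ((sub_le_self _ hk).trans (le_abs_self _)) (abs_nonneg _)
  have hpm : AEStronglyMeasurable (fun x => max (w x - k) 0) volume :=
    (continuous_id.max continuous_const).comp_aestronglyMeasurable hwm
  refine ⟨Integrable.mono h.int hpm (Filter.Eventually.of_forall hle),
    h.int_grad.indicator₀ hset, fun φ hφ hφc i => ?_⟩
  set e : 𝔼[n] := EuclideanSpace.single i (1 : ℝ) with he
  obtain ⟨Mφ, hMφ⟩ := hφ.continuous.bounded_above_of_compact_support hφc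
  have hdφ : Continuous fun x => fderiv ℝ φ x e :=
    (hφ.continuous_fderiv (by simp)).clm_apply continuous_const
  have hdφc : HasCompactSupport fun x => fderiv ℝ φ x e := hφc.fderiv_apply ℝ e
  obtain ⟨Md, hMd⟩ := hdφ.bounded_above_of_compact_support hdφc
  have hdwφ : Integrable fun x => dw x i * φ x := by
    simpa only [mul_comm] using (integrable_coord h.int_grad i).bdd_mul (c := Mφ)
      hφ.continuous.aestronglyMeasurable (Filter.Eventually.of_forall hMφ)
  have l1 : Filter.Tendsto (fun N : ℕ => ∫ x, rampInt (1 / ((N : ℝ) + 1)) (w x - k) *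
      fderiv ℝ φ x e) Filter.atTop (𝓝 (∫ x, max (w x - k) 0 * fderiv ℝ φ x e)) := by
    refine tendsto_integral_of_dominated_convergence (fun x => ‖w x‖ * Md)
      (fun N => ((continuous_rampInt _).comp_aestronglyMeasurable hwm).mul
        hdφ.aestronglyMeasurable) (h.int.norm.mul_const _)
      (fun N => Filter.Eventually.of_forall fun x => ?_)
      (Filter.Eventually.of_forall fun x => (tendsto_rampInt _).mul_const _)
    rw [norm_mul]
    refine mul_le_mul ?_ (hMd x) (norm_nonneg _) (norm_nonneg _)
    refine (abs_rampInt_le (by positivity) _).trans ((le_abs_self _).trans (hle x))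
  have l2 : Filter.Tendsto (fun N : ℕ => ∫ x, ramp (1 / ((N : ℝ) + 1)) (w x - k) *
      (dw x i * φ x)) Filter.atTop
      (𝓝 (∫ x, (Ioi (0 : ℝ)).indicator (fun _ => (1 : ℝ)) (w x - k) * (dw x i * φ x))) := by
    refine tendsto_integral_of_dominated_convergence (fun x => ‖dw x i * φ x‖)
      (fun N => ((continuous_ramp _).comp_aestronglyMeasurable hwm).mul hdwφ.1) hdwφ.norm
      (fun N => Filter.Eventually.of_forall fun x => ?_)
      (Filter.Eventually.of_forall fun x => (tendsto_ramp _).mul_const _)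
    rw [norm_mul]
    exact mul_le_of_le_one_left (norm_nonneg _) (abs_ramp_le_one _ _)
  have := tendsto_nhds_unique l1 (l2.neg.congr fun N =>
    (h.integral_rampInt k (1 / ((N : ℝ) + 1)) hφ hφc i).symm)
  rw [this]
  congr 1
  refine integral_congr_ae (Filter.Eventually.of_forall fun x => ?_)
  by_cases hx : k < w x
  · simp [indicator, hx]
  · simp [indicator, hx]

/-- The Sobolev inequality for weakly differentiable functions supported in a fixed ball. -/
theorem exists_sobolev_const {n : ℕ} (R : ℝ) {s r : ℝ} (hs : 1 ≤ s) (hsn : s < n) (hr : 0 < r)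
    (hsr : 1 / s - 1 / n ≤ 1 / r) :
    ∃ C : ℝ≥0, ∀ (w : 𝔼[n] → ℝ) (dw : 𝔼[n] → 𝔼[n]), HasWeakGrad w dw →
      Function.support w ⊆ closedBall 0 R →
      (∫⁻ x, ‖w x‖ₑ ^ r) ^ (1 / r) ≤ C * (∫⁻ x, ‖dw x‖ₑ ^ s) ^ (1 / s) := by
  have hs0 : 0 < s := by linarith
  lift s to ℝ≥0 using hs0.le
  lift r to ℝ≥0 using hr.le
  set C := eLpNormLESNormFDerivOfLeConst ℝ (volume : Measure 𝔼[n]) (closedBall 0 (R + 1)) s r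
  refine ⟨C, fun w dw h hsupp => ?_⟩
  have hj : ∀ j, ∫⁻ x, ‖moll w j x‖ₑ ^ (r : ℝ) ≤
      (C * (∫⁻ x, ‖dw x‖ₑ ^ (s : ℝ)) ^ (1 / (s : ℝ))) ^ (r : ℝ) := by
    intro j
    have hsub : Function.support (moll w j) ⊆ closedBall 0 (R + 1) := by
      refine (support_moll_subset w j).trans fun x hx => ?_
      obtain ⟨y, hy, hxy⟩ := mem_thickening_iff.1 hx
      have h1 := hsupp hy
      have h2 : 1 / ((j : ℝ) + 1) ≤ 1 := by
        rw [div_le_one (by positivity)]; linarith [(Nat.cast_nonneg j : (0 : ℝ) ≤ j)]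
      rw [mem_closedBall] at h1 ⊢
      linarith [dist_triangle x y 0]
    have := eLpNorm_le_eLpNorm_fderiv_of_le (volume : Measure 𝔼[n])
      ((contDiff_moll h.int j).of_le (by norm_cast)) hsub (p := s) (q := r) (by exact_mod_cast hs)
      (by simpa using (by exact_mod_cast hsn : s < n)) (by simpa using hsr) isBounded_closedBall
    rw [eLpNorm_eq_lintegral_rpow_enorm_toReal (by simpa using (by exact_mod_cast hr.ne' : r ≠ 0))
      ENNReal.coe_ne_top,
      eLpNorm_eq_lintegral_rpow_enorm_toReal (by simpa using (by exact_mod_cast hs0.ne' : s ≠ 0))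
      ENNReal.coe_ne_top] at this
    simp only [ENNReal.coe_toReal] at this
    have h2 : ∫⁻ x, ‖fderiv ℝ (moll w j) x‖ₑ ^ (s : ℝ) ≤ ∫⁻ x, ‖dw x‖ₑ ^ (s : ℝ) := by
      refine le_trans (le_of_eq (lintegral_congr fun x => ?_)) (lintegral_moll_rpow_le h.int_grad j hs)
      rw [h.fderiv_moll j x, ← ofReal_norm, ← ofReal_norm, innerSL_apply_norm]
    have h3 := ENNReal.rpow_le_rpow this hr.le
    rw [← ENNReal.rpow_mul, one_div_mul_cancel hr.ne', ENNReal.rpow_one] at h3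
    refine h3.trans ?_
    gcongr
  have hF : ∫⁻ x, ‖w x‖ₑ ^ (r : ℝ) ≤
      (C * (∫⁻ x, ‖dw x‖ₑ ^ (s : ℝ)) ^ (1 / (s : ℝ))) ^ (r : ℝ) := by
    calc ∫⁻ x, ‖w x‖ₑ ^ (r : ℝ)
        = ∫⁻ x, Filter.liminf (fun j => ‖moll w j x‖ₑ ^ (r : ℝ)) Filter.atTop := by
          refine lintegral_congr_ae ?_
          filter_upwards [tendsto_moll_ae h.int] with x hx
          exact ((hx.enorm).ennrpow_const _).liminf_eq.symm
      _ ≤ Filter.liminf (fun j => ∫⁻ x, ‖moll w j x‖ₑ ^ (r : ℝ)) Filter.atTop :=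
          lintegral_liminf_le' fun j => (integrable_moll h.int j).1.enorm.pow_const _
      _ ≤ _ := Filter.liminf_le_of_frequently_le' (Filter.Frequently.of_forall hj)
  calc _ ≤ ((C * (∫⁻ x, ‖dw x‖ₑ ^ (s : ℝ)) ^ (1 / (s : ℝ))) ^ (r : ℝ)) ^ (1 / (r : ℝ)) := by gcongr
    _ = _ := by rw [← ENNReal.rpow_mul, mul_one_div_cancel hr.ne', ENNReal.rpow_one]

theorem eLpNorm_le_fin_one {q : ℝ} (hq : 1 ≤ q) {f : (Fin 1 → ℝ) → ℝ} {c : Fin 1 → ℝ} {σ : ℝ}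
    (hσ : 0 < σ) (hf : ContDiff ℝ 1 f) (hs : Function.support f ⊆ closedBall c σ) :
    eLpNorm f (ENNReal.ofReal q) volume ≤
      ENNReal.ofReal (2 * σ) ^ (1 / q) * ∫⁻ y, ‖fderiv ℝ f y‖ₑ := by
  have hfc : HasCompactSupport f := HasCompactSupport.of_support_subset_isCompact
    (isCompact_closedBall c σ) hs
  set F : ℝ → ℝ := fun s => f (fun _ => s) with hF
  have hcst : ContDiff ℝ 1 (fun s : ℝ => (fun _ => s : Fin 1 → ℝ)) := contDiff_pi.2 fun _ => contDiff_id
  have hFd : ContDiff ℝ 1 F := hf.comp hcst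
  have hFc : HasCompactSupport F := hfc.comp_isClosedEmbedding
    ((Homeomorph.funUnique (Fin 1) ℝ).symm.isClosedEmbedding)
  have hd : ∀ s, ‖deriv F s‖ₑ ≤ ‖fderiv ℝ f (fun _ => s)‖ₑ := by
    intro s
    have h1 : HasDerivAt F (fderiv ℝ f (fun _ => s) (fun _ => 1)) s :=
      ((hf.differentiable (by simp) _).hasFDerivAt).comp_hasDerivAt s
        (hasDerivAt_pi.2 fun _ => hasDerivAt_id s)
    rw [h1.deriv, ← ofReal_norm, ← ofReal_norm]
    refine ENNReal.ofReal_le_ofReal ((ContinuousLinearMap.le_opNorm _ _).trans ?_)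
    refine mul_le_of_le_one_right (norm_nonneg _) ((pi_norm_le_iff_of_nonneg zero_le_one).2 ?_)
    intro i; simp
  have hInt : ∫⁻ s : ℝ, ‖fderiv ℝ f (fun _ => s)‖ₑ = ∫⁻ y, ‖fderiv ℝ f y‖ₑ :=
    (volume_preserving_funUnique (Fin 1) ℝ).symm.lintegral_comp
      (f := fun y => ‖fderiv ℝ f y‖ₑ) ((hf.continuous_fderiv (by simp)).enorm.measurable)
  have hb : ∀ y, ‖f y‖ₑ ≤ ∫⁻ y, ‖fderiv ℝ f y‖ₑ := by
    intro y
    have h1 : f y = F (y 0) := by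
      simp only [hF]; congr 1; ext i; rw [Subsingleton.elim i 0]
    rw [h1, ← hInt]
    exact (hFc.enorm_le_lintegral_Ici_deriv hFd (y 0)).trans
      ((setLIntegral_le_lintegral _ _).trans (lintegral_mono hd))
  have := eLpNorm_le_of_ae_enorm_bound (p := ENNReal.ofReal q) (μ := volume.restrict (closedBall c σ))
    (Filter.Eventually.of_forall hb)
  rw [eLpNorm_restrict_eq_of_support_subset hs, Measure.restrict_apply_univ,
    Real.volume_pi_closedBall _ hσ.le, ENNReal.toReal_ofReal (by linarith)] at this
  simpa [mul_comm] using this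

/-- Gagliardo-Nirenberg-Sobolev inequality with explicit dependence on the size of the support. -/
theorem exists_gns_const {m : ℕ} (hm : 1 ≤ m) {q t : ℝ} (ht : 1 ≤ t) (hq : 1 ≤ q)
    (hqt : 1 / t - 1 / m ≤ 1 / q) (htm : t < m ∨ (t = 1 ∧ m = 1)) :
    ∃ C : ℝ≥0, ∀ (f : (Fin m → ℝ) → ℝ) (c : Fin m → ℝ) (σ : ℝ), 0 < σ → ContDiff ℝ 1 f →
      Function.support f ⊆ closedBall c σ →
      (∫⁻ y, ‖f y‖ₑ ^ q) ^ (1 / q) ≤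
        C * ENNReal.ofReal ((2 * σ) ^ m) ^ (1 / q - (1 / t - 1 / m)) *
          (∫⁻ y, ‖fderiv ℝ f y‖ₑ ^ t) ^ (1 / t) := by
  have hq0 : 0 < q := by linarith
  have ht0 : 0 < t := by linarith
  have hqe : ∀ f : (Fin m → ℝ) → ℝ, eLpNorm f (ENNReal.ofReal q) volume =
      (∫⁻ y, ‖f y‖ₑ ^ q) ^ (1 / q) := fun f => by
    rw [eLpNorm_eq_lintegral_rpow_enorm_toReal (by simpa using hq0) ENNReal.ofReal_ne_top,
      ENNReal.toReal_ofReal hq0.le]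
  rcases htm with htm | ⟨rfl, rfl⟩
  · have hm0 : (0 : ℝ) < m := by linarith
    have hr : 0 < 1 / t - 1 / m := sub_pos.2 (one_div_lt_one_div_of_lt ht0 htm)
    set r : ℝ := (1 / t - 1 / m)⁻¹ with hr_def
    have hr0 : 0 < r := inv_pos.2 hr
    have hqr : q ≤ r := by
      rw [hr_def, le_inv_comm₀ hq0 hr]; simpa using hqt
    lift t to ℝ≥0 using ht0.le
    refine ⟨SNormLESNormFDerivOfEqConst ℝ (volume : Measure (Fin m → ℝ)) t,
      fun f c σ hσ hf hs => ?_⟩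
    have hfc : HasCompactSupport f := HasCompactSupport.of_support_subset_isCompact
      (isCompact_closedBall c σ) hs
    have h1 := eLpNorm_le_eLpNorm_fderiv_of_eq (volume : Measure (Fin m → ℝ)) hf hfc (p := t)
      (p' := r.toNNReal) (by exact_mod_cast ht)
      (by rw [Module.finrank_fin_fun]; omega)
      (by rw [Module.finrank_fin_fun, Real.coe_toNNReal _ hr0.le, hr_def, inv_inv]; simp)
    have h2 := eLpNorm_le_eLpNorm_mul_rpow_measure_univ (p := ENNReal.ofReal q)
      (q := ENNReal.ofReal r) (μ := volume.restrict (closedBall c σ)) (f := f)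
      (ENNReal.ofReal_le_ofReal hqr) hf.continuous.aestronglyMeasurable
    rw [eLpNorm_restrict_eq_of_support_subset hs, eLpNorm_restrict_eq_of_support_subset hs,
      Measure.restrict_apply_univ, Real.volume_pi_closedBall _ hσ.le,
      ENNReal.toReal_ofReal hq0.le, ENNReal.toReal_ofReal hr0.le, Fintype.card_fin, hqe,
      hr_def, one_div (1 / (t : ℝ) - 1 / m)⁻¹, inv_inv, ← hr_def] at h2
    refine h2.trans ?_
    rw [mul_right_comm]
    gcongr
    refine h1.trans (le_of_eq ?_)
    rw [eLpNorm_eq_lintegral_rpow_enorm_toReal (by simpa using (by exact_mod_cast ht0.ne' : t ≠ 0))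
      ENNReal.coe_ne_top]
    simp
  · refine ⟨1, fun f c σ hσ hf hs => ?_⟩
    have := eLpNorm_le_fin_one hq hσ hf hs
    rw [hqe] at this
    simpa using this

/-- Assemble a point of `ℝ^{m+1}` from its `i`-th coordinate and the remaining ones. -/
def insCoord {m : ℕ} (i : Fin (m + 1)) (s : ℝ) (y : Fin m → ℝ) : 𝔼[m + 1] :=
  WithLp.toLp 2 (i.insertNth s y)

theorem measurePreserving_insCoord {m : ℕ} (i : Fin (m + 1)) :
    MeasurePreserving (fun z : ℝ × (Fin m → ℝ) => insCoord i z.1 z.2) (volume.prod volume) volume :=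
  (EuclideanSpace.volume_preserving_symm_measurableEquiv_toLp (Fin (m + 1))).symm.comp
    (volume_preserving_piFinSuccAbove (fun _ => ℝ) i).symm

theorem continuous_insCoord {m : ℕ} (i : Fin (m + 1)) :
    Continuous (fun z : ℝ × (Fin m → ℝ) => insCoord i z.1 z.2) := by
  refine (PiLp.continuous_toLp 2 _).comp ?_
  exact Continuous.finInsertNth i continuous_fst continuous_snd

theorem lintegral_insCoord {m : ℕ} (i : Fin (m + 1)) {F : 𝔼[m + 1] → ℝ≥0∞} (hF : AEMeasurable F) :
    ∫⁻ s, ∫⁻ y, F (insCoord i s y) = ∫⁻ x, F x := by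
  have hp := measurePreserving_insCoord i
  rw [← hp.map_eq, lintegral_map' (by rwa [hp.map_eq]) hp.measurable.aemeasurable, lintegral_prod]
  exact AEMeasurable.comp_measurable (by rwa [hp.map_eq]) hp.measurable

/-- The linear part of `y ↦ insCoord i s y`. -/
def insCoordL {m : ℕ} (i : Fin (m + 1)) : (Fin m → ℝ) →L[ℝ] 𝔼[m + 1] :=
  LinearMap.toContinuousLinearMap
    { toFun := fun y => insCoord i 0 y
      map_add' := fun y z => by
        ext j
        simp only [insCoord, PiLp.add_apply]
        rcases Fin.eq_self_or_eq_succAbove i j with rfl | ⟨k, rfl⟩ <;> simp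
      map_smul' := fun c y => by
        ext j
        simp only [insCoord, PiLp.smul_apply, RingHom.id_apply]
        rcases Fin.eq_self_or_eq_succAbove i j with rfl | ⟨k, rfl⟩ <;> simp }

theorem insCoord_eq_add {m : ℕ} (i : Fin (m + 1)) (s : ℝ) (y : Fin m → ℝ) :
    insCoord i s y = insCoordL i y + insCoord i s 0 := by
  ext j
  change (i.insertNth s y : Fin (m + 1) → ℝ) j =
    (i.insertNth 0 y : Fin (m + 1) → ℝ) j + (i.insertNth s 0 : Fin (m + 1) → ℝ) j
  rcases Fin.eq_self_or_eq_succAbove i j with rfl | ⟨k, rfl⟩ <;> simp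

theorem contDiff_insCoord {m : ℕ} (i : Fin (m + 1)) (s : ℝ) :
    ContDiff ℝ 1 (fun y => insCoord i s y) := by
  rw [show (fun y => insCoord i s y) = fun y => insCoordL i y + insCoord i s 0 from
    funext (insCoord_eq_add i s)]
  exact (insCoordL i).contDiff.add contDiff_const

theorem hasFDerivAt_insCoord {m : ℕ} (i : Fin (m + 1)) (s : ℝ) (y : Fin m → ℝ) :
    HasFDerivAt (fun y => insCoord i s y) (insCoordL i) y := by
  rw [show (fun y => insCoord i s y) = fun y => insCoordL i y + insCoord i s 0 from
    funext (insCoord_eq_add i s)]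
  exact (insCoordL i).hasFDerivAt.add_const _

/-- Supremum norm of the coordinates of `x - x₀`. -/
def cubeN {n : ℕ} (x₀ x : 𝔼[n]) : ℝ := ‖WithLp.ofLp (x - x₀)‖

/-- Sobolev inequality on coordinate slices. -/
theorem exists_slice_const {m : ℕ} (hm : 1 ≤ m) {q t : ℝ} (ht : 1 ≤ t) (hq : 1 ≤ q)
    (hqt : 1 / t - 1 / m ≤ 1 / q) (htm : t < m ∨ (t = 1 ∧ m = 1)) :
    ∃ C : ℝ≥0, ∀ (w : 𝔼[m + 1] → ℝ) (dw : 𝔼[m + 1] → 𝔼[m + 1]) (x₀ : 𝔼[m + 1]) (σ : ℝ), 0 < σ →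
      HasWeakGrad w dw → Function.support w ⊆ {x | cubeN x₀ x ≤ σ} → ∀ i : Fin (m + 1),
      ∫⁻ s, (∫⁻ y, ‖w (insCoord i s y)‖ₑ ^ q) ^ (t / q) ≤
        (C * ENNReal.ofReal ((4 * σ) ^ m) ^ (1 / q - (1 / t - 1 / m))) ^ t *
          ∫⁻ x, ‖dw x‖ₑ ^ t := by
  obtain ⟨C, hC⟩ := exists_gns_const hm ht hq hqt htm
  have hq0 : 0 < q := by linarith
  have ht0 : 0 < t := by linarith
  set D : ℝ≥0 := ∑ i : Fin (m + 1), ‖insCoordL i‖₊ with hD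
  refine ⟨C * D, fun w dw x₀ σ hσ h hs i => ?_⟩
  set V := ENNReal.ofReal ((4 * σ) ^ m) ^ (1 / q - (1 / t - 1 / m)) with hV
  have hDi : ‖insCoordL i‖ₑ ≤ D := by
    rw [hD]
    exact_mod_cast Finset.single_le_sum (f := fun i : Fin (m + 1) => ‖insCoordL i‖₊)
      (fun _ _ => zero_le) (Finset.mem_univ i)
  have hj : ∀ᶠ j in Filter.atTop, ∫⁻ s, (∫⁻ y, ‖moll w j (insCoord i s y)‖ₑ ^ q) ^ (t / q) ≤
      (((C * D : ℝ≥0) : ℝ≥0∞) * V) ^ t * ∫⁻ x, ‖dw x‖ₑ ^ t := by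
    have hev : ∀ᶠ j : ℕ in Filter.atTop, 1 / ((j : ℝ) + 1) < σ :=
      tendsto_one_div_add_atTop_nhds_zero_nat.eventually (gt_mem_nhds hσ)
    filter_upwards [hev] with j hjσ
    have hW := contDiff_moll h.int j
    have hWs : ∀ x, moll w j x ≠ 0 → cubeN x₀ x ≤ 2 * σ := by
      intro x hx
      obtain ⟨y, hy, hxy⟩ := mem_thickening_iff.1 (support_moll_subset w j hx)
      have h1 : cubeN x₀ y ≤ σ := hs hy
      refine (pi_norm_le_iff_of_nonneg (by linarith)).2 fun k => ?_
      have h2 : ‖(y - x₀) k‖ ≤ σ := (norm_le_pi_norm (WithLp.ofLp (y - x₀)) k).trans h1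
      have h3 : ‖(x - y) k‖ ≤ ‖x - y‖ := PiLp.norm_apply_le _ k
      rw [← dist_eq_norm] at h3
      have h4 : (x - x₀) k = (x - y) k + (y - x₀) k := by simp
      change ‖(x - x₀) k‖ ≤ _
      rw [h4]
      linarith [norm_add_le ((x - y) k) ((y - x₀) k)]
    have hslice : ∀ s, (∫⁻ y, ‖moll w j (insCoord i s y)‖ₑ ^ q) ^ (t / q) ≤
        (((C * D : ℝ≥0) : ℝ≥0∞) * V) ^ t * ∫⁻ y, ‖moll dw j (insCoord i s y)‖ₑ ^ t := by
      intro s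
      have hfd : ContDiff ℝ 1 (fun y => moll w j (insCoord i s y)) :=
        (hW.of_le (by norm_cast)).comp (contDiff_insCoord i s)
      have hsup : Function.support (fun y => moll w j (insCoord i s y)) ⊆
          closedBall (fun k => x₀ (i.succAbove k)) (2 * σ) := by
        intro y hy
        have h1 := hWs _ hy
        rw [mem_closedBall, dist_eq_norm]
        refine (pi_norm_le_iff_of_nonneg (by linarith)).2 fun k => ?_
        have h2 := (norm_le_pi_norm (WithLp.ofLp (insCoord i s y - x₀)) (i.succAbove k)).trans h1
        simpa [insCoord] using h2
      have h1 := hC _ _ _ (by linarith : 0 < 2 * σ) hfd hsup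
      have hder : ∀ y, ‖fderiv ℝ (fun y => moll w j (insCoord i s y)) y‖ₑ ≤
          D * ‖moll dw j (insCoord i s y)‖ₑ := by
        intro y
        have hd2 := ((hW.differentiable (by simp) (insCoord i s y)).hasFDerivAt).comp y
          (hasFDerivAt_insCoord i s y)
        rw [show (fun y => moll w j (insCoord i s y)) = moll w j ∘ (fun y => insCoord i s y) from rfl,
          hd2.fderiv, h.fderiv_moll]
        refine (ContinuousLinearMap.opENorm_comp_le _ _).trans ?_
        rw [mul_comm]
        gcongr
        rw [← ofReal_norm, ← ofReal_norm, innerSL_apply_norm]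
      have h2 : ∫⁻ y, ‖fderiv ℝ (fun y => moll w j (insCoord i s y)) y‖ₑ ^ t ≤
          (D : ℝ≥0∞) ^ t * ∫⁻ y, ‖moll dw j (insCoord i s y)‖ₑ ^ t := by
        rw [← lintegral_const_mul' _ _ (by simp [ht0.le])]
        refine lintegral_mono fun y => ?_
        rw [← ENNReal.mul_rpow_of_nonneg _ _ ht0.le]
        gcongr
        exact hder y
      have h3 := ENNReal.rpow_le_rpow h1 ht0.le
      rw [← ENNReal.rpow_mul, one_div_mul_eq_div, ENNReal.mul_rpow_of_nonneg _ _ ht0.le,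
        ← ENNReal.rpow_mul (∫⁻ y, _), one_div_mul_cancel ht0.ne', ENNReal.rpow_one] at h3
      refine h3.trans ((mul_le_mul_right h2 _).trans (le_of_eq ?_))
      rw [hV, show 2 * (2 * σ) = 4 * σ by ring, ← mul_assoc,
        ← ENNReal.mul_rpow_of_nonneg _ _ ht0.le, ENNReal.coe_mul, mul_right_comm]
    calc ∫⁻ s, (∫⁻ y, ‖moll w j (insCoord i s y)‖ₑ ^ q) ^ (t / q)
        ≤ ∫⁻ s, (((C * D : ℝ≥0) : ℝ≥0∞) * V) ^ t * ∫⁻ y, ‖moll dw j (insCoord i s y)‖ₑ ^ t :=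
          lintegral_mono hslice
      _ ≤ (((C * D : ℝ≥0) : ℝ≥0∞) * V) ^ t * ∫⁻ s, ∫⁻ y, ‖moll dw j (insCoord i s y)‖ₑ ^ t := by
          have hpos : 0 ≤ 1 / q - (1 / t - 1 / m) := by linarith
          rw [lintegral_const_mul']
          refine ENNReal.rpow_ne_top_of_nonneg ht0.le (ENNReal.mul_ne_top ENNReal.coe_ne_top ?_)
          exact ENNReal.rpow_ne_top_of_nonneg hpos ENNReal.ofReal_ne_top
      _ = (((C * D : ℝ≥0) : ℝ≥0∞) * V) ^ t * ∫⁻ x, ‖moll dw j x‖ₑ ^ t := by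
          rw [lintegral_insCoord i (F := fun x => ‖moll dw j x‖ₑ ^ t)]
          exact (integrable_moll h.int_grad j).1.enorm.pow_const _
      _ ≤ _ := mul_le_mul_right (lintegral_moll_rpow_le h.int_grad j ht) _
  have hae : ∀ᵐ s, ∀ᵐ y, Filter.Tendsto (fun j => moll w j (insCoord i s y)) Filter.atTop
      (𝓝 (w (insCoord i s y))) :=
    Measure.ae_ae_of_ae_prod ((measurePreserving_insCoord i).quasiMeasurePreserving.ae
      (tendsto_moll_ae h.int))
  have hmeas : ∀ j s, Measurable fun y => ‖moll w j (insCoord i s y)‖ₑ ^ q := fun j s =>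
    (((contDiff_moll h.int j).continuous.comp ((continuous_insCoord i).comp
      (Continuous.prodMk_right s))).enorm.measurable).pow_const _
  have hmeas2 : ∀ j, Measurable fun s => (∫⁻ y, ‖moll w j (insCoord i s y)‖ₑ ^ q) ^ (t / q) :=
    fun j => (Measurable.lintegral_prod_right' (f := fun z : ℝ × (Fin m → ℝ) =>
      ‖moll w j (insCoord i z.1 z.2)‖ₑ ^ q) ((((contDiff_moll h.int j).continuous.comp
        (continuous_insCoord i)).enorm.measurable).pow_const _)).pow_const _
  calc ∫⁻ s, (∫⁻ y, ‖w (insCoord i s y)‖ₑ ^ q) ^ (t / q)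
      ≤ ∫⁻ s, Filter.liminf (fun j => (∫⁻ y, ‖moll w j (insCoord i s y)‖ₑ ^ q) ^ (t / q))
          Filter.atTop := by
        refine lintegral_mono_ae ?_
        filter_upwards [hae] with s hs'
        have h1 : ∫⁻ y, ‖w (insCoord i s y)‖ₑ ^ q ≤
            Filter.liminf (fun j => ∫⁻ y, ‖moll w j (insCoord i s y)‖ₑ ^ q) Filter.atTop := by
          refine le_trans (le_of_eq (lintegral_congr_ae ?_)) (lintegral_liminf_le (fun j => hmeas j s))
          filter_upwards [hs'] with y hy
          exact ((hy.enorm).ennrpow_const _).liminf_eq.symm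
        refine (ENNReal.rpow_le_rpow h1 (by positivity)).trans (le_of_eq ?_)
        exact ((ENNReal.monotone_rpow_of_nonneg (div_nonneg ht0.le hq0.le)).map_liminf_of_continuousAt
          _ (ENNReal.continuous_rpow_const.continuousAt))
    _ ≤ Filter.liminf (fun j => ∫⁻ s, (∫⁻ y, ‖moll w j (insCoord i s y)‖ₑ ^ q) ^ (t / q))
          Filter.atTop := lintegral_liminf_le hmeas2
    _ ≤ _ := Filter.liminf_le_of_frequently_le' hj.frequently

theorem measure_div_lt_le {α : Type*} [MeasurableSpace α] {μ : Measure α} {f : α → ℝ≥0∞}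
    (hf : AEMeasurable f μ) {I : ℝ≥0∞} (hI : ∫⁻ x, f x ∂μ ≤ I) {b : ℝ≥0∞} (hb : b ≠ 0)
    (hb' : b ≠ ∞) : μ {x | I / b < f x} ≤ b := by
  rcases eq_or_ne I 0 with rfl | hI0
  · have h0 : f =ᵐ[μ] 0 := (lintegral_eq_zero_iff' hf).1 (le_antisymm hI zero_le)
    have : μ {x | 0 / b < f x} = 0 := by
      refine measure_mono_null ?_ h0
      intro x hx hx0
      simp only [ENNReal.zero_div, mem_ofPred_eq] at hx
      exact hx.ne' hx0
    rw [this]; exact zero_le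
  rcases eq_or_ne I ∞ with rfl | hIt
  · simp [ENNReal.top_div_of_ne_top hb']
  · calc μ {x | I / b < f x} ≤ μ {x | I / b ≤ f x} := measure_mono fun x (hx : I / b < f x) => hx.le
      _ ≤ (∫⁻ x, f x ∂μ) / (I / b) := meas_ge_le_lintegral_div hf
          (ENNReal.div_ne_zero.2 ⟨hI0, hb'⟩) (ENNReal.div_ne_top hIt hb)
      _ ≤ I / (I / b) := by gcongr
      _ = b := by
          rw [ENNReal.div_eq_inv_mul, ENNReal.inv_div (Or.inl hb') (Or.inl hb), 
            ENNReal.div_mul_cancel hI0 hIt]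

theorem setLIntegral_rpow_le {α : Type*} [MeasurableSpace α] {μ : Measure α} {f : α → ℝ≥0∞}
    {S : Set α} (hf : AEMeasurable f (μ.restrict S)) {t p : ℝ} (ht : 0 < t) (htp : t ≤ p) :
    ∫⁻ x in S, f x ^ t ∂μ ≤ μ S ^ (1 - t / p) * (∫⁻ x in S, f x ^ p ∂μ) ^ (t / p) := by
  have hp : 0 < p := ht.trans_le htp
  have h := eLpNorm'_le_eLpNorm'_mul_rpow_measure_univ ht htp hf.aestronglyMeasurable
  simp only [eLpNorm'_eq_lintegral_enorm, enorm_eq_self, Measure.restrict_apply_univ] at h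
  have h2 := ENNReal.rpow_le_rpow h ht.le
  rw [← ENNReal.rpow_mul, one_div_mul_cancel ht.ne', ENNReal.rpow_one,
    ENNReal.mul_rpow_of_nonneg _ _ ht.le, ← ENNReal.rpow_mul, ← ENNReal.rpow_mul, mul_comm] at h2
  convert h2 using 3
  · field_simp
  · ring

section cubeN

variable {n : ℕ}

theorem cubeN_le_iff {x₀ x : 𝔼[n]} {r : ℝ} (hr : 0 ≤ r) :
    cubeN x₀ x ≤ r ↔ ∀ i, |x i - x₀ i| ≤ r := by
  rw [cubeN, pi_norm_le_iff_of_nonneg hr]; simp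

theorem abs_coord_le_cubeN (x₀ x : 𝔼[n]) (i : Fin n) : |x i - x₀ i| ≤ cubeN x₀ x :=
  norm_le_pi_norm (WithLp.ofLp (x - x₀)) i

theorem cubeN_nonneg (x₀ x : 𝔼[n]) : 0 ≤ cubeN x₀ x := norm_nonneg _

theorem cubeN_le_dist (x₀ x : 𝔼[n]) : cubeN x₀ x ≤ dist x x₀ := by
  rw [cubeN_le_iff dist_nonneg, dist_eq_norm]
  exact fun i => PiLp.norm_apply_le (x - x₀) i

theorem abs_cubeN_sub_le (x₀ x y : 𝔼[n]) : |cubeN x₀ x - cubeN x₀ y| ≤ dist x y := by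
  refine (abs_norm_sub_norm_le _ _).trans ?_
  have h : WithLp.ofLp (x - x₀) - WithLp.ofLp (y - x₀) = WithLp.ofLp (x - y) := by
    rw [← WithLp.ofLp_sub, sub_sub_sub_cancel_right]
  rw [h, dist_eq_norm]
  exact (pi_norm_le_iff_of_nonneg (norm_nonneg _)).2 fun i => PiLp.norm_apply_le (x - y) i

theorem lipschitz_cubeN (x₀ : 𝔼[n]) : LipschitzWith 1 (cubeN x₀) :=
  LipschitzWith.of_dist_le_mul fun x y => by
    rw [Real.dist_eq]; simpa using abs_cubeN_sub_le x₀ x y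

theorem continuous_cubeN (x₀ : 𝔼[n]) : Continuous (cubeN x₀) := (lipschitz_cubeN x₀).continuous

theorem exists_cubeN_eq {m : ℕ} (x₀ x : 𝔼[m + 1]) : ∃ i, cubeN x₀ x = |x i - x₀ i| := by
  by_contra! hne
  have hlt : ∀ i, |x i - x₀ i| < cubeN x₀ x := fun i =>
    lt_of_le_of_ne (abs_coord_le_cubeN x₀ x i) (Ne.symm (hne i))
  have hpos : 0 < cubeN x₀ x := (abs_nonneg _).trans_lt (hlt 0)
  have : cubeN x₀ x < cubeN x₀ x := (pi_norm_lt_iff hpos).2 fun i => by simpa using hlt i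
  exact lt_irrefl _ this

theorem dist_le_cubeN (x₀ x : 𝔼[n]) : dist x x₀ ≤ n * cubeN x₀ x := by
  rw [EuclideanSpace.dist_eq]
  refine Real.sqrt_le_iff.2 ⟨by have := cubeN_nonneg x₀ x; positivity, ?_⟩
  calc ∑ i, dist (x i) (x₀ i) ^ 2 ≤ ∑ _i : Fin n, cubeN x₀ x ^ 2 := by
        refine Finset.sum_le_sum fun i _ => ?_
        rw [Real.dist_eq]
        exact pow_le_pow_left₀ (abs_nonneg _) (abs_coord_le_cubeN x₀ x i) 2
    _ = n * cubeN x₀ x ^ 2 := by simp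
    _ ≤ (n * cubeN x₀ x) ^ 2 := by
        rw [mul_pow]
        gcongr
        rcases n with _ | k
        · simp
        · have : (1 : ℝ) ≤ ((k + 1 : ℕ) : ℝ) := by exact_mod_cast Nat.le_add_left 1 k
          nlinarith

end cubeN

/-- One-dimensional cut-off profile whose transition takes place in a prescribed set. -/
theorem exists_profile {ρ μ : ℝ} {b : ℝ} (hρ : 0 ≤ ρ) (hb : 0 < b) {G : Set ℝ}
    (hG : MeasurableSet G) (hGs : G ⊆ Ioo ρ μ) (hbG : ENNReal.ofReal b ≤ volume G) :
    ∃ ψ : ℝ → ℝ, LipschitzWith (1 / b).toNNReal ψ ∧ (∀ s, 0 ≤ s → 0 ≤ ψ s) ∧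
      (∀ s, 0 ≤ s → ψ s ≤ 1) ∧
      (∀ s, 0 ≤ s → s ≤ ρ → ψ s = 1) ∧ (∀ s, μ ≤ s → ψ s = 0) ∧
      ∀ᵐ s, s ∉ G → HasDerivAt ψ 0 s := by
  set g : ℝ → ℝ := G.indicator fun _ => 1 with hg
  have hGfin : volume G ≠ ∞ := ne_top_of_le_ne_top (by simp) (measure_mono hGs)
  have hgi : Integrable g := (integrable_indicator_iff hG).2 (integrableOn_const hGfin)
  set M : ℝ := volume.real G with hM
  have hbM : b ≤ M := by
    rw [hM, Measure.real]; exact (ENNReal.ofReal_le_iff_le_toReal hGfin).1 hbG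
  have hM0 : 0 < M := hb.trans_le hbM
  have hμ : ρ < μ := by
    by_contra h
    have : G = ∅ := by rw [Ioo_eq_empty h] at hGs; exact subset_empty_iff.1 hGs
    rw [hM, this] at hM0; simp at hM0
  have hg0 : ∀ r, 0 ≤ g r := fun r => indicator_nonneg (fun _ _ => zero_le_one) r
  have hg1 : ∀ r, ‖g r‖ ≤ 1 := fun r => by
    rw [Real.norm_of_nonneg (hg0 r)]
    by_cases hr : r ∈ G <;> simp [hg, hr]
  have hInt : ∀ s, μ ≤ s → ∫ r in (0 : ℝ)..s, g r = M := by
    intro s hs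
    rw [intervalIntegral.integral_of_le (by linarith), hg, setIntegral_indicator hG]
    have hGI : G ⊆ Ioc 0 s := fun r hr =>
      ⟨by linarith [(hGs hr).1], by linarith [(hGs hr).2]⟩
    rw [inter_eq_right.2 hGI]
    simp [hM]
  have hz : ∀ s, 0 ≤ s → s ≤ ρ → ∫ r in (0 : ℝ)..s, g r = 0 := by
    intro s hs hsρ
    refine intervalIntegral.integral_zero_ae (Filter.Eventually.of_forall fun r hr => ?_)
    rw [uIoc_of_le hs] at hr
    exact indicator_of_notMem (fun h => by linarith [(hGs h).1, hr.2]) _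
  have hsub : ∀ a c, (∫ r in (0 : ℝ)..a, g r) - ∫ r in (0 : ℝ)..c, g r = ∫ r in c..a, g r :=
    fun a c => intervalIntegral.integral_interval_sub_left hgi.intervalIntegrable
      hgi.intervalIntegrable
  have hle : ∀ s, ∫ r in (0 : ℝ)..s, g r ≤ M := by
    intro s
    rw [← hInt (max s μ) (le_max_right _ _), ← sub_nonneg, hsub]
    exact intervalIntegral.integral_nonneg (le_max_left _ _) fun r _ => hg0 r
  refine ⟨fun s => 1 - (∫ r in (0 : ℝ)..s, g r) / M, ?_, fun s _ => ?_, fun s hs => ?_,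
    fun s hs hsρ => ?_, fun s hs => ?_, ?_⟩
  · refine LipschitzWith.of_dist_le_mul fun a c => ?_
    rw [Real.coe_toNNReal _ (by positivity), Real.dist_eq, Real.dist_eq]
    have h1 : |∫ r in c..a, g r| ≤ |a - c| := by
      simpa using intervalIntegral.norm_integral_le_of_norm_le_const (a := c) (b := a)
        (f := g) (C := 1) (fun x _ => hg1 x)
    have h2 : (1 - (∫ r in (0 : ℝ)..a, g r) / M) - (1 - (∫ r in (0 : ℝ)..c, g r) / M) =
        -((∫ r in c..a, g r) / M) := by rw [← hsub a c]; ring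
    rw [h2, abs_neg, abs_div, abs_of_pos hM0, div_le_iff₀ hM0]
    calc _ ≤ |a - c| := h1
      _ ≤ 1 / b * |a - c| * b := by
          rw [mul_right_comm, one_div_mul_cancel hb.ne', one_mul]
      _ ≤ _ := by gcongr
  · rw [sub_nonneg, div_le_one hM0]; exact hle s
  · rw [sub_le_self_iff]
    exact div_nonneg (intervalIntegral.integral_nonneg hs fun r _ => hg0 r) hM0.le
  · simp only [hz s hs hsρ]; simp
  · simp only [hInt s hs, div_self hM0.ne', sub_self]
  · filter_upwards [LocallyIntegrable.ae_hasDerivAt_integral hgi.locallyIntegrable] with s hs hsG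
    have h1 := ((hs 0).div_const M).const_sub 1
    rwa [show g s = 0 from indicator_of_notMem hsG _, zero_div, neg_zero] at h1

theorem ae_cubeN_notMem {m : ℕ} (x₀ : 𝔼[m + 1]) {Z : Set ℝ} (hZ : volume Z = 0) :
    ∀ᵐ x : 𝔼[m + 1], cubeN x₀ x ∉ Z := by
  have habs : ∀ i : Fin (m + 1), ∀ᵐ x : 𝔼[m + 1], |x i - x₀ i| ∉ Z := by
    intro i
    have h1 : ∀ᵐ s : ℝ, |s - x₀ i| ∉ Z := by
      have ha : ∀ᵐ s : ℝ, s - x₀ i ∉ Z :=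
        (measurePreserving_sub_right volume (x₀ i)).quasiMeasurePreserving.ae
          (measure_eq_zero_iff_ae_notMem.1 hZ)
      have hb : ∀ᵐ s : ℝ, x₀ i - s ∉ Z :=
        (Measure.measurePreserving_sub_left volume (x₀ i)).quasiMeasurePreserving.ae
          (measure_eq_zero_iff_ae_notMem.1 hZ)
      filter_upwards [ha, hb] with s h1 h2
      rcases abs_choice (s - x₀ i) with h | h <;> rw [h]
      · exact h1
      · rwa [neg_sub]
    have h2 : Measure.QuasiMeasurePreserving (fun x : 𝔼[m + 1] => x i) volume volume :=
      (Measure.quasiMeasurePreserving_eval (fun _ : Fin (m + 1) => (volume : Measure ℝ)) i).comp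
        (EuclideanSpace.volume_preserving_symm_measurableEquiv_toLp
          (Fin (m + 1))).quasiMeasurePreserving
    exact h2.ae h1
  filter_upwards [ae_all_iff.2 habs] with x hx
  obtain ⟨i, hi⟩ := exists_cubeN_eq x₀ x
  rw [hi]; exact hx i

theorem hasFDerivAt_comp_cubeN {n : ℕ} {x₀ x : 𝔼[n]} {ψ : ℝ → ℝ}
    (h : HasDerivAt ψ 0 (cubeN x₀ x)) :
    HasFDerivAt (fun y => ψ (cubeN x₀ y)) (0 : 𝔼[n] →L[ℝ] ℝ) x := by
  have h1 := hasDerivAt_iff_isLittleO.1 h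
  simp only [smul_zero, sub_zero] at h1
  have h2 := h1.comp_tendsto ((continuous_cubeN x₀).tendsto x)
  refine .of_isLittleO ?_
  simp only [zero_apply, sub_zero]
  refine h2.trans_isBigO (Asymptotics.IsBigO.of_bound 1 (Filter.Eventually.of_forall fun y => ?_))
  rw [one_mul, ← dist_eq_norm]
  exact abs_cubeN_sub_le x₀ y x

theorem exists_good_set {ι : Type*} [Fintype ι] [Nonempty ι] {Φ : ι → ℝ → ℝ≥0∞}
    (hΦ : ∀ k, AEMeasurable (Φ k)) {I : ℝ≥0∞} (hI : ∀ k, ∫⁻ s, Φ k s ≤ I) {ρ μ : ℝ}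
    (hρ : ρ < μ) :
    ∃ G : Set ℝ, MeasurableSet G ∧ G ⊆ Ioo ρ μ ∧ ENNReal.ofReal ((μ - ρ) / 2) ≤ volume G ∧
      ∀ s ∈ G, ∀ k, Φ k s ≤ I / ENNReal.ofReal ((μ - ρ) / (2 * Fintype.card ι)) := by
  have hc : (0 : ℝ) < Fintype.card ι := by exact_mod_cast Fintype.card_pos
  set b : ℝ := (μ - ρ) / (2 * Fintype.card ι) with hb
  have hb0 : 0 < b := div_pos (sub_pos.2 hρ) (by positivity)
  set B : Set ℝ := ⋃ k, {s | I / ENNReal.ofReal b < Φ k s} with hB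
  have hBm : volume B ≤ ENNReal.ofReal ((μ - ρ) / 2) := by
    refine (measure_iUnion_fintype_le _ _).trans ?_
    refine (Finset.sum_le_sum fun k _ => measure_div_lt_le (hΦ k) (hI k) (b := ENNReal.ofReal b)
      (by simpa using hb0) (by simp)).trans (le_of_eq ?_)
    rw [Finset.sum_const, nsmul_eq_mul, Finset.card_univ, ← ENNReal.ofReal_natCast,
      ← ENNReal.ofReal_mul hc.le, hb]
    congr 1; field_simp
  refine ⟨Ioo ρ μ \ toMeasurable volume B, measurableSet_Ioo.diff (measurableSet_toMeasurable _ _),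
    sdiff_subset, ?_, fun s hs k => ?_⟩
  · refine le_trans ?_ (le_measure_sdiff)
    rw [measure_toMeasurable, Real.volume_Ioo]
    refine ENNReal.le_sub_of_add_le_right (ne_top_of_le_ne_top (by simp) hBm) ?_
    refine (add_le_add_right hBm _).trans (le_of_eq ?_)
    rw [← ENNReal.ofReal_add (by linarith) (by linarith)]
    congr 1; ring
  · have : s ∉ B := fun h => hs.2 (subset_toMeasurable _ _ h)
    simp only [hB, mem_iUnion, mem_ofPred_eq, not_exists, not_lt] at this
    exact this k

/-- Bound for the integral over the shell `{cubeN x₀ x ∈ G}` in terms of slices. -/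
theorem lintegral_shell_le {m : ℕ} {x₀ : 𝔼[m + 1]} {F : 𝔼[m + 1] → ℝ≥0∞} (hF : AEMeasurable F)
    {G : Set ℝ} (hG : MeasurableSet G) {J : ℝ≥0∞}
    (h1 : ∀ s ∈ G, ∀ i, ∫⁻ y, F (insCoord i (x₀ i + s) y) ≤ J)
    (h2 : ∀ s ∈ G, ∀ i, ∫⁻ y, F (insCoord i (x₀ i - s) y) ≤ J) :
    ∫⁻ x in {x | cubeN x₀ x ∈ G}, F x ≤ (2 * (m + 1) : ℕ) * (volume G * J) := by
  have hmeas : MeasurableSet {x | cubeN x₀ x ∈ G} := (continuous_cubeN x₀).measurable hG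
  have hcoord : ∀ i, Measurable fun x : 𝔼[m + 1] => x i := fun i => by fun_prop
  have hins : ∀ (i : Fin (m + 1)) s (y : Fin m → ℝ), insCoord i s y i = s := fun i s y => by
    simp [insCoord]
  have key : ∀ i (T : ℝ → ℝ), Measurable T → 
      ∫⁻ x, {x : 𝔼[m + 1] | T (x i) ∈ G}.indicator F x =
      ∫⁻ s, {s | T s ∈ G}.indicator (fun s => ∫⁻ y, F (insCoord i s y)) s := by
    intro i T hT
    have hm : MeasurableSet {x : 𝔼[m + 1] | T (x i) ∈ G} := hT.comp (hcoord i) hG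
    rw [← lintegral_insCoord i (hF.indicator hm)]
    refine lintegral_congr fun s => ?_
    by_cases hs : T s ∈ G
    · simp [indicator, hins, hs]
    · simp [indicator, hins, hs]
  have hle : ∀ i (T : ℝ → ℝ), MeasurePreserving T volume volume → 
      (∀ s, T s ∈ G → ∫⁻ y, F (insCoord i s y) ≤ J) → 
      ∫⁻ x, {x : 𝔼[m + 1] | T (x i) ∈ G}.indicator F x ≤ volume G * J := by
    intro i T hT hJ
    rw [key i T hT.measurable]
    calc _ ≤ ∫⁻ s, {s | T s ∈ G}.indicator (fun s => J) s := by
          refine lintegral_mono fun s => ?_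
          by_cases hs : T s ∈ G
          · simpa [indicator, hs] using hJ s hs
          · simp [indicator, hs]
      _ = volume G * J := by
          have hm : MeasurableSet {s | T s ∈ G} := hT.measurable hG
          rw [lintegral_indicator_const hm, mul_comm]
          congr 1
          exact hT.measure_preimage hG.nullMeasurableSet
  calc ∫⁻ x in {x | cubeN x₀ x ∈ G}, F x
      = ∫⁻ x, {x | cubeN x₀ x ∈ G}.indicator F x := (lintegral_indicator hmeas _).symm
    _ ≤ ∫⁻ x, ∑ i, ({x : 𝔼[m + 1] | x i - x₀ i ∈ G}.indicator F x +
          {x : 𝔼[m + 1] | x₀ i - x i ∈ G}.indicator F x) := by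
        refine lintegral_mono fun x => ?_
        by_cases hx : cubeN x₀ x ∈ G
        · obtain ⟨i, hi⟩ := exists_cubeN_eq x₀ x
          refine le_trans ?_ (Finset.single_le_sum (fun _ _ => zero_le) (Finset.mem_univ i))
          rw [hi] at hx
          have h0 : {x | cubeN x₀ x ∈ G}.indicator F x = F x := 
            indicator_of_mem (by show cubeN x₀ x ∈ G; rwa [hi]) _
          rw [h0]
          rcases abs_choice (x i - x₀ i) with h | h <;> rw [h] at hx
          · have : {x : 𝔼[m + 1] | x i - x₀ i ∈ G}.indicator F x = F x :=
              by simp [indicator, hx]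
            rw [this]; exact le_self_add
          · rw [neg_sub] at hx
            have : {x : 𝔼[m + 1] | x₀ i - x i ∈ G}.indicator F x = F x :=
              by simp [indicator, hx]
            rw [this]; exact le_add_self
        · have : {x | cubeN x₀ x ∈ G}.indicator F x = 0 :=
            by simp [indicator, hx]
          rw [this]; exact zero_le
    _ = ∑ i, ((∫⁻ x, {x : 𝔼[m + 1] | x i - x₀ i ∈ G}.indicator F x) +
          ∫⁻ x, {x : 𝔼[m + 1] | x₀ i - x i ∈ G}.indicator F x) := by
        have hm1 : ∀ i, AEMeasurable ({x : 𝔼[m + 1] | x i - x₀ i ∈ G}.indicator F) := fun i =>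
          hF.indicator (((hcoord i).sub_const _) hG)
        have hm2 : ∀ i, AEMeasurable ({x : 𝔼[m + 1] | x₀ i - x i ∈ G}.indicator F) := fun i =>
          hF.indicator (((hcoord i).const_sub _) hG)
        refine (lintegral_finsetSum' _ fun i _ => (hm1 i).add (hm2 i)).trans ?_
        exact Finset.sum_congr rfl fun i _ => lintegral_add_left' (hm1 i) _
    _ ≤ ∑ i : Fin (m + 1), (volume G * J + volume G * J) := by
        refine Finset.sum_le_sum fun i _ => add_le_add ?_ ?_
        · refine hle i (fun s => s - x₀ i) (measurePreserving_sub_right volume (x₀ i)) fun s hs => ?_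
          simpa using h1 _ hs i
        · refine hle i (fun s => x₀ i - s) (Measure.measurePreserving_sub_left volume (x₀ i))
            fun s hs => ?_
          simpa using h2 _ hs i
    _ = _ := by
        rw [Finset.sum_const, Finset.card_univ, Fintype.card_fin, nsmul_eq_mul, ← two_mul]
        push_cast; ring

theorem HasWeakGrad.exists_cut {n : ℕ} {v : 𝔼[n] → ℝ} {dv : 𝔼[n] → 𝔼[n]} (h : HasWeakGrad v dv)
    (x₀ : 𝔼[n]) {a b : ℝ} (hab : a < b) :
    ∃ w dw, HasWeakGrad w dw ∧ (∀ x, cubeN x₀ x ≤ a → w x = v x) ∧ (∀ x, ‖w x‖ₑ ≤ ‖v x‖ₑ) ∧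
      (∀ x, ¬ cubeN x₀ x ≤ b → w x = 0 ∧ dw x = 0) ∧
      ∀ x, ‖dw x‖ₑ ≤ ‖dv x‖ₑ + ENNReal.ofReal (1 / (b - a)) * ‖v x‖ₑ := by
  have hd : 0 < b - a := sub_pos.2 hab
  set ζ : 𝔼[n] → ℝ := fun x => max 0 (min 1 ((b - cubeN x₀ x) / (b - a))) with hζ
  have hζ0 : ∀ x, 0 ≤ ζ x := fun x => le_max_left _ _
  have hζ1 : ∀ x, ζ x ≤ 1 := fun x => max_le zero_le_one (min_le_left _ _)
  have hζabs : ∀ x, |ζ x| ≤ 1 := fun x => by rw [abs_of_nonneg (hζ0 x)]; exact hζ1 x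
  have hlip : LipschitzWith (1 / (b - a)).toNNReal ζ := by
    have h1 : LipschitzWith (1 / (b - a)).toNNReal fun x => (b - cubeN x₀ x) / (b - a) := by
      refine LipschitzWith.of_dist_le_mul fun x y => ?_
      rw [Real.dist_eq, ← sub_div, abs_div, abs_of_pos hd, Real.coe_toNNReal _ (by positivity),
        div_eq_inv_mul, one_div]
      gcongr
      rw [sub_sub_sub_cancel_left, abs_sub_comm]
      exact abs_cubeN_sub_le x₀ x y
    exact (h1.const_min 1).const_max 0
  have hgK : ∀ x, ‖gradient ζ x‖ₑ ≤ ENNReal.ofReal (1 / (b - a)) := fun x => by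
    rw [← ofReal_norm, norm_gradient]
    refine ENNReal.ofReal_le_ofReal ((norm_fderiv_le_of_lipschitz ℝ hlip).trans ?_)
    rw [Real.coe_toNNReal _ (by positivity)]
  refine ⟨_, _, h.lipschitz_mul hlip hζabs, fun x hx => ?_, fun x => ?_, fun x hx => ?_,
    fun x => ?_⟩
  · have h1 : 1 ≤ (b - cubeN x₀ x) / (b - a) := by rw [le_div_iff₀ hd]; linarith
    simp [hζ, min_eq_left h1]
  · rw [enorm_mul]
    refine mul_le_of_le_one_left zero_le ?_
    rw [← ofReal_norm]
    exact ENNReal.ofReal_le_one.2 (hζabs x)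
  · have h0 : ∀ y, b < cubeN x₀ y → ζ y = 0 := fun y hy => by
      have : (b - cubeN x₀ y) / (b - a) ≤ 0 := div_nonpos_of_nonpos_of_nonneg (by linarith) hd.le
      simp only [hζ]
      rw [max_eq_left ((min_le_right _ _).trans this)]
    have hev : ζ =ᶠ[𝓝 x] fun _ => 0 := by
      filter_upwards [(isOpen_lt continuous_const (continuous_cubeN x₀)).mem_nhds (not_le.1 hx)]
        with y hy using h0 y hy
    have hg : gradient ζ x = 0 := by
      rw [gradient, hev.fderiv_eq]; simp
    simp [h0 x (not_le.1 hx), hg]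
  · refine (enorm_add_le _ _).trans (add_le_add ?_ ?_)
    · rw [enorm_smul]
      refine mul_le_of_le_one_left zero_le ?_
      rw [← ofReal_norm]
      exact ENNReal.ofReal_le_one.2 (hζabs x)
    · rw [enorm_smul, mul_comm]
      gcongr
      exact hgK x

theorem exists_cutoff_const {m : ℕ} (hm : 1 ≤ m) {p q t : ℝ} (ht : 1 ≤ t) (htp : t < p)
    (hpq : p < q) (hqt : 1 / t - 1 / m ≤ 1 / q) (htm : t < m ∨ (t = 1 ∧ m = 1)) :
    ∃ C : ℝ≥0, ∀ (v : 𝔼[m + 1] → ℝ) (dv : 𝔼[m + 1] → 𝔼[m + 1]), HasWeakGrad v dv →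
      ∀ A : Set 𝔼[m + 1], MeasurableSet A → (∀ x, x ∉ A → v x = 0) → (∀ x, x ∉ A → dv x = 0) →
      ∀ x₀ ρ σ, 0 ≤ ρ → ρ < σ →
      ∃ (η : 𝔼[m + 1] → ℝ) (K : ℝ≥0), LipschitzWith K η ∧ (∀ x, 0 ≤ η x) ∧ (∀ x, η x ≤ 1) ∧
        (∀ x, cubeN x₀ x ≤ ρ → η x = 1) ∧ (∀ x, (ρ + σ) / 2 ≤ cubeN x₀ x → η x = 0) ∧
        ∫⁻ x, ‖v x‖ₑ ^ q * ‖gradient η x‖ₑ ^ q ≤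
          C * ENNReal.ofReal ((σ - ρ) * (1 / (σ - ρ)) ^ q * (1 / (σ - ρ)) ^ (q / t) *
              σ ^ (m * (1 / q - 1 / t + 1 / m) * q)) *
            volume (A ∩ {x | cubeN x₀ x ≤ σ}) ^ (q * (1 / t - 1 / p)) *
            (∫⁻ x in {x | cubeN x₀ x ≤ σ},
              (‖dv x‖ₑ + ENNReal.ofReal (2 / (σ - ρ)) * ‖v x‖ₑ) ^ p) ^ (q / p) := by
  have ht0 : 0 < t := by linarith
  have hp0 : 0 < p := by linarith
  have hq0 : 0 < q := by linarith
  obtain ⟨C0, hC0⟩ := exists_slice_const hm ht (by linarith) hqt htm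
  set κ : ℝ := 1 / q - (1 / t - 1 / m) with hκ
  have hκ0 : 0 ≤ κ := by linarith
  set N : ℝ := m + 1 with hN
  have hN0 : 0 < N := by positivity
  refine ⟨C0 ^ q * (2 * N * 4 ^ q * (8 * N) ^ (q / t) * 4 ^ (m * κ * q)).toNNReal, 
    fun v dv h A hA hvA hdA x₀ ρ σ hρ hρσ => ?_⟩
  set d : ℝ := σ - ρ with hd
  have hd0 : 0 < d := sub_pos.2 hρσ
  have hσ0 : 0 < σ := by linarith
  obtain ⟨w, dw, hw, hwv, hwle, hw0, hdw⟩ := h.exists_cut x₀ (show (ρ + σ) / 2 < σ by linarith)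
  rw [show 1 / (σ - (ρ + σ) / 2) = 2 / d by rw [hd]; field_simp; ring] at hdw
  set E : ℝ≥0∞ := ∫⁻ x in {x | cubeN x₀ x ≤ σ},
              (‖dv x‖ₑ + ENNReal.ofReal (2 / d) * ‖v x‖ₑ) ^ p with hE
  set V : ℝ≥0∞ := volume (A ∩ {x | cubeN x₀ x ≤ σ}) with hV
  set S : Set 𝔼[m + 1] := A ∩ {x | cubeN x₀ x ≤ σ} with hS
  have hcl : MeasurableSet {x | cubeN x₀ x ≤ σ} :=
    (isClosed_le (continuous_cubeN x₀) continuous_const).measurableSet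
  have hSm : MeasurableSet S := hA.inter hcl
  have hdwt : ∫⁻ x, ‖dw x‖ₑ ^ t ≤ V ^ (1 - t / p) * E ^ (t / p) := by
    have h1 : ∫⁻ x, ‖dw x‖ₑ ^ t ≤
        ∫⁻ x in S, (‖dv x‖ₑ + ENNReal.ofReal (2 / d) * ‖v x‖ₑ) ^ t := by
      rw [← lintegral_indicator hSm]
      refine lintegral_mono fun x => ?_
      by_cases hx : x ∈ S
      · rw [indicator_of_mem hx]
        gcongr
        exact hdw x
      · have : dw x = 0 := by
          by_cases hxA : x ∈ A
          · exact (hw0 x fun hh => hx ⟨hxA, hh⟩).2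
          · simpa [hvA x hxA, hdA x hxA] using hdw x
        simp [this, ht0]
    refine h1.trans ((setLIntegral_rpow_le ?_ ht0 htp.le).trans ?_)
    · exact ((h.int_grad.1.enorm).add (h.int.1.enorm.const_mul _)).restrict
    · gcongr
      · exact lintegral_mono_set inter_subset_right
  set I : ℝ≥0∞ := (C0 * ENNReal.ofReal ((4 * σ) ^ m) ^ κ) ^ t * (V ^ (1 - t / p) * E ^ (t / p))
    with hI
  have hsupp : Function.support w ⊆ {x | cubeN x₀ x ≤ σ} := fun x hx => by
    by_contra hh
    exact hx (hw0 x hh).1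
  have hslice : ∀ i, ∫⁻ s, (∫⁻ y, ‖w (insCoord i s y)‖ₑ ^ q) ^ (t / q) ≤ I := fun i =>
    (hC0 w dw x₀ σ hσ0 hw hsupp i).trans (mul_le_mul_right hdwt _)
  have hmeas : ∀ i : Fin (m + 1), 
      AEMeasurable (fun s => (∫⁻ y, ‖w (insCoord i s y)‖ₑ ^ q) ^ (t / q)) := fun i => by
    refine AEMeasurable.pow_const (AEMeasurable.lintegral_prod_right'
      (f := fun z : ℝ × (Fin m → ℝ) => ‖w (insCoord i z.1 z.2)‖ₑ ^ q) ?_) _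
    exact (hw.int.1.enorm.pow_const q).comp_quasiMeasurePreserving
      (measurePreserving_insCoord i).quasiMeasurePreserving
  obtain ⟨G, hG, hGs, hGv, hGI⟩ := exists_good_set (ι := Fin (m + 1) × Bool)
    (Φ := fun k r => (∫⁻ y, ‖w (insCoord k.1 (if k.2 then x₀ k.1 + r else x₀ k.1 - r) y)‖ₑ ^ q)
      ^ (t / q)) (I := I) (ρ := ρ) (μ := (ρ + σ) / 2)
    (by
      rintro ⟨i, b⟩
      rcases b
      · exact (hmeas i).comp_quasiMeasurePreserving
          (Measure.measurePreserving_sub_left volume (x₀ i)).quasiMeasurePreserving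
      · exact (hmeas i).comp_quasiMeasurePreserving
          (measurePreserving_add_left volume (x₀ i)).quasiMeasurePreserving)
    (by
      rintro ⟨i, b⟩
      rcases b
      · simp only [Bool.false_eq_true, if_false]
        rw [lintegral_sub_left_eq_self
          (fun s => (∫⁻ y, ‖w (insCoord i s y)‖ₑ ^ q) ^ (t / q)) (x₀ i)]
        exact hslice i
      · simp only [if_true]
        rw [lintegral_add_left_eq_self
          (fun s => (∫⁻ y, ‖w (insCoord i s y)‖ₑ ^ q) ^ (t / q)) (x₀ i)]
        exact hslice i)
    (by linarith)
  rw [show ((ρ + σ) / 2 - ρ) / 2 = d / 4 by rw [hd]; ring] at hGv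
  have hcard : ((Fintype.card (Fin (m + 1) × Bool) : ℕ) : ℝ) = 2 * N := by
    simp [hN]; ring
  rw [hcard, show ((ρ + σ) / 2 - ρ) / (2 * (2 * N)) = d / (8 * N) by rw [hd]; field_simp; ring] at hGI
  obtain ⟨ψ, hψl, hψ0, hψ1, hψρ, hψσ, hψG⟩ := exists_profile hρ (by positivity) hG hGs hGv
  have hηl : LipschitzWith (1 / (d / 4)).toNNReal fun x => ψ (cubeN x₀ x) := by
    have := hψl.comp (lipschitz_cubeN x₀)
    rwa [mul_one] at this
  refine ⟨fun x => ψ (cubeN x₀ x), _, hηl, fun x => hψ0 _ (cubeN_nonneg _ _),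
    fun x => hψ1 _ (cubeN_nonneg _ _), fun x hx => hψρ _ (cubeN_nonneg _ _) hx,
    fun x hx => hψσ _ hx, ?_⟩
  have hgK : ∀ x, ‖gradient (fun x => ψ (cubeN x₀ x)) x‖ₑ ≤ ENNReal.ofReal (4 / d) := fun x => by
    rw [← ofReal_norm, norm_gradient]
    refine ENNReal.ofReal_le_ofReal ((norm_fderiv_le_of_lipschitz ℝ hηl).trans (le_of_eq ?_))
    rw [Real.coe_toNNReal _ (by positivity), one_div_div]
  have hg0 : ∀ᵐ x, cubeN x₀ x ∉ G → gradient (fun x => ψ (cubeN x₀ x)) x = 0 := by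
    filter_upwards [ae_cubeN_notMem x₀ (ae_iff.1 hψG)] with x hx hxG
    have h1 : HasDerivAt ψ 0 (cubeN x₀ x) := by
      by_contra hh
      exact hx fun hhh => hh (hhh hxG)
    rw [gradient, (hasFDerivAt_comp_cubeN h1).fderiv]; simp
  have hGmeas : MeasurableSet {x | cubeN x₀ x ∈ G} := (continuous_cubeN x₀).measurable hG
  have hstep1 : ∫⁻ x, ‖v x‖ₑ ^ q * ‖gradient (fun x => ψ (cubeN x₀ x)) x‖ₑ ^ q ≤
      ENNReal.ofReal (4 / d) ^ q * ∫⁻ x in {x | cubeN x₀ x ∈ G}, ‖w x‖ₑ ^ q := by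
    rw [← lintegral_const_mul' _ _ (by simp [hq0.le]), ← lintegral_indicator hGmeas]
    refine lintegral_mono_ae ?_
    filter_upwards [hg0] with x hx
    by_cases hxG : cubeN x₀ x ∈ G
    · have hi : ({x | cubeN x₀ x ∈ G} : Set 𝔼[m + 1]).indicator
          (fun a => ENNReal.ofReal (4 / d) ^ q * ‖w a‖ₑ ^ q) x =
          ENNReal.ofReal (4 / d) ^ q * ‖w x‖ₑ ^ q := by simp [indicator, hxG]
      rw [hi, mul_comm, hwv x (hGs hxG).2.le]
      gcongr
      exact hgK x
    · simp [hx hxG, hq0]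
  set J : ℝ≥0∞ := (I / ENNReal.ofReal (d / (8 * N))) ^ (q / t) with hJ
  have hroot : ∀ X : ℝ≥0∞, X ^ (t / q) ≤ I / ENNReal.ofReal (d / (8 * N)) → X ≤ J := by
    intro X hX
    have := ENNReal.rpow_le_rpow hX (show 0 ≤ q / t by positivity)
    rwa [← ENNReal.rpow_mul, show t / q * (q / t) = 1 by field_simp, ENNReal.rpow_one] at this
  have hstep2 : ∫⁻ x in {x | cubeN x₀ x ∈ G}, ‖w x‖ₑ ^ q ≤
      (2 * (m + 1) : ℕ) * (volume G * J) := by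
    refine lintegral_shell_le (hw.int.1.enorm.pow_const q) hG (fun s hs i => ?_) fun s hs i => ?_
    · exact hroot _ (by simpa using hGI s hs (i, true))
    · exact hroot _ (by simpa using hGI s hs (i, false))
  have hGd : volume G ≤ ENNReal.ofReal d := (measure_mono hGs).trans (by
    rw [Real.volume_Ioo]; exact ENNReal.ofReal_le_ofReal (by linarith))
  refine hstep1.trans ((mul_le_mul_right (hstep2.trans
    (mul_le_mul_right (mul_le_mul_left hGd J) _)) _).trans (le_of_eq ?_))
  have hJ2 : J = C0 ^ q * ENNReal.ofReal ((4 * σ) ^ (m * κ * q)) * V ^ (q * (1 / t - 1 / p)) *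
      E ^ (q / p) * ENNReal.ofReal ((8 * N) ^ (q / t) * (1 / d) ^ (q / t)) := by
    have hqt0 : 0 ≤ q / t := by positivity
    rw [hJ, ENNReal.div_eq_inv_mul, ← ENNReal.ofReal_inv_of_pos (by positivity),
      ENNReal.mul_rpow_of_nonneg _ _ hqt0, hI, ENNReal.mul_rpow_of_nonneg _ _ hqt0,
      ENNReal.mul_rpow_of_nonneg _ _ hqt0, ← ENNReal.rpow_mul, ← ENNReal.rpow_mul,
      ← ENNReal.rpow_mul, ENNReal.ofReal_rpow_of_nonneg (by positivity) hqt0, inv_div,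
      show t * (q / t) = q by field_simp, show t / p * (q / t) = q / p by field_simp,
      show (1 - t / p) * (q / t) = q * (1 / t - 1 / p) by field_simp,
      ENNReal.mul_rpow_of_nonneg _ _ hq0.le, ← ENNReal.rpow_mul,
      ENNReal.ofReal_rpow_of_nonneg (by positivity) (by positivity),
      ← Real.rpow_natCast, ← Real.rpow_mul (by positivity), ← mul_assoc (m : ℝ),
      div_eq_mul_one_div (8 * N), Real.mul_rpow (by positivity) (by positivity)]
    ring
  rw [hJ2, show 1 / q - 1 / t + 1 / (m : ℝ) = κ by rw [hκ]; ring, Real.mul_rpow (by positivity) hσ0.le,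
    show (4 : ℝ) / d = 4 * (1 / d) by ring,
    ENNReal.ofReal_rpow_of_nonneg (by positivity) hq0.le, Real.mul_rpow (by positivity) (by positivity),
    ENNReal.ofReal_mul (by positivity), ENNReal.ofReal_mul (by positivity),
    ENNReal.ofReal_mul (p := (8 * N) ^ (q / t)) (by positivity),
    ENNReal.ofReal_mul (q := σ ^ _) (by positivity),
    ENNReal.ofReal_mul (q := (1 / d) ^ (q / t)) (by positivity),
    ENNReal.ofReal_mul (q := (1 / d) ^ q) (by positivity), ENNReal.coe_mul,
    ENNReal.coe_rpow_of_nonneg _ hq0.le, 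
    show (((2 * N * 4 ^ q * (8 * N) ^ (q / t) * 4 ^ (m * κ * q)).toNNReal : ℝ≥0) : ℝ≥0∞) =
      ENNReal.ofReal (2 * N * 4 ^ q * (8 * N) ^ (q / t) * 4 ^ (m * κ * q)) from rfl,
    ENNReal.ofReal_mul (q := 4 ^ (m * κ * q)) (by positivity),
    ENNReal.ofReal_mul (q := (8 * N) ^ (q / t)) (by positivity),
    ENNReal.ofReal_mul (q := 4 ^ q) (by positivity),
    show ((2 * (m + 1) : ℕ) : ℝ≥0∞) = ENNReal.ofReal (2 * N) by
      rw [← ENNReal.ofReal_natCast]; congr 1; rw [hN]; push_cast; ring]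
  ring

theorem measurableSet_cube {n : ℕ} (x₀ : 𝔼[n]) (r : ℝ) : MeasurableSet {x | cubeN x₀ x ≤ r} :=
  (isClosed_le (continuous_cubeN x₀) continuous_const).measurableSet

theorem cube_subset_closedBall {n : ℕ} (x₀ : 𝔼[n]) (r : ℝ) :
    {x | cubeN x₀ x ≤ r} ⊆ closedBall x₀ (n * r) := fun x (hx : cubeN x₀ x ≤ r) =>
  (dist_le_cubeN x₀ x).trans (by gcongr)

theorem exists_sobolev_cube_const {n : ℕ} (R : ℝ) {p : ℝ} (hp : 1 ≤ p) (hpn : p < n) :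
    ∃ C : ℝ≥0, ∀ (v : 𝔼[n] → ℝ) (dv : 𝔼[n] → 𝔼[n]), HasWeakGrad v dv →
      ∀ A : Set 𝔼[n], MeasurableSet A → (∀ x, x ∉ A → v x = 0) → (∀ x, x ∉ A → dv x = 0) →
      ∀ x₀ a b, a < b → {x | cubeN x₀ x ≤ b} ⊆ closedBall 0 R →
        (∫⁻ x in {x | cubeN x₀ x ≤ a}, ‖v x‖ₑ ^ p) ^ (1 / p) ≤
          C * volume (A ∩ {x | cubeN x₀ x ≤ b}) ^ (1 / (n : ℝ)) *
          (∫⁻ x in {x | cubeN x₀ x ≤ b},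
            (‖dv x‖ₑ + ENNReal.ofReal (1 / (b - a)) * ‖v x‖ₑ) ^ p) ^ (1 / p) := by
  have hp0 : 0 < p := by linarith
  have hn0 : (0 : ℝ) < n := by linarith
  set s : ℝ := (1 / p - 1 / n)⁻¹ with hs
  have hs' : 0 < 1 / p - 1 / (n : ℝ) := sub_pos.2 (one_div_lt_one_div_of_lt hp0 hpn)
  have hs0 : 0 < s := inv_pos.2 hs'
  have hs1 : 1 / s = 1 / p - 1 / n := by rw [hs, one_div, inv_inv]
  have hps : p ≤ s := by
    refine (one_div_le_one_div hs0 hp0).1 ?_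
    rw [hs1]; have : 0 < 1 / (n : ℝ) := by positivity
    linarith
  obtain ⟨C, hC⟩ := exists_sobolev_const (n := n) R hp hpn hs0 hs1.ge
  refine ⟨C, fun v dv h A hA hvA hdA x₀ a b hab hR => ?_⟩
  obtain ⟨w, dw, hw, hwv, hwle, hw0, hdw⟩ := h.exists_cut x₀ hab
  set S : Set 𝔼[n] := A ∩ {x | cubeN x₀ x ≤ b} with hS
  have hSm : MeasurableSet S := hA.inter (measurableSet_cube _ _)
  have hwS : ∀ x, x ∉ S → w x = 0 := fun x hx => by
    by_cases hxA : x ∈ A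
    · exact (hw0 x fun hh => hx ⟨hxA, hh⟩).1
    · simpa [hvA x hxA] using hwle x
  have h1 : ∫⁻ x in {x | cubeN x₀ x ≤ a}, ‖v x‖ₑ ^ p ≤ ∫⁻ x in S, ‖w x‖ₑ ^ p := by
    rw [← lintegral_indicator hSm, ← lintegral_indicator (measurableSet_cube _ _)]
    refine lintegral_mono fun x => ?_
    by_cases hx : cubeN x₀ x ≤ a
    · by_cases hxS : x ∈ S
      · simp [indicator, hx, hxS, hwv x hx]
      · have h2 := hwS x hxS
        rw [hwv x hx] at h2
        simp [indicator, h2, hp0]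
    · simp [indicator, hx]
  have h2 : ∫⁻ x, ‖dw x‖ₑ ^ p ≤ ∫⁻ x in {x | cubeN x₀ x ≤ b},
            (‖dv x‖ₑ + ENNReal.ofReal (1 / (b - a)) * ‖v x‖ₑ) ^ p := by
    rw [← lintegral_indicator (measurableSet_cube _ _)]
    refine lintegral_mono fun x => ?_
    by_cases hx : cubeN x₀ x ≤ b
    · simp only [indicator, mem_ofPred_eq, hx, if_true]
      gcongr
      exact hdw x
    · simp [(hw0 x hx).2, hp0]
  have h3 := hC w dw hw fun x hx => hR (by
    by_contra hh
    exact hx (hw0 x hh).1)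
  have h4 := setLIntegral_rpow_le (μ := volume) (S := S) (f := fun x => ‖w x‖ₑ)
    hw.int.1.enorm.restrict hp0 hps
  have h5 := ENNReal.rpow_le_rpow (h1.trans h4) (show 0 ≤ 1 / p by positivity)
  rw [ENNReal.mul_rpow_of_nonneg _ _ (by positivity), ← ENNReal.rpow_mul, ← ENNReal.rpow_mul,
    show (1 - p / s) * (1 / p) = 1 / n by
      rw [div_eq_mul_one_div p s, hs1]; field_simp; ring,
    show p / s * (1 / p) = 1 / s by field_simp] at h5
  refine h5.trans ?_
  rw [mul_comm (C : ℝ≥0∞), mul_assoc]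
  gcongr
  calc (∫⁻ x in S, ‖w x‖ₑ ^ s) ^ (1 / s) ≤ (∫⁻ x, ‖w x‖ₑ ^ s) ^ (1 / s) := by
        gcongr; exact Measure.restrict_le_self
    _ ≤ _ := h3
    _ ≤ _ := by gcongr

theorem ae_tendsto_lintegral_cube_div {n : ℕ} (hn : n ≠ 0) {F : 𝔼[n] → ℝ≥0∞} (hF : AEMeasurable F)
    (hFi : ∫⁻ x, F x ≠ ∞) :
    ∀ᵐ x, F x = 0 → Filter.Tendsto
      (fun r => (∫⁻ y in {y | cubeN x y ≤ r}, F y) / ENNReal.ofReal r ^ n) (𝓝[>] 0) (𝓝 0) := by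
  have : Nonempty (Fin n) := ⟨⟨0, Nat.pos_of_ne_zero hn⟩⟩
  have hn0 : (0 : ℝ) < n := by exact_mod_cast Nat.pos_of_ne_zero hn
  filter_upwards [(Besicovitch.vitaliFamily (volume : Measure 𝔼[n])).ae_tendsto_lintegral_div hF hFi]
    with x hx hx0
  rw [hx0] at hx
  have h1 := hx.comp (Besicovitch.tendsto_filterAt volume x)
  have h2 : Filter.Tendsto (fun r : ℝ => n * r) (𝓝[>] 0) (𝓝[>] 0) := by
    refine tendsto_nhdsWithin_iff.2 ⟨?_, ?_⟩
    · have : Filter.Tendsto (fun r : ℝ => n * r) (𝓝 0) (𝓝 (n * 0)) := 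
        (continuous_const.mul continuous_id).tendsto _
      rw [mul_zero] at this
      exact this.mono_left nhdsWithin_le_nhds
    · filter_upwards [self_mem_nhdsWithin] with r hr
      exact mul_pos hn0 hr
  have h3 := h1.comp h2
  set c : ℝ≥0∞ := volume (closedBall (0 : 𝔼[n]) n) with hc
  have hct : c ≠ ∞ := measure_closedBall_lt_top.ne
  have h4 := ENNReal.Tendsto.const_mul (a := c) h3 (Or.inr hct)
  rw [mul_zero] at h4
  refine tendsto_of_tendsto_of_tendsto_of_le_of_le' tendsto_const_nhds h4
    (Filter.Eventually.of_forall fun _ => zero_le) ?_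
  filter_upwards [self_mem_nhdsWithin] with r (hr : 0 < r)
  simp only [Function.comp_apply]
  have hv : volume (closedBall x (n * r)) = ENNReal.ofReal r ^ n * c := by
    rw [hc, EuclideanSpace.volume_closedBall, EuclideanSpace.volume_closedBall, Fintype.card_fin,
      ENNReal.ofReal_mul hn0.le, mul_pow]
    ring
  have hc0 : c ≠ 0 := (measure_closedBall_pos _ _ hn0).ne'
  rw [hv, ENNReal.div_eq_inv_mul, ENNReal.div_eq_inv_mul, ENNReal.mul_inv (Or.inr hct) (Or.inr hc0)]
  calc _ ≤ (ENNReal.ofReal r ^ n)⁻¹ * ∫⁻ y in closedBall x (n * r), F y :=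
        mul_le_mul_right (lintegral_mono_set (cube_subset_closedBall x r)) _
    _ = _ := by
        rw [← mul_assoc c, mul_comm c, mul_assoc _ c⁻¹ c, ENNReal.inv_mul_cancel hc0 hct, mul_one]

theorem tendsto_zero_of_le_mul_one_add {y ω : ℕ → ℝ≥0∞} (hy : ∀ j, y j ≠ ∞)
    (h : ∀ᶠ j in Filter.atTop, y (j + 1) ≤ ω j * (1 + y j))
    (hω : Filter.Tendsto ω Filter.atTop (𝓝 0)) : Filter.Tendsto y Filter.atTop (𝓝 0) := by
  have h2 : ∀ᶠ j in Filter.atTop, ω j ≤ 1 / 2 := by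
    have := hω.eventually (eventually_lt_nhds (show (0 : ℝ≥0∞) < 1 / 2 by simp))
    exact this.mono fun j hj => hj.le
  obtain ⟨J, hJ⟩ := Filter.eventually_atTop.1 (h.and h2)
  set M : ℝ≥0∞ := max 1 (y J) with hM
  have hMt : M ≠ ∞ := by simp [hM, hy J]
  have hb : ∀ j, y (J + j) ≤ M := by
    intro j
    induction j with
    | zero => exact le_max_right _ _
    | succ k ih =>
      obtain ⟨h3, h4⟩ := hJ (J + k) (Nat.le_add_right _ _)
      calc y (J + k + 1) ≤ 1 / 2 * (M + M) := h3.trans (by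
            gcongr
            exact le_max_left _ _)
        _ = M := by rw [← two_mul, ← mul_assoc, ENNReal.div_mul_cancel (by simp) (by simp), one_mul]
  rw [← Filter.tendsto_add_atTop_iff_nat (J + 1)]
  have h5 : Filter.Tendsto (fun j => ω (j + J) * (1 + M)) Filter.atTop (𝓝 0) := by
    have := ENNReal.Tendsto.mul_const (b := 1 + M) ((Filter.tendsto_add_atTop_iff_nat J).2 hω)
      (Or.inr (by simp [hMt]))
    rwa [zero_mul] at this
  refine tendsto_of_tendsto_of_tendsto_of_le_of_le tendsto_const_nhds h5 (fun _ => zero_le)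
    fun j => ?_
  have h6 := (hJ (j + J) (Nat.le_add_left _ _)).1
  have h7 := hb j
  rw [add_comm] at h7
  exact h6.trans (by gcongr)

theorem ae_exists_good_radius {n : ℕ} {p : ℝ} (hp : 1 ≤ p) (hpn : p < n) {v : 𝔼[n] → ℝ}
    {dv : 𝔼[n] → 𝔼[n]} (h : HasWeakGrad v dv) {A : Set 𝔼[n]} (hA : MeasurableSet A)
    (hvA : ∀ x, x ∉ A → v x = 0) (hdA : ∀ x, x ∉ A → dv x = 0) (hAt : volume A ≠ ∞)
    (hv : ∫⁻ x, ‖v x‖ₑ ^ p ≠ ∞) (hdv : ∫⁻ x, ‖dv x‖ₑ ^ p ≠ ∞) :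
    ∀ᵐ x, x ∉ A → ∀ ε : ℝ≥0∞, ε ≠ 0 → ∀ r₀ > 0, ∃ r ∈ Ioo 0 r₀,
      volume (A ∩ {y | cubeN x y ≤ r}) ≤ ε * ENNReal.ofReal r ^ n ∧
      ∫⁻ y in {y | cubeN x y ≤ r}, ‖dv y‖ₑ ^ p ≤ ε * ENNReal.ofReal r ^ n ∧
      ∫⁻ y in {y | cubeN x y ≤ r}, ‖v y‖ₑ ^ p ≤
        ε * (ENNReal.ofReal r ^ n * ENNReal.ofReal r ^ p) := by
  have hp0 : 0 < p := by linarith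
  have hn0 : (0 : ℝ) < n := by linarith
  have hn : n ≠ 0 := by rintro rfl; simp at hn0
  have hαF : ∫⁻ x, A.indicator (fun _ => (1 : ℝ≥0∞)) x ≠ ∞ := by
    rw [lintegral_indicator_const hA]; simpa using hAt
  filter_upwards [ae_tendsto_lintegral_cube_div hn
      ((aemeasurable_const (b := (1 : ℝ≥0∞))).indicator hA) hαF,
    ae_tendsto_lintegral_cube_div hn (h.int_grad.1.enorm.pow_const p) hdv] with x hα hβ hxA
  replace hα := hα (by simp [hxA])
  replace hβ := hβ (by simp [hdA x hxA, hp0])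
  have hvol : ∀ r, ∫⁻ y in {y | cubeN x y ≤ r}, A.indicator (fun _ => (1 : ℝ≥0∞)) y =
      volume (A ∩ {y | cubeN x y ≤ r}) := fun r => by
    rw [lintegral_indicator_const hA, Measure.restrict_apply hA, one_mul]
  simp only [hvol] at hα
  set r : ℕ → ℝ := fun j => (1 / 2) ^ j with hr
  have hr0 : ∀ j, 0 < r j := fun j => by positivity
  have hrt : Filter.Tendsto r Filter.atTop (𝓝[>] 0) :=
    tendsto_nhdsWithin_iff.2 ⟨tendsto_pow_atTop_nhds_zero_of_lt_one (by norm_num) (by norm_num),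
      Filter.Eventually.of_forall hr0⟩
  set ρ : ℕ → ℝ≥0∞ := fun j => ENNReal.ofReal (r j) with hρ
  have hρ0 : ∀ j, ρ j ≠ 0 := fun j => by simpa [hρ] using hr0 j
  have hρt : ∀ j, ρ j ≠ ∞ := fun j => ENNReal.ofReal_ne_top
  have hρ2 : ∀ j, ρ j = 2 * ρ (j + 1) := fun j => by
    rw [hρ]; simp only
    rw [← ENNReal.ofReal_ofNat 2, ← ENNReal.ofReal_mul (by norm_num), hr]
    simp only [pow_succ]
    congr 1; ring
  have hα' := hα.comp hrt
  have hβ' := hβ.comp hrt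
  set α : ℕ → ℝ≥0∞ := (fun r => volume (A ∩ {y | cubeN x y ≤ r}) / ENNReal.ofReal r ^ n) ∘ r
    with hαdef
  set β : ℕ → ℝ≥0∞ :=
    (fun r => (∫⁻ y in {y | cubeN x y ≤ r}, ‖dv y‖ₑ ^ p) / ENNReal.ofReal r ^ n) ∘ r with hβdef
  have hα2 : ∀ j, volume (A ∩ {y | cubeN x y ≤ r j}) = α j * ρ j ^ n := fun j =>
    (ENNReal.div_mul_cancel (pow_ne_zero _ (hρ0 j)) (ENNReal.pow_ne_top (hρt j))).symm
  have hβ2 : ∀ j, ∫⁻ y in {y | cubeN x y ≤ r j}, ‖dv y‖ₑ ^ p = β j * ρ j ^ n := fun j =>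
    (ENNReal.div_mul_cancel (pow_ne_zero _ (hρ0 j)) (ENNReal.pow_ne_top (hρt j))).symm
  set e : ℕ → ℝ≥0∞ := fun j => (∫⁻ y in {y | cubeN x y ≤ r j}, ‖v y‖ₑ ^ p) ^ (1 / p) with he
  have het : ∀ j, e j ≠ ∞ := fun j =>
    ENNReal.rpow_ne_top_of_nonneg (by positivity)
      (ne_top_of_le_ne_top hv (lintegral_mono' Measure.restrict_le_self le_rfl))
  set D : ℕ → ℝ≥0∞ := fun j => ρ j * ρ j ^ (n / p) with hD
  have hpw0 : ∀ j, ρ j ^ (n / p : ℝ) ≠ 0 := fun j => by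
    simp [ENNReal.rpow_eq_zero_iff, hρ0 j, hρt j]
  have hpwt : ∀ j, ρ j ^ (n / p : ℝ) ≠ ∞ := fun j =>
    ENNReal.rpow_ne_top_of_nonneg (by positivity) (hρt j)
  have hD0 : ∀ j, D j ≠ 0 := fun j => mul_ne_zero (hρ0 j) (hpw0 j)
  have hDt : ∀ j, D j ≠ ∞ := fun j => ENNReal.mul_ne_top (hρt j) (hpwt j)
  set y : ℕ → ℝ≥0∞ := fun j => e j / D j with hy
  have hey : ∀ j, e j = y j * D j := fun j => (ENNReal.div_mul_cancel (hD0 j) (hDt j)).symm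
  obtain ⟨C, hC⟩ := exists_sobolev_cube_const (n := n) (‖x‖ + n) hp hpn
  have hstep : ∀ j, y (j + 1) ≤
      (C * 2 * 2 ^ (n / p : ℝ) * (α j ^ (1 / n : ℝ) * (β j ^ (1 / p) + 2))) * (1 + y j) := by
    intro j
    have hsub : {y | cubeN x y ≤ r j} ⊆ closedBall 0 (‖x‖ + n) := by
      refine (cube_subset_closedBall x _).trans (closedBall_subset_closedBall' ?_)
      rw [dist_zero_right, add_comm]
      gcongr
      exact mul_le_of_le_one_right hn0.le (pow_le_one₀ (by norm_num) (by norm_num))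
    have hlt : r (j + 1) < r j := pow_lt_pow_right_of_lt_one₀ (by norm_num) (by norm_num) (by simp)
    have h1 := hC v dv h A hA hvA hdA x (r (j + 1)) (r j) hlt hsub
    have hrr : r j - r (j + 1) = r (j + 1) := by simp only [hr, pow_succ]; ring
    have h2 : (∫⁻ y in {y | cubeN x y ≤ r j},
        (‖dv y‖ₑ + ENNReal.ofReal (1 / (r j - r (j + 1))) * ‖v y‖ₑ) ^ p) ^ (1 / p) ≤
        (β j * ρ j ^ n) ^ (1 / p) + (ρ (j + 1))⁻¹ * e j := by
      refine (ENNReal.lintegral_Lp_add_le h.int_grad.1.enorm.restrict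
        (h.int.1.enorm.restrict.const_mul _) hp).trans ?_
      rw [hβ2, hrr, one_div (r (j + 1)), ENNReal.ofReal_inv_of_pos (hr0 _)]
      gcongr
      simp only [ENNReal.mul_rpow_of_nonneg _ _ hp0.le]
      rw [lintegral_const_mul' _ _ (ENNReal.rpow_ne_top_of_nonneg hp0.le
        (ENNReal.inv_ne_top.2 (hρ0 _))), ENNReal.mul_rpow_of_nonneg _ _ (by positivity),
        ← ENNReal.rpow_mul, mul_one_div_cancel hp0.ne', ENNReal.rpow_one]
    have h3 : e (j + 1) ≤ C * (α j * ρ j ^ n) ^ (1 / n : ℝ) *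
        ((β j * ρ j ^ n) ^ (1 / p) + (ρ (j + 1))⁻¹ * e j) := by
      refine h1.trans ?_
      rw [hα2]
      gcongr
    have hn1 : ∀ z : ℝ≥0∞, (z ^ n) ^ (1 / n : ℝ) = z := fun z => by
      rw [← ENNReal.rpow_natCast, ← ENNReal.rpow_mul, mul_one_div_cancel hn0.ne', ENNReal.rpow_one]
    have hn2 : ∀ z : ℝ≥0∞, (z ^ n) ^ (1 / p) = z ^ (n / p : ℝ) := fun z => by
      rw [← ENNReal.rpow_natCast, ← ENNReal.rpow_mul, mul_one_div]
    rw [ENNReal.mul_rpow_of_nonneg _ _ (by positivity), hn1,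
      ENNReal.mul_rpow_of_nonneg _ _ (by positivity), hn2, hey j] at h3
    simp only [hy]
    rw [ENNReal.div_le_iff (hD0 _) (hDt _)]
    refine h3.trans ?_
    simp only [hD]
    have hcan : (ρ (j + 1))⁻¹ * ρ j = 2 := by
      rw [hρ2 j, mul_comm, mul_assoc, ENNReal.mul_inv_cancel (hρ0 _) (hρt _), mul_one]
    calc C * (α j ^ (1 / n : ℝ) * ρ j) * (β j ^ (1 / p) * ρ j ^ (n / p : ℝ) +
          (ρ (j + 1))⁻¹ * (y j * (ρ j * ρ j ^ (n / p : ℝ))))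
        = C * α j ^ (1 / n : ℝ) * ρ j * ρ j ^ (n / p : ℝ) *
          (β j ^ (1 / p) + (ρ (j + 1))⁻¹ * ρ j * y j) := by ring
      _ = C * 2 * 2 ^ (n / p : ℝ) * α j ^ (1 / n : ℝ) * (β j ^ (1 / p) + 2 * y j) *
          (ρ (j + 1) * ρ (j + 1) ^ (n / p : ℝ)) := by
          rw [hcan, hρ2 j, ENNReal.mul_rpow_of_nonneg _ _ (by positivity)]; ring
      _ ≤ C * 2 * 2 ^ (n / p : ℝ) * α j ^ (1 / n : ℝ) * ((β j ^ (1 / p) + 2) * (1 + y j)) *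
          (ρ (j + 1) * ρ (j + 1) ^ (n / p : ℝ)) := by
          gcongr
          calc β j ^ (1 / p) + 2 * y j ≤ β j ^ (1 / p) + 2 * y j + (2 + β j ^ (1 / p) * y j) :=
                le_self_add
            _ = _ := by ring
      _ = _ := by simp only [hy]; ring
  have hω : Filter.Tendsto (fun j => C * 2 * 2 ^ (n / p : ℝ) *
      (α j ^ (1 / n : ℝ) * (β j ^ (1 / p) + 2))) Filter.atTop (𝓝 0) := by
    have h1 : Filter.Tendsto (fun j => α j ^ (1 / n : ℝ)) Filter.atTop (𝓝 0) := by
      have := hα'.ennrpow_const (1 / n : ℝ)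
      rwa [ENNReal.zero_rpow_of_pos (by positivity)] at this
    have h2 : Filter.Tendsto (fun j => β j ^ (1 / p) + 2) Filter.atTop (𝓝 (0 + 2)) := by
      have := hβ'.ennrpow_const (1 / p)
      rw [ENNReal.zero_rpow_of_pos (by positivity)] at this
      exact this.add_const 2
    have h3 := ENNReal.Tendsto.mul h1 (Or.inr (by simp)) h2 (Or.inr (by simp))
    have h4 := ENNReal.Tendsto.const_mul (a := C * 2 * 2 ^ (n / p : ℝ)) h3 (Or.inr (by
      refine ENNReal.mul_ne_top (by finiteness) ?_
      exact ENNReal.rpow_ne_top_of_nonneg (by positivity) (by simp)))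
    simpa using h4
  have hyt := tendsto_zero_of_le_mul_one_add
    (fun j => (ENNReal.div_ne_top (het j) (hD0 j) : y j ≠ ∞))
    (Filter.Eventually.of_forall hstep) hω
  intro ε hε r₀ hr₀
  have hεp : (0 : ℝ≥0∞) < ε ^ (1 / p) := by
    rw [pos_iff_ne_zero, Ne, ENNReal.rpow_eq_zero_iff]
    rintro (⟨h1, _⟩ | ⟨_, h2⟩)
    · exact hε h1
    · have : 0 < 1 / p := by positivity
      linarith
  obtain ⟨j, h1, h2, h3, h4⟩ := ((hα'.eventually (eventually_lt_nhds (pos_iff_ne_zero.2 hε))).and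
    ((hβ'.eventually (eventually_lt_nhds (pos_iff_ne_zero.2 hε))).and
    ((hyt.eventually (eventually_lt_nhds hεp)).and
      ((tendsto_nhdsWithin_iff.1 hrt).1.eventually (eventually_lt_nhds hr₀))))).exists
  refine ⟨r j, ⟨hr0 j, h4⟩, ?_, ?_, ?_⟩
  · rw [hα2]; exact mul_le_mul_left h1.le _
  · rw [hβ2]; exact mul_le_mul_left h2.le _
  · have h5 : e j ≤ ε ^ (1 / p) * D j := by rw [hey]; gcongr
    have h6 := ENNReal.rpow_le_rpow h5 hp0.le
    simp only [he, hD] at h6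
    rw [← ENNReal.rpow_mul, one_div_mul_cancel hp0.ne', ENNReal.rpow_one,
      ENNReal.mul_rpow_of_nonneg _ _ hp0.le, ENNReal.mul_rpow_of_nonneg _ _ hp0.le,
      ← ENNReal.rpow_mul, ← ENNReal.rpow_mul, one_div_mul_cancel hp0.ne', ENNReal.rpow_one,
      div_mul_cancel₀ _ hp0.ne', ENNReal.rpow_natCast, mul_comm (ρ j ^ p)] at h6
    exact h6

theorem volume_toLp_preimage {n : ℕ} (S : Set 𝔼[n]) :
    volume ((fun y : Fin n → ℝ => (WithLp.toLp 2 y : 𝔼[n])) ⁻¹' S) = volume S :=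
  (PiLp.volume_preserving_toLp (Fin n)).measure_preimage_equiv
    (f := MeasurableEquiv.toLp 2 (Fin n → ℝ)) S

theorem cubeN_toLp {n : ℕ} (x : 𝔼[n]) (y : Fin n → ℝ) :
    cubeN x (WithLp.toLp 2 y) = dist y (WithLp.ofLp x) := by
  rw [cubeN, dist_eq_norm, WithLp.ofLp_sub]

theorem volume_cube {n : ℕ} (x : 𝔼[n]) {r : ℝ} (hr : 0 ≤ r) :
    volume {y | cubeN x y ≤ r} = ENNReal.ofReal ((2 * r) ^ n) := by
  rw [← volume_toLp_preimage]
  have : (fun y : Fin n → ℝ => (WithLp.toLp 2 y : 𝔼[n])) ⁻¹' {y | cubeN x y ≤ r} =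
      closedBall (WithLp.ofLp x) r := by
    ext y; simp [cubeN_toLp]
  rw [this, Real.volume_pi_closedBall _ hr, Fintype.card_fin]

theorem volume_cube_lt {n : ℕ} (x : 𝔼[n]) {r : ℝ} (hr : 0 < r) :
    volume {y | cubeN x y < r} = ENNReal.ofReal ((2 * r) ^ n) := by
  rw [← volume_toLp_preimage]
  have : (fun y : Fin n → ℝ => (WithLp.toLp 2 y : 𝔼[n])) ⁻¹' {y | cubeN x y < r} =
      ball (WithLp.ofLp x) r := by
    ext y; simp [cubeN_toLp]
  rw [this, Real.volume_pi_ball _ hr, Fintype.card_fin]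

theorem volume_cube_diff_le {n : ℕ} (x : 𝔼[n]) {r τ : ℝ} (hr : 0 < r) (hτ : 0 ≤ τ) (hτ1 : τ < 1) :
    volume ({y | cubeN x y ≤ r} \ {y | cubeN x y < (1 - τ) * r}) ≤
      ENNReal.ofReal (n * τ) * volume {y | cubeN x y ≤ r} := by
  have h1 : 0 < (1 - τ) * r := mul_pos (by linarith) hr
  have hsub : {y | cubeN x y < (1 - τ) * r} ⊆ {y | cubeN x y ≤ r} := fun y hy => by
    simp only [mem_ofPred_eq] at hy ⊢
    nlinarith
  rw [measure_sdiff hsub (isOpen_lt (continuous_cubeN x) continuous_const).measurableSet.nullMeasurableSet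
    (by rw [volume_cube_lt _ h1]; simp), volume_cube _ hr.le, volume_cube_lt _ h1,
    ← ENNReal.ofReal_sub _ (by positivity), ← ENNReal.ofReal_mul (by positivity)]
  refine ENNReal.ofReal_le_ofReal ?_
  have hb := one_add_mul_le_pow (show (-2 : ℝ) ≤ -τ by linarith) n
  rw [show 2 * ((1 - τ) * r) = (1 + -τ) * (2 * r) by ring, mul_pow (1 + -τ) (2 * r)]
  have := mul_le_mul_of_nonneg_right hb (show 0 ≤ (2 * r) ^ n by positivity)
  linarith

theorem exists_disjoint_cubes {n : ℕ} (f : 𝔼[n] → Set ℝ) (s : Set 𝔼[n])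
    (hf : ∀ x ∈ s, ∀ δ > 0, (f x ∩ Ioo 0 δ).Nonempty) {R : ℝ} (hR : 0 < R) :
    ∃ (t : Set 𝔼[n]) (r : 𝔼[n] → ℝ), t.Countable ∧ t ⊆ s ∧ (∀ x ∈ t, r x ∈ f x ∩ Ioo 0 R) ∧
      volume (s \ ⋃ x ∈ t, {y | cubeN x y ≤ r x}) = 0 ∧
      t.PairwiseDisjoint fun x => {y | cubeN x y ≤ r x} := by
  obtain ⟨t, r, htc, hts, hr, hcov, hdisj⟩ :=
    Besicovitch.exists_disjoint_closedBall_covering_ae (volume : Measure (Fin n → ℝ))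
      (fun y => f (WithLp.toLp 2 y)) ((fun y : Fin n → ℝ => (WithLp.toLp 2 y : 𝔼[n])) ⁻¹' s)
      (fun y hy => hf _ hy) (fun _ => R) fun _ _ => hR
  refine ⟨WithLp.toLp 2 '' t, fun x => r (WithLp.ofLp x), htc.image _, ?_, ?_, ?_, ?_⟩
  · rintro _ ⟨y, hy, rfl⟩; exact hts hy
  · rintro _ ⟨y, hy, rfl⟩; exact hr y hy
  · rw [← volume_toLp_preimage]
    convert hcov using 2
    ext y
    simp [cubeN_toLp, mem_sdiff]
  · rintro _ ⟨y, hy, rfl⟩ _ ⟨z, hz, rfl⟩ hyz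
    have h1 : Disjoint (closedBall y (r y)) (closedBall z (r z)) :=
      hdisj hy hz (by rintro rfl; exact hyz rfl)
    refine Set.disjoint_left.2 fun x hx hx' => ?_
    have h2 : WithLp.ofLp x ∈ closedBall y (r y) := by
      rw [mem_closedBall, ← cubeN_toLp (WithLp.toLp 2 y) (WithLp.ofLp x)]; exact hx
    have h3 : WithLp.ofLp x ∈ closedBall z (r z) := by
      rw [mem_closedBall, ← cubeN_toLp (WithLp.toLp 2 z) (WithLp.ofLp x)]; exact hx'
    exact Set.disjoint_left.1 h1 h2 h3

theorem exists_finset_cover {α β : Type*} [MeasurableSpace α] {μ : Measure α} {t : Set β}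
    (htc : t.Countable) {C : β → Set α} (hC : ∀ x, MeasurableSet (C x)) (hd : t.PairwiseDisjoint C)
    {B : Set α} (hB : μ B ≠ ∞) (hCB : ∀ x ∈ t, C x ⊆ B) {s : Set α}
    (hs : μ (s \ ⋃ x ∈ t, C x) = 0) {δ : ℝ≥0∞} (hδ : δ ≠ 0) :
    ∃ F : Finset β, ↑F ⊆ t ∧ μ (s \ ⋃ x ∈ F, C x) ≤ δ ∧ ∑ x ∈ F, μ (C x) ≤ μ B := by
  have hsum : ∑' x : t, μ (C x) ≤ μ B := by
    have := measure_biUnion (μ := μ) htc hd fun x _ => hC x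
    rw [← this]
    exact measure_mono (iUnion₂_subset hCB)
  have htend := ENNReal.tendsto_tsum_compl_atTop_zero (ne_top_of_le_ne_top hB hsum)
  obtain ⟨F, hF⟩ := (htend.eventually (eventually_lt_nhds (pos_iff_ne_zero.2 hδ))).exists
  refine ⟨F.map (Function.Embedding.subtype _), by
    intro x hx; simp only [Finset.coe_map, mem_image] at hx
    obtain ⟨y, _, rfl⟩ := hx; exact y.2, ?_, ?_⟩
  · calc μ (s \ ⋃ x ∈ F.map (Function.Embedding.subtype _), C x)
        ≤ μ ((s \ ⋃ x ∈ t, C x) ∪ ⋃ x : {x : t // x ∉ F}, C x) := by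
          refine measure_mono fun y hy => ?_
          by_cases h : y ∈ ⋃ x ∈ t, C x
          · right
            simp only [mem_iUnion] at h
            obtain ⟨x, hx, hyx⟩ := h
            refine mem_iUnion.2 ⟨⟨⟨x, hx⟩, fun hxF => hy.2 ?_⟩, hyx⟩
            simp only [mem_iUnion]
            exact ⟨x, Finset.mem_map.2 ⟨⟨x, hx⟩, hxF, rfl⟩, hyx⟩
          · exact Or.inl ⟨hy.1, h⟩
      _ ≤ 0 + ∑' x : {x : t // x ∉ F}, μ (C x) := by
          have := htc.to_subtype
          refine (measure_union_le _ _).trans (add_le_add hs.le (measure_iUnion_le _))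
      _ ≤ δ := by rw [zero_add]; exact hF.le
  · rw [Finset.sum_map]
    exact (ENNReal.sum_le_tsum F).trans hsum

theorem cutoff_cost_le_of_density {m : ℕ} (hm : 1 ≤ m) {p q t τ r : ℝ} (ht : 1 ≤ t) (htp : t < p)
    (hpq : p < q) (hτ : 0 < τ) (hr : 0 < r) {V E ε : ℝ≥0∞}
    (hV : V ≤ ε * ENNReal.ofReal r ^ (m + 1)) {D : ℝ≥0∞}
    (hE : E ≤ D * (ε * ENNReal.ofReal r ^ (m + 1))) :
    ENNReal.ofReal ((r - (1 - τ) * r) * (1 / (r - (1 - τ) * r)) ^ q *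
        (1 / (r - (1 - τ) * r)) ^ (q / t) * r ^ (m * (1 / q - 1 / t + 1 / m) * q)) *
      V ^ (q * (1 / t - 1 / p)) * E ^ (q / p) ≤
    ENNReal.ofReal (τ * (1 / τ) ^ q * (1 / τ) ^ (q / t)) * D ^ (q / p) * ε ^ (q / t) *
      ENNReal.ofReal r ^ (m + 1) := by
  have hq : 0 < q := by linarith
  have hp : 0 < p := by linarith
  have ht0 : 0 < t := by linarith
  have hm0 : (0 : ℝ) < m := by exact_mod_cast hm
  have hs1 : 0 ≤ q * (1 / t - 1 / p) := by
    refine mul_nonneg hq.le (sub_nonneg.2 (one_div_le_one_div_of_le ht0 htp.le))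
  have hs2 : 0 ≤ q / p := by positivity
  have hst : q * (1 / t - 1 / p) + q / p = q / t := by field_simp; ring
  have hreal : (r - (1 - τ) * r) * (1 / (r - (1 - τ) * r)) ^ q *
        (1 / (r - (1 - τ) * r)) ^ (q / t) * r ^ (m * (1 / q - 1 / t + 1 / m) * q) *
        (r ^ (m + 1)) ^ (q / t) =
      τ * (1 / τ) ^ q * (1 / τ) ^ (q / t) * r ^ (m + 1) := by
    have e1 : r - (1 - τ) * r = τ * r := by ring
    have e2 : 1 / (τ * r) = 1 / τ * r⁻¹ := by field_simp
    have e3 : r ^ (m + 1) = r ^ ((m : ℝ) + 1) := by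
      rw [← Real.rpow_natCast]; push_cast; rfl
    rw [e1, e2, Real.mul_rpow (by positivity) (by positivity),
      Real.mul_rpow (by positivity) (by positivity), Real.inv_rpow hr.le, Real.inv_rpow hr.le,
      ← Real.rpow_neg hr.le, ← Real.rpow_neg hr.le, e3, ← Real.rpow_mul hr.le]
    have e4 : r * r ^ (-q) * r ^ (-(q / t)) * r ^ (m * (1 / q - 1 / t + 1 / m) * q) *
        r ^ (((m : ℝ) + 1) * (q / t)) = r ^ ((m : ℝ) + 1) := by
      nth_rewrite 1 [← Real.rpow_one r]
      rw [← Real.rpow_add hr, ← Real.rpow_add hr, ← Real.rpow_add hr, ← Real.rpow_add hr]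
      congr 1
      field_simp
      ring
    rw [← e4]; ring
  calc _ ≤ ENNReal.ofReal ((r - (1 - τ) * r) * (1 / (r - (1 - τ) * r)) ^ q *
        (1 / (r - (1 - τ) * r)) ^ (q / t) * r ^ (m * (1 / q - 1 / t + 1 / m) * q)) *
        (ε * ENNReal.ofReal r ^ (m + 1)) ^ (q * (1 / t - 1 / p)) *
        (D * (ε * ENNReal.ofReal r ^ (m + 1))) ^ (q / p) := by gcongr
    _ = ENNReal.ofReal ((r - (1 - τ) * r) * (1 / (r - (1 - τ) * r)) ^ q *
        (1 / (r - (1 - τ) * r)) ^ (q / t) * r ^ (m * (1 / q - 1 / t + 1 / m) * q)) *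
        ((ENNReal.ofReal r ^ (m + 1)) ^ (q / t)) * D ^ (q / p) * ε ^ (q / t) := by
      rw [ENNReal.mul_rpow_of_nonneg D _ hs2, ← hst, ENNReal.rpow_add_of_nonneg _ _ hs1 hs2,
        ENNReal.rpow_add_of_nonneg _ _ hs1 hs2, ENNReal.mul_rpow_of_nonneg _ _ hs2,
        ENNReal.mul_rpow_of_nonneg _ _ hs1]
      ring
    _ = _ := by
      rw [← ENNReal.ofReal_pow hr.le, ENNReal.ofReal_rpow_of_pos (by positivity),
        ← ENNReal.ofReal_mul' (by positivity), hreal, ENNReal.ofReal_mul (by positivity)]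
      ring

theorem lintegral_add_mul_rpow_le {α : Type*} [MeasurableSpace α] {μ : Measure α} {F G : α → ℝ≥0∞}
    (hF : AEMeasurable F μ) {c : ℝ≥0∞} (hc : c ≠ ∞) {p : ℝ} (hp : 1 ≤ p) :
    ∫⁻ x, (F x + c * G x) ^ p ∂μ ≤
      2 ^ (p - 1) * (∫⁻ x, F x ^ p ∂μ + c ^ p * ∫⁻ x, G x ^ p ∂μ) := by
  have hp0 : 0 ≤ p := by linarith
  have h2 : (2 : ℝ≥0∞) ^ (p - 1) ≠ ∞ := ENNReal.rpow_ne_top_of_nonneg (by linarith) (by simp)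
  calc ∫⁻ x, (F x + c * G x) ^ p ∂μ ≤ ∫⁻ x, 2 ^ (p - 1) * (F x ^ p + c ^ p * G x ^ p) ∂μ := by
        refine lintegral_mono fun x => ?_
        rw [← ENNReal.mul_rpow_of_nonneg _ _ hp0]
        exact ENNReal.rpow_add_le_mul_rpow_add_rpow _ _ hp
    _ = _ := by
        rw [lintegral_const_mul' _ _ h2, lintegral_add_left' (hF.pow_const p),
          lintegral_const_mul' _ _ (ENNReal.rpow_ne_top_of_nonneg hp0 hc)]

theorem exists_lipschitz_finset_sum {ι X : Type*} [PseudoEMetricSpace X] (F : Finset ι)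
    {η : ι → X → ℝ} (h : ∀ i ∈ F, ∃ K, LipschitzWith K (η i)) :
    ∃ K, LipschitzWith K fun x => ∑ i ∈ F, η i x := by
  classical
  induction F using Finset.induction_on with
  | empty => exact ⟨0, by simp⟩
  | insert a s ha ih =>
    obtain ⟨K, hK⟩ := ih fun i hi => h i (Finset.mem_insert_of_mem hi)
    obtain ⟨K', hK'⟩ := h a (Finset.mem_insert_self _ _)
    refine ⟨K' + K, ?_⟩
    simp_rw [Finset.sum_insert ha]
    exact hK'.add hK

theorem sum_eq_of_disjoint_cubes {n : ℕ} {F : Finset 𝔼[n]} {r : 𝔼[n] → ℝ}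
    (hd : (F : Set 𝔼[n]).PairwiseDisjoint fun x => {y | cubeN x y ≤ r x})
    {η : 𝔼[n] → 𝔼[n] → ℝ} (hη : ∀ x ∈ F, ∀ y, r x < cubeN x y → η x y = 0)
    {x₀ y : 𝔼[n]} (hx₀ : x₀ ∈ F) (hy : cubeN x₀ y ≤ r x₀) : ∑ x ∈ F, η x y = η x₀ y := by
  refine Finset.sum_eq_single x₀ (fun x hx hne => hη x hx y ?_) fun h => absurd hx₀ h
  by_contra hcon
  exact Set.disjoint_left.1 (hd hx hx₀ hne) (not_lt.1 hcon) hy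

theorem enorm_gradient_one_sub_sum_le {n : ℕ} {F : Finset 𝔼[n]} {r : 𝔼[n] → ℝ}
    (hd : (F : Set 𝔼[n]).PairwiseDisjoint fun x => {y | cubeN x y ≤ r x})
    {η : 𝔼[n] → 𝔼[n] → ℝ} (hη : ∀ x ∈ F, ∀ y, r x < cubeN x y → η x y = 0) {q : ℝ} (hq : 0 < q)
    (y : 𝔼[n]) : ‖gradient (fun z => 1 - ∑ x ∈ F, η x z) y‖ₑ ^ q ≤
      ∑ x ∈ F, ‖gradient (η x) y‖ₑ ^ q := by
  classical
  have key : ∀ G : Finset 𝔼[n], G ⊆ F → (∀ x ∈ F, x ∉ G → r x < cubeN x y) →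
      (fun z => 1 - ∑ x ∈ F, η x z) =ᶠ[𝓝 y] fun z => 1 - ∑ x ∈ G, η x z := by
    intro G hG hGy
    have : ∀ᶠ z in 𝓝 y, ∀ x ∈ F, x ∉ G → r x < cubeN x z := by
      rw [Filter.eventually_all_finset]
      intro x hx
      by_cases hxG : x ∈ G
      · exact Filter.Eventually.of_forall fun z h => absurd hxG h
      · filter_upwards [(continuous_cubeN x).continuousAt.eventually_const_lt (hGy x hx hxG)]
          with z hz _ using hz
    filter_upwards [this] with z hz
    rw [Finset.sum_subset hG fun x hx hxG => hη x hx z (hz x hx hxG)]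
  by_cases hex : ∃ x₀ ∈ F, cubeN x₀ y ≤ r x₀
  · obtain ⟨x₀, hx₀, hy⟩ := hex
    have h1 := key {x₀} (by simpa using hx₀) fun x hx hne => by
      by_contra hcon
      exact Set.disjoint_left.1 (hd hx hx₀ (by simpa using hne)) (not_lt.1 hcon) hy
    have h2 : ‖gradient (fun z => 1 - ∑ x ∈ F, η x z) y‖ₑ = ‖gradient (η x₀) y‖ₑ := by
      rw [← ofReal_norm, ← ofReal_norm, norm_gradient, norm_gradient, h1.fderiv_eq]
      simp only [Finset.sum_singleton]
      rw [fderiv_const_sub, norm_neg]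
    rw [h2]
    exact Finset.single_le_sum (f := fun x => ‖gradient (η x) y‖ₑ ^ q)
      (fun _ _ => zero_le) hx₀
  · push Not at hex
    have h1 := key ∅ (by simp) fun x hx _ => hex x hx
    have h2 : ‖gradient (fun z => 1 - ∑ x ∈ F, η x z) y‖ₑ = 0 := by
      rw [← ofReal_norm, norm_gradient, h1.fderiv_eq]
      simp
    rw [h2, ENNReal.zero_rpow_of_pos hq]
    exact zero_le

theorem exists_pos_small {a b : ℝ} (hb : 0 < b) {V δ : ℝ≥0∞} (hV : V ≠ ∞) (hδ : δ ≠ 0) :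
    ∃ τ ∈ Ioo 0 b, ENNReal.ofReal (a * τ) * V ≤ δ := by
  have h1 : Filter.Tendsto (fun τ : ℝ => ENNReal.ofReal (a * τ) * V) (𝓝[>] 0) (𝓝 0) := by
    have : Filter.Tendsto (fun τ : ℝ => ENNReal.ofReal (a * τ) * V) (𝓝 0)
        (𝓝 (ENNReal.ofReal (a * 0) * V)) :=
      ENNReal.Tendsto.mul_const (ENNReal.tendsto_ofReal (by fun_prop : Continuous
        fun τ : ℝ => a * τ).continuousAt) (Or.inr hV)
    simp only [mul_zero, ENNReal.ofReal_zero, zero_mul] at this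
    exact this.mono_left nhdsWithin_le_nhds
  obtain ⟨τ, h, h'⟩ := ((h1.eventually (eventually_lt_nhds (pos_iff_ne_zero.2 hδ))).and
    (Ioo_mem_nhdsGT hb)).exists
  exact ⟨τ, h', h.le⟩

theorem exists_ne_zero_small {B V δ : ℝ≥0∞} {s : ℝ} (hs : 0 < s) (hB : B ≠ ∞) (hV : V ≠ ∞)
    (hδ : δ ≠ 0) : ∃ ε : ℝ≥0∞, ε ≠ 0 ∧ ε * V ≤ δ ∧ B * ε ^ s * V ≤ δ := by
  have h1 : Filter.Tendsto (fun ε : ℝ≥0∞ => ε * V) (𝓝[>] 0) (𝓝 0) := by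
    have := ENNReal.Tendsto.mul_const (f := 𝓝 (0 : ℝ≥0∞)) (m := id) (b := V) Filter.tendsto_id
      (Or.inr hV)
    rw [zero_mul] at this
    exact this.mono_left nhdsWithin_le_nhds
  have h2 : Filter.Tendsto (fun ε : ℝ≥0∞ => B * ε ^ s * V) (𝓝[>] 0) (𝓝 0) := by
    have h3 : Filter.Tendsto (fun ε : ℝ≥0∞ => ε ^ s) (𝓝 0) (𝓝 0) := by
      have := (ENNReal.continuous_rpow_const (y := s)).tendsto 0
      rwa [ENNReal.zero_rpow_of_pos hs] at this
    have := ENNReal.Tendsto.mul_const (ENNReal.Tendsto.const_mul h3 (Or.inr hB)) (b := V)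
      (Or.inr hV)
    simp only [mul_zero, zero_mul] at this
    exact this.mono_left nhdsWithin_le_nhds
  have hδ' := eventually_lt_nhds (pos_iff_ne_zero.2 hδ)
  obtain ⟨ε, ⟨h4, h5⟩, h6⟩ := (((h1.eventually hδ').and (h2.eventually hδ')).and
    (self_mem_nhdsWithin (s := Ioi (0 : ℝ≥0∞)))).exists
  exact ⟨ε, (pos_iff_ne_zero.1 h6), h4.le, h5.le⟩

theorem exists_theta {m : ℕ} (hm : 1 ≤ m) {p q t : ℝ} (ht : 1 ≤ t) (htp : t < p)
    (hpq : p < q) (hqt : 1 / t - 1 / m ≤ 1 / q) (htm : t < m ∨ (t = 1 ∧ m = 1))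
    (hpn : p < (m + 1 : ℕ)) {v : 𝔼[m + 1] → ℝ} {dv : 𝔼[m + 1] → 𝔼[m + 1]} (h : HasWeakGrad v dv)
    {A : Set 𝔼[m + 1]} (hA : MeasurableSet A) (hvA : ∀ x, x ∉ A → v x = 0)
    (hdA : ∀ x, x ∉ A → dv x = 0) (hAt : volume A ≠ ∞)
    (hv : ∫⁻ x, ‖v x‖ₑ ^ p ≠ ∞) (hdv : ∫⁻ x, ‖dv x‖ₑ ^ p ≠ ∞)
    {K : Set 𝔼[m + 1]} (hKb : Bornology.IsBounded K) {δ : ℝ≥0∞} (hδ : δ ≠ 0) :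
    ∃ (θ : 𝔼[m + 1] → ℝ) (Λ : ℝ≥0), LipschitzWith Λ θ ∧ (∀ x, 0 ≤ θ x) ∧ (∀ x, θ x ≤ 1) ∧
      (∃ O : Set 𝔼[m + 1], IsOpen O ∧ (∀ x ∈ O, θ x = 0) ∧ volume ((K \ A) \ O) ≤ δ) ∧
      volume (A ∩ {x | θ x ≠ 1}) ≤ δ ∧ ∫⁻ x, ‖v x‖ₑ ^ q * ‖gradient θ x‖ₑ ^ q ≤ δ := by
  classical
  have hp : 1 ≤ p := by linarith
  have hq0 : 0 < q := by linarith
  obtain ⟨C, hC⟩ := exists_cutoff_const hm ht htp hpq hqt htm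
  obtain ⟨R, hKR⟩ := hKb.subset_closedBall 0
  set B : Set 𝔼[m + 1] := closedBall 0 (R + (m + 1 : ℕ)) with hBdef
  have hBt : volume B ≠ ∞ := (isCompact_closedBall _ _).measure_lt_top.ne
  obtain ⟨τ, ⟨hτ0, hτ1⟩, hτ⟩ := exists_pos_small (a := (m + 1 : ℕ)) one_pos hBt
    (δ := δ / 2) (ENNReal.div_ne_zero.2 ⟨hδ, by simp⟩)
  set c0 : ℝ≥0∞ := ENNReal.ofReal (2 / τ) with hc0
  set D : ℝ≥0∞ := 2 ^ (p - 1) * (1 + c0 ^ p) with hD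
  have hDt : D ≠ ∞ := ENNReal.mul_ne_top (ENNReal.rpow_ne_top_of_nonneg (by linarith) (by simp))
    (ENNReal.add_ne_top.2 ⟨by simp, ENNReal.rpow_ne_top_of_nonneg (by linarith) (by simp [hc0])⟩)
  obtain ⟨ε, hε0, hε1, hε2⟩ := exists_ne_zero_small (V := volume B) (δ := δ)
    (B := C * (ENNReal.ofReal (τ * (1 / τ) ^ q * (1 / τ) ^ (q / t)) * D ^ (q / p)))
    (s := q / t) (by positivity)
    (ENNReal.mul_ne_top (by simp) (ENNReal.mul_ne_top (by simp)
      (ENNReal.rpow_ne_top_of_nonneg (by positivity) hDt))) hBt hδ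
  have hgood := ae_exists_good_radius hp hpn h hA hvA hdA hAt hv hdv
  set f : 𝔼[m + 1] → Set ℝ := fun x => {r | 0 < r ∧
      volume (A ∩ {y | cubeN x y ≤ r}) ≤ ε * ENNReal.ofReal r ^ (m + 1) ∧
      ∫⁻ y in {y | cubeN x y ≤ r}, ‖dv y‖ₑ ^ p ≤ ε * ENNReal.ofReal r ^ (m + 1) ∧
      ∫⁻ y in {y | cubeN x y ≤ r}, ‖v y‖ₑ ^ p ≤
        ε * (ENNReal.ofReal r ^ (m + 1) * ENNReal.ofReal r ^ p)} with hf
  set s : Set 𝔼[m + 1] := {x | x ∈ K \ A ∧ ∀ δ > 0, (f x ∩ Ioo 0 δ).Nonempty} with hs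
  have hsK : volume ((K \ A) \ s) = 0 := by
    refine measure_mono_null (fun x hx => ?_) (ae_iff.1 hgood)
    intro hcon
    refine hx.2 ⟨hx.1, fun d hd => ?_⟩
    obtain ⟨r, hr, h1, h2, h3⟩ := hcon hx.1.2 ε hε0 d hd
    exact ⟨r, ⟨hr.1, h1, h2, h3⟩, hr⟩
  obtain ⟨tt, r, htc, hts, hr, hcov, hdisj⟩ := exists_disjoint_cubes f s (fun x hx => hx.2) one_pos
  have hCB : ∀ x ∈ tt, {y | cubeN x y ≤ r x} ⊆ B := by
    intro x hx y hy
    have h1 := cube_subset_closedBall x (r x) hy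
    have h2 := hKR (hts hx).1.1
    have h3 := (hr x hx).2.2
    rw [mem_closedBall] at h1 h2
    rw [hBdef, mem_closedBall]
    have h4 := dist_triangle y x 0
    have h5 : ((m + 1 : ℕ) : ℝ) * r x ≤ (m + 1 : ℕ) * 1 := by gcongr
    linarith
  obtain ⟨F, hFt, hFs, hFsum⟩ := exists_finset_cover (μ := volume) htc
    (fun x => measurableSet_cube x (r x)) hdisj hBt hCB hcov (δ := δ / 2)
    (ENNReal.div_ne_zero.2 ⟨hδ, by simp⟩)
  have hrpos : ∀ x ∈ F, 0 < r x := fun x hx => (hr x (hFt hx)).2.1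
  have hrn : ∑ x ∈ F, ENNReal.ofReal (r x) ^ (m + 1) ≤ volume B := by
    refine le_trans (Finset.sum_le_sum fun x hx => ?_) hFsum
    have := hrpos x hx
    rw [volume_cube x this.le, ← ENNReal.ofReal_pow this.le]
    refine ENNReal.ofReal_le_ofReal ?_
    gcongr
    linarith
  have hcut : ∀ x : 𝔼[m + 1], ∃ η : 𝔼[m + 1] → ℝ, x ∈ F → ((∃ Λ, LipschitzWith Λ η) ∧
      (∀ y, 0 ≤ η y) ∧ (∀ y, η y ≤ 1) ∧ (∀ y, cubeN x y ≤ (1 - τ) * r x → η y = 1) ∧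
      (∀ y, r x < cubeN x y → η y = 0) ∧ ∫⁻ y, ‖v y‖ₑ ^ q * ‖gradient η y‖ₑ ^ q ≤
        C * (ENNReal.ofReal (τ * (1 / τ) ^ q * (1 / τ) ^ (q / t)) * D ^ (q / p)) * ε ^ (q / t) *
          ENNReal.ofReal (r x) ^ (m + 1)) := by
    intro x
    by_cases hx : x ∈ F
    · have hr0 := hrpos x hx
      obtain ⟨-, hg1, hg2, hg3⟩ := (hr x (hFt hx)).1
      have hρ : (1 - τ) * r x < r x := by nlinarith
      obtain ⟨η, Λ, hη1, hη2, hη3, hη4, hη5, hη6⟩ := hC v dv h A hA hvA hdA x ((1 - τ) * r x) (r x)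
        (mul_nonneg (by linarith) hr0.le) hρ
      refine ⟨η, fun _ => ⟨⟨Λ, hη1⟩, hη2, hη3, hη4, fun y hy => hη5 y (by linarith), hη6.trans ?_⟩⟩
      have hE : ∫⁻ y in {y | cubeN x y ≤ r x},
          (‖dv y‖ₑ + ENNReal.ofReal (2 / (r x - (1 - τ) * r x)) * ‖v y‖ₑ) ^ p ≤
          D * (ε * ENNReal.ofReal (r x) ^ (m + 1)) := by
        refine (lintegral_add_mul_rpow_le h.int_grad.aestronglyMeasurable.enorm.restrict
          (by simp) hp).trans ?_
        rw [hD, mul_assoc]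
        gcongr
        rw [one_add_mul]
        refine add_le_add hg2 ?_
        refine (mul_le_mul_right hg3 _).trans (le_of_eq ?_)
        rw [show 2 / (r x - (1 - τ) * r x) = 2 / τ * (r x)⁻¹ by
            rw [show r x - (1 - τ) * r x = τ * r x by ring]; field_simp,
          ENNReal.ofReal_mul (by positivity), ENNReal.mul_rpow_of_nonneg _ _ (by linarith),
          ENNReal.ofReal_inv_of_pos hr0, ENNReal.inv_rpow, ← hc0]
        have e0 : ENNReal.ofReal (r x) ^ p ≠ 0 := by
          simp [hr0]
        have e1 : ENNReal.ofReal (r x) ^ p ≠ ∞ := ENNReal.rpow_ne_top_of_nonneg (by linarith) (by simp)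
        calc _ = c0 ^ p * (ε * ENNReal.ofReal (r x) ^ (m + 1)) *
              ((ENNReal.ofReal (r x) ^ p)⁻¹ * ENNReal.ofReal (r x) ^ p) := by ring
          _ = _ := by rw [ENNReal.inv_mul_cancel e0 e1, mul_one]
      have := cutoff_cost_le_of_density hm ht htp hpq hτ0 hr0 hg1 hE
      calc _ = C * (ENNReal.ofReal ((r x - (1 - τ) * r x) * (1 / (r x - (1 - τ) * r x)) ^ q *
            (1 / (r x - (1 - τ) * r x)) ^ (q / t) * r x ^ (m * (1 / q - 1 / t + 1 / m) * q)) *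
            volume (A ∩ {y | cubeN x y ≤ r x}) ^ (q * (1 / t - 1 / p)) *
            (∫⁻ y in {y | cubeN x y ≤ r x},
          (‖dv y‖ₑ + ENNReal.ofReal (2 / (r x - (1 - τ) * r x)) * ‖v y‖ₑ) ^ p) ^ (q / p)) := by
            simp only [mul_assoc]
        _ ≤ _ := mul_le_mul_right this _
        _ = _ := by ring
    · exact ⟨0, fun hx' => absurd hx' hx⟩
  choose η hη using hcut
  have hd : (F : Set 𝔼[m + 1]).PairwiseDisjoint fun x => {y | cubeN x y ≤ r x} := hdisj.subset hFt
  have hη0 : ∀ x ∈ F, ∀ y, r x < cubeN x y → η x y = 0 := fun x hx => (hη x hx).2.2.2.2.1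
  have hcase : ∀ y, (∃ x ∈ F, cubeN x y ≤ r x ∧ ∑ x ∈ F, η x y = η x y) ∨
      ((∀ x ∈ F, r x < cubeN x y) ∧ ∑ x ∈ F, η x y = 0) := by
    intro y
    by_cases hex : ∃ x ∈ F, cubeN x y ≤ r x
    · obtain ⟨x, hx, hy⟩ := hex
      exact Or.inl ⟨x, hx, hy, sum_eq_of_disjoint_cubes hd hη0 hx hy⟩
    · push Not at hex
      exact Or.inr ⟨hex, Finset.sum_eq_zero fun x hx => hη0 x hx y (hex x hx)⟩
  obtain ⟨Λ, hΛ⟩ := exists_lipschitz_finset_sum F fun x hx => (hη x hx).1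
  refine ⟨fun y => 1 - ∑ x ∈ F, η x y, 0 + Λ, (LipschitzWith.const (1 : ℝ)).sub hΛ, ?_, ?_, ?_, ?_, ?_⟩
  · intro y
    rcases hcase y with ⟨x, hx, -, he⟩ | ⟨-, he⟩
    · simp only [he]; exact sub_nonneg.2 ((hη x hx).2.2.1 y)
    · simp only [he]; norm_num
  · intro y
    exact sub_le_self _ (Finset.sum_nonneg fun x hx => (hη x hx).2.1 y)
  · refine ⟨⋃ x ∈ F, {y | cubeN x y < (1 - τ) * r x}, ?_, ?_, ?_⟩
    · exact isOpen_biUnion fun x _ => isOpen_lt (continuous_cubeN x) continuous_const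
    · intro y hy
      simp only [mem_iUnion, exists_prop, mem_ofPred_eq] at hy
      obtain ⟨x, hx, hy⟩ := hy
      have hr0 := hrpos x hx
      simp only [sum_eq_of_disjoint_cubes hd hη0 hx (show cubeN x y ≤ r x by nlinarith)]
      rw [(hη x hx).2.2.2.1 y hy.le, sub_self]
    · calc _ ≤ volume (((K \ A) \ s) ∪ ((s \ ⋃ x ∈ F, {y | cubeN x y ≤ r x}) ∪
            ⋃ x ∈ F, ({y | cubeN x y ≤ r x} \ {y | cubeN x y < (1 - τ) * r x}))) := by
            refine measure_mono fun y hy => ?_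
            by_cases hys : y ∈ s
            · right
              by_cases hyC : y ∈ ⋃ x ∈ F, {y | cubeN x y ≤ r x}
              · right
                simp only [mem_iUnion, exists_prop] at hyC ⊢
                obtain ⟨x, hx, hyx⟩ := hyC
                refine ⟨x, hx, hyx, fun hlt => hy.2 ?_⟩
                simp only [mem_iUnion, exists_prop]
                exact ⟨x, hx, hlt⟩
              · exact Or.inl ⟨hys, hyC⟩
            · exact Or.inl ⟨hy.1, hys⟩
        _ ≤ 0 + (δ / 2 + δ / 2) := by
            refine (measure_union_le _ _).trans (add_le_add hsK.le
              ((measure_union_le _ _).trans (add_le_add hFs ?_)))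
            refine (measure_biUnion_finset_le _ _).trans (le_trans ?_ hτ)
            refine le_trans ?_ (mul_le_mul_right hFsum _)
            rw [Finset.mul_sum]
            exact Finset.sum_le_sum fun x hx => volume_cube_diff_le x (hrpos x hx) hτ0.le hτ1
        _ = δ := by rw [zero_add, ENNReal.add_halves]
  · calc _ ≤ volume (⋃ x ∈ F, (A ∩ {y | cubeN x y ≤ r x})) := by
          refine measure_mono fun y hy => ?_
          simp only [mem_iUnion, exists_prop]
          rcases hcase y with ⟨x, hx, hyx, -⟩ | ⟨-, he⟩
          · exact ⟨x, hx, hy.1, hyx⟩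
          · exact absurd (show 1 - ∑ x ∈ F, η x y = 1 by rw [he, sub_zero]) hy.2
      _ ≤ ∑ x ∈ F, ε * ENNReal.ofReal (r x) ^ (m + 1) :=
          (measure_biUnion_finset_le _ _).trans
            (Finset.sum_le_sum fun x hx => (hr x (hFt hx)).1.2.1)
      _ ≤ δ := by
          rw [← Finset.mul_sum]
          exact (mul_le_mul_right hrn _).trans hε1
  · calc _ ≤ ∫⁻ y, ∑ x ∈ F, ‖v y‖ₑ ^ q * ‖gradient (η x) y‖ₑ ^ q := by
          refine lintegral_mono fun y => ?_
          rw [← Finset.mul_sum]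
          exact mul_le_mul_right (enorm_gradient_one_sub_sum_le hd hη0 hq0 y) _
      _ = ∑ x ∈ F, ∫⁻ y, ‖v y‖ₑ ^ q * ‖gradient (η x) y‖ₑ ^ q := by
          refine lintegral_finsetSum' _ fun x _ => ?_
          exact (h.int.aestronglyMeasurable.enorm.pow_const _).mul
            ((measurable_gradient (η x)).enorm.pow_const _).aemeasurable
      _ ≤ ∑ x ∈ F, C * (ENNReal.ofReal (τ * (1 / τ) ^ q * (1 / τ) ^ (q / t)) * D ^ (q / p)) *
            ε ^ (q / t) * ENNReal.ofReal (r x) ^ (m + 1) :=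
          Finset.sum_le_sum fun x hx => (hη x hx).2.2.2.2.2
      _ ≤ δ := by
          rw [← Finset.mul_sum]
          exact (mul_le_mul_right hrn _).trans hε2

theorem aemeasurable_caratheodory {X E : Type*} [MeasurableSpace X] {μ : Measure X}
    [TopologicalSpace E] [TopologicalSpace.PseudoMetrizableSpace E] {f : X → E → ℝ}
    (hf : ∀ z, AEMeasurable (fun x => f x z) μ) (hc : ∀ᵐ x ∂μ, Continuous (f x)) {V : X → E}
    (hV : AEStronglyMeasurable V μ) : AEMeasurable (fun x => f x (V x)) μ := by
  obtain ⟨W, hW, hVW⟩ := hV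
  have h1 : ∀ s : SimpleFunc X E, AEMeasurable (fun x => f x (s x)) μ := by
    intro s
    classical
    have : (fun x => f x (s x)) = fun x => ∑ z ∈ s.range, (s ⁻¹' {z}).indicator (fun x => f x z) x := by
      funext x
      rw [Finset.sum_eq_single (s x)]
      · simp [indicator]
      · intro z _ hz
        simp [indicator, Ne.symm hz]
      · intro h; exact absurd (SimpleFunc.mem_range_self s x) h
    rw [this]
    exact Finset.aemeasurable_fun_sum _ fun z _ => (hf z).indicator (s.measurableSet_fiber z)
  have h2 : AEMeasurable (fun x => f x (W x)) μ := by
    refine aemeasurable_of_tendsto_metrizable_ae Filter.atTop (fun j => h1 (hW.approx j)) ?_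
    filter_upwards [hc] with x hx
    exact (hx.tendsto _).comp (hW.tendsto_approx x)
  refine h2.congr ?_
  filter_upwards [hVW] with x hx
  rw [hx]

/-- A convex Carathéodory integrand on `Ω` with `(p, q)`-growth up to the integrable weight `G`. -/
structure HasPQGrowth {n : ℕ} (Ω : Set 𝔼[n]) (p q L : ℝ) (f : 𝔼[n] → 𝔼[n] → ℝ) (G : 𝔼[n] → ℝ) :
    Prop where
  open_dom : IsOpen Ω
  meas : ∀ z, AEMeasurable (fun x => f x z) (volume.restrict Ω)
  cont : ∀ᵐ x ∂volume.restrict Ω, Continuous (f x)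
  conv : ∀ᵐ x ∂volume.restrict Ω, ConvexOn ℝ univ (f x)
  lower : ∀ᵐ x ∂volume.restrict Ω, ∀ z, ‖z‖ ^ p - G x ≤ f x z
  upper : ∀ᵐ x ∂volume.restrict Ω, ∀ z, f x z ≤ L * ‖z‖ ^ q + G x
  nonneg : ∀ᵐ x ∂volume.restrict Ω, 0 ≤ G x
  int : IntegrableOn G Ω

theorem HasWeakGrad.isWeakGradOn {n : ℕ} {w : 𝔼[n] → ℝ} {dw : 𝔼[n] → 𝔼[n]} (h : HasWeakGrad w dw)
    (Ω : Set 𝔼[n]) : IsWeakGradOn n Ω w dw := by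
  intro φ hφ hφc hφΩ i
  rw [setIntegral_eq_integral_of_forall_compl_eq_zero, setIntegral_eq_integral_of_forall_compl_eq_zero,
    h.ibp φ hφ hφc i]
  · intro x hx
    rw [image_eq_zero_of_notMem_tsupport fun h => hx (hφΩ h), mul_zero]
  · intro x hx
    rw [fderiv_of_notMem_tsupport ℝ fun h => hx (hφΩ h)]
    simp

theorem hasWeakGrad_of_contDiff {n : ℕ} {φ : 𝔼[n] → ℝ} (hφ : ContDiff ℝ (⊤ : ℕ∞) φ)
    (hφc : HasCompactSupport φ) : HasWeakGrad φ (gradient φ) := by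
  have hc1 : Continuous (fderiv ℝ φ) := hφ.continuous_fderiv (by simp)
  have hg : Continuous (gradient φ) :=
    (InnerProductSpace.toDual ℝ 𝔼[n]).symm.continuous.comp hc1
  refine ⟨hφ.continuous.integrable_of_hasCompactSupport hφc,
    hg.integrable_of_hasCompactSupport ?_, ?_⟩
  · refine HasCompactSupport.intro hφc fun x hx => ?_
    rw [gradient, fderiv_of_notMem_tsupport ℝ hx, map_zero]
  · intro ψ hψ hψc i
    have hc2 : Continuous (fderiv ℝ ψ) := hψ.continuous_fderiv (by simp)
    simp_rw [gradient_apply_coord]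
    refine integral_mul_fderiv_eq_neg_fderiv_mul_of_integrable ?_ ?_ ?_
      (fun x _ => (hφ.differentiable (by simp)).differentiableAt)
      (fun x _ => (hψ.differentiable (by simp)).differentiableAt)
    · exact (Continuous.integrable_of_hasCompactSupport (by fun_prop) (hψc.mul_left))
    · exact (Continuous.integrable_of_hasCompactSupport (by fun_prop) (hφc.mul_right))
    · exact (Continuous.integrable_of_hasCompactSupport (hφ.continuous.mul hψ.continuous)
        (hφc.mul_right))

theorem IsQMinimizer.integrableOn {n : ℕ} {Ω : Set 𝔼[n]} {f : 𝔼[n] → 𝔼[n] → ℝ} {Q : ℝ}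
    {u : 𝔼[n] → ℝ} {du : 𝔼[n] → 𝔼[n]} (hu : IsQMinimizer n Ω f Q u du) (hΩ : IsOpen Ω)
    {K : Set 𝔼[n]} (hK : IsCompact K) (hKΩ : K ⊆ Ω) : IntegrableOn (fun x => f x (du x)) K := by
  refine LocallyIntegrableOn.integrableOn_isCompact (fun x hx => ?_) hK
  obtain ⟨r, hr, hrΩ⟩ := Metric.nhds_basis_closedBall.mem_iff.1 (hΩ.mem_nhds (hKΩ hx))
  let φ : ContDiffBump x := ⟨r / 2, r, by positivity, by linarith⟩
  have h1 := hasWeakGrad_of_contDiff (φ := φ) φ.contDiff φ.hasCompactSupport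
  have h2 : tsupport φ = closedBall x r := φ.tsupport_eq
  refine ⟨closedBall x r, mem_nhdsWithin_of_mem_nhds (closedBall_mem_nhds x hr), ?_⟩
  have := hu.2.2.2 φ _ (h1.isWeakGradOn Ω) h1.int.integrableOn h1.int_grad.integrableOn
    φ.hasCompactSupport (h2.trans_subset hrΩ)
  rw [← h2]
  exact this.1

theorem HasPQGrowth.lintegral_le {n : ℕ} {Ω : Set 𝔼[n]} {p q L Q : ℝ} {f : 𝔼[n] → 𝔼[n] → ℝ}
    {G : 𝔼[n] → ℝ} (h : HasPQGrowth Ω p q L f G) (hQ : 1 ≤ Q)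
    {u : 𝔼[n] → ℝ} {du : 𝔼[n] → 𝔼[n]} (hu : IsQMinimizer n Ω f Q u du)
    {φ : 𝔼[n] → ℝ} {dφ : 𝔼[n] → 𝔼[n]} (hφ : HasWeakGrad φ dφ) (hφc : IsCompact (tsupport φ))
    (hφΩ : tsupport φ ⊆ Ω) :
    ∫⁻ x in tsupport φ, ENNReal.ofReal (f x (du x) + G x) ≤
      ENNReal.ofReal Q * ∫⁻ x in tsupport φ, ENNReal.ofReal (f x (du x + dφ x) + G x) := by
  obtain ⟨h1, h2⟩ := hu.2.2.2 φ dφ (hφ.isWeakGradOn Ω) hφ.int.integrableOn hφ.int_grad.integrableOn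
    hφc hφΩ
  set S := tsupport φ with hS
  have hle : volume.restrict S ≤ volume.restrict Ω := Measure.restrict_mono hφΩ le_rfl
  have hmono : ∀ {P : 𝔼[n] → Prop}, (∀ᵐ x ∂volume.restrict Ω, P x) → ∀ᵐ x ∂volume.restrict S, P x :=
    fun hP => hP.filter_mono (ae_mono hle)
  have hG : IntegrableOn G S := h.int.mono_set hφΩ
  have hdu : AEStronglyMeasurable du (volume.restrict S) := by
    have := hu.2.2.1.aestronglyMeasurable
    exact this.mono_measure hle
  have hmeas : AEMeasurable (fun x => f x (du x + dφ x)) (volume.restrict S) :=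
    aemeasurable_caratheodory (fun z => (h.meas z).mono_measure hle) (hmono h.cont)
      (hdu.add hφ.int_grad.aestronglyMeasurable.restrict)
  by_cases htop : ∫⁻ x in S, ENNReal.ofReal (f x (du x + dφ x) + G x) = ∞
  · rw [htop, ENNReal.mul_top (by simp; linarith)]
    exact le_top
  have hnn : ∀ V : 𝔼[n] → 𝔼[n], ∀ᵐ x ∂volume.restrict S, 0 ≤ f x (V x) + G x := fun V => by
    filter_upwards [hmono h.lower] with x hx
    have := hx (V x)
    have := Real.rpow_nonneg (norm_nonneg (V x)) p
    linarith
  have h3 : IntegrableOn (fun x => f x (du x + dφ x) + G x) S := by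
    refine ⟨hmeas.aestronglyMeasurable.add hG.aestronglyMeasurable, ?_⟩
    rw [hasFiniteIntegral_iff_ofReal (hnn _)]
    exact lt_top_iff_ne_top.2 htop
  have h4 : IntegrableOn (fun x => f x (du x + dφ x)) S := by
    refine (h3.sub hG).congr (Filter.Eventually.of_forall fun x => ?_)
    simp
  have h5 := h2 h4
  have h6 : IntegrableOn (fun x => f x (du x) + G x) S := h1.add hG
  rw [← ofReal_integral_eq_lintegral_ofReal h6 (hnn _),
    ← ofReal_integral_eq_lintegral_ofReal h3 (hnn _), ← ENNReal.ofReal_mul (by linarith)]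
  refine ENNReal.ofReal_le_ofReal ?_
  have hG0 : 0 ≤ ∫ x in S, G x := integral_nonneg_of_ae (hmono h.nonneg)
  have e1 : ∫ x in S, f x (du x) + G x = (∫ x in S, f x (du x)) + ∫ x in S, G x :=
    integral_add h1 hG
  have e2 : ∫ x in S, f x (du x + dφ x) + G x = (∫ x in S, f x (du x + dφ x)) + ∫ x in S, G x :=
    integral_add h4 hG
  rw [e1, e2]
  nlinarith

theorem abs_rpow_sub_rpow_le {q a b : ℝ} (hq : 1 ≤ q) (ha : a ∈ Icc (0 : ℝ) 1)
    (hb : b ∈ Icc (0 : ℝ) 1) : |a ^ q - b ^ q| ≤ q * |a - b| := by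
  have := Convex.norm_image_sub_le_of_norm_hasDerivWithin_le (f := fun x : ℝ => x ^ q)
    (f' := fun x => q * x ^ (q - 1)) (s := Icc 0 1) (C := q)
    (fun x _ => (Real.hasDerivAt_rpow_const (Or.inr hq)).hasDerivWithinAt) (fun x hx => by
      rw [Real.norm_of_nonneg (mul_nonneg (by linarith) (Real.rpow_nonneg hx.1 _))]
      exact mul_le_of_le_one_right (by linarith) (Real.rpow_le_one hx.1 hx.2 (by linarith)))
    (convex_Icc 0 1) hb ha
  simpa [Real.norm_eq_abs] using this

theorem lipschitzWith_mul_of_le_one {X : Type*} [PseudoMetricSpace X] {η θ : X → ℝ} {K M : ℝ≥0}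
    (hη : LipschitzWith K η) (hθ : LipschitzWith M θ) (hη0 : ∀ x, 0 ≤ η x) (hη1 : ∀ x, η x ≤ 1)
    (hθ0 : ∀ x, 0 ≤ θ x) (hθ1 : ∀ x, θ x ≤ 1) : LipschitzWith (K + M) fun x => η x * θ x := by
  refine LipschitzWith.of_dist_le_mul fun x y => ?_
  have h1 := hη.dist_le_mul x y
  have h2 := hθ.dist_le_mul x y
  rw [Real.dist_eq] at h1 h2 ⊢
  have e : η x * θ x - η y * θ y = (η x - η y) * θ x + η y * (θ x - θ y) := by ring
  calc |η x * θ x - η y * θ y| ≤ |η x - η y| * θ x + η y * |θ x - θ y| := by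
        rw [e]
        refine (abs_add_le _ _).trans (le_of_eq ?_)
        rw [abs_mul, abs_mul, abs_of_nonneg (hθ0 x), abs_of_nonneg (hη0 y)]
    _ ≤ |η x - η y| * 1 + 1 * |θ x - θ y| := by
        gcongr
        · exact hθ1 x
        · exact hη1 y
    _ ≤ (K + M : ℝ≥0) * dist x y := by push_cast; linarith

theorem lipschitzWith_neg_rpow {X : Type*} [PseudoMetricSpace X] {T : X → ℝ} {K : ℝ≥0} {q : ℝ}
    (hq : 1 ≤ q) (hT : LipschitzWith K T) (hT0 : ∀ x, 0 ≤ T x) (hT1 : ∀ x, T x ≤ 1) :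
    LipschitzWith (q.toNNReal * K) fun x => -T x ^ q := by
  refine LipschitzWith.of_dist_le_mul fun x y => ?_
  have h1 := hT.dist_le_mul x y
  rw [Real.dist_eq] at h1 ⊢
  have h2 := abs_rpow_sub_rpow_le hq ⟨hT0 x, hT1 x⟩ ⟨hT0 y, hT1 y⟩
  push_cast
  rw [Real.coe_toNNReal _ (by linarith), mul_assoc, show -T x ^ q - -T y ^ q = -(T x ^ q - T y ^ q) by
    ring, abs_neg]
  exact h2.trans (mul_le_mul_of_nonneg_left h1 (by linarith))

theorem gradient_neg_rpow {n : ℕ} {T : 𝔼[n] → ℝ} {q : ℝ} (hq : 1 ≤ q) {x : 𝔼[n]}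
    (hT : DifferentiableAt ℝ T x) :
    gradient (fun y => -T y ^ q) x = -(q * T x ^ (q - 1)) • gradient T x := by
  have h1 : HasFDerivAt (fun y => -T y ^ q) (-((q * T x ^ (q - 1)) • fderiv ℝ T x)) x :=
    (hT.hasFDerivAt.rpow_const (Or.inr hq)).neg
  rw [gradient, gradient, h1.fderiv, neg_smul, map_neg]
  simp

theorem enorm_gradient_mul_le {n : ℕ} {η θ : 𝔼[n] → ℝ} {x : 𝔼[n]} (hη : DifferentiableAt ℝ η x)
    (hθ : DifferentiableAt ℝ θ x) (hη0 : 0 ≤ η x) (hη1 : η x ≤ 1) (hθ0 : 0 ≤ θ x) (hθ1 : θ x ≤ 1)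
    {q : ℝ} (hq : 1 ≤ q) :
    ‖gradient (fun y => η y * θ y) x‖ₑ ^ q ≤
      2 ^ (q - 1) * (‖gradient η x‖ₑ ^ q + ‖gradient θ x‖ₑ ^ q) := by
  refine le_trans ?_ (ENNReal.rpow_add_le_mul_rpow_add_rpow _ _ hq)
  refine ENNReal.rpow_le_rpow ?_ (by linarith)
  rw [← ofReal_norm, ← ofReal_norm, ← ofReal_norm, ← ENNReal.ofReal_add (norm_nonneg _) (norm_nonneg _)]
  refine ENNReal.ofReal_le_ofReal ?_
  rw [norm_gradient, norm_gradient, norm_gradient, fderiv_fun_mul hη hθ]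
  refine (norm_add_le _ _).trans ?_
  rw [norm_smul, norm_smul, Real.norm_of_nonneg hη0, Real.norm_of_nonneg hθ0, add_comm]
  exact add_le_add (mul_le_of_le_one_left (norm_nonneg _) hθ1)
    (mul_le_of_le_one_left (norm_nonneg _) hη1)

/-- Convexity estimate for the competitor `z - T ^ q z - q T ^ (q - 1) v ζ`. -/
theorem convex_competitor_le {E : Type*} [NormedAddCommGroup E] [NormedSpace ℝ E] {F : E → ℝ}
    (hF : ConvexOn ℝ univ F) {q L G : ℝ} (hq : 1 < q)
    (hup : ∀ z, F z ≤ L * ‖z‖ ^ q + G) {T v : ℝ} (hT0 : 0 ≤ T) (hT1 : T ≤ 1)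
    (hv : 0 ≤ v) (hL : 0 ≤ L) (hG : 0 ≤ G) (z ζ : E) :
    F (z + ((-T ^ q) • z + v • (-(q * T ^ (q - 1)) • ζ))) + G ≤
      (1 - T ^ q) * (F z + G) + (L * q ^ q * (v ^ q * ‖ζ‖ ^ q) + 2 * G) := by
  have hTq0 := Real.rpow_nonneg hT0 q
  have hTq1 := Real.rpow_le_one hT0 hT1 (by linarith : 0 ≤ q)
  have hq0 : 0 < q := by linarith
  have hX : 0 ≤ L * q ^ q * (v ^ q * ‖ζ‖ ^ q) := by positivity
  rcases hT0.eq_or_lt with rfl | hT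
  · rw [Real.zero_rpow (by linarith), Real.zero_rpow (by linarith)]
    simp only [neg_zero, zero_smul, mul_zero, smul_zero, add_zero, sub_zero, one_mul]
    linarith
  · have e : z + ((-T ^ q) • z + v • (-(q * T ^ (q - 1)) • ζ)) =
        (1 - T ^ q) • z + T ^ q • (-(q * v / T) • ζ) := by
      have : T ^ (q - 1) = T ^ q / T := by rw [Real.rpow_sub hT, Real.rpow_one]
      rw [this]
      module
    have h1 := hF.2 (mem_univ z) (mem_univ (-(q * v / T) • ζ)) (sub_nonneg.2 hTq1) hTq0 (by ring)
    have h2 := hup (-(q * v / T) • ζ)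
    have h3 : T ^ q * (L * ‖-(q * v / T) • ζ‖ ^ q) = L * q ^ q * (v ^ q * ‖ζ‖ ^ q) := by
      rw [norm_smul, norm_neg, Real.norm_of_nonneg (by positivity),
        Real.mul_rpow (by positivity) (norm_nonneg _), Real.div_rpow (by positivity) hT0,
        Real.mul_rpow hq0.le hv]
      have : T ^ q ≠ 0 := (Real.rpow_pos_of_pos hT q).ne'
      field_simp
    rw [e]
    simp only [smul_eq_mul] at h1
    have h4 := mul_le_mul_of_nonneg_left h2 hTq0
    rw [mul_add, h3] at h4
    nlinarith

theorem qmin_test_le {n : ℕ} {Ω : Set 𝔼[n]} {p q L Q : ℝ} {f : 𝔼[n] → 𝔼[n] → ℝ}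
    {G : 𝔼[n] → ℝ} (h : HasPQGrowth Ω p q L f G) (hL : 0 ≤ L) (hQ : 1 ≤ Q) (hq : 1 < q)
    {u : 𝔼[n] → ℝ} {du : 𝔼[n] → 𝔼[n]} (hu : IsQMinimizer n Ω f Q u du)
    {v : 𝔼[n] → ℝ} {dv : 𝔼[n] → 𝔼[n]} (hv : HasWeakGrad v dv) (hv0 : ∀ x, 0 ≤ v x) {A : Set 𝔼[n]}
    (hA : MeasurableSet A) (hvA : ∀ x, x ∉ A → v x = 0) (hvA' : ∀ x ∈ A, 0 < v x)
    (hdA : ∀ x, x ∉ A → dv x = 0)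
    {C C' O : Set 𝔼[n]} (hC : IsCompact C) (hCΩ : C ⊆ Ω) (hO : IsOpen O)
    (hdu : ∀ x ∈ C ∩ A, dv x = du x)
    {η θ : 𝔼[n] → ℝ} {K M : ℝ≥0} (hη : LipschitzWith K η) (hη0 : ∀ x, 0 ≤ η x) (hη1 : ∀ x, η x ≤ 1)
    (hηC : ∀ x, x ∉ C → η x = 0) (hηC' : ∀ x ∈ C', η x = 1)
    (hθ : LipschitzWith M θ) (hθ0 : ∀ x, 0 ≤ θ x) (hθ1 : ∀ x, θ x ≤ 1) (hθO : ∀ x ∈ O, θ x = 0) :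
    ∫⁻ x in A ∩ C' ∩ {x | θ x = 1}, ENNReal.ofReal (f x (du x) + G x) ≤
      ENNReal.ofReal Q * ((∫⁻ x in A ∩ (C \ C'), ENNReal.ofReal (f x (du x) + G x)) +
        (∫⁻ x in C ∩ ((C \ A) \ O), ENNReal.ofReal (f x (du x) + G x)) +
        (∫⁻ x in C ∩ (A ∩ {x | θ x ≠ 1}), ENNReal.ofReal (f x (du x) + G x)) +
        ENNReal.ofReal (L * q ^ q) * 2 ^ (q - 1) * ((∫⁻ x, ‖v x‖ₑ ^ q * ‖gradient η x‖ₑ ^ q) +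
          ∫⁻ x, ‖v x‖ₑ ^ q * ‖gradient θ x‖ₑ ^ q) +
        2 * ∫⁻ x in A ∩ C, ENNReal.ofReal (G x)) := by
  set T : 𝔼[n] → ℝ := fun x => η x * θ x with hTdef
  have hT : LipschitzWith (K + M) T := lipschitzWith_mul_of_le_one hη hθ hη0 hη1 hθ0 hθ1
  have hT0 : ∀ x, 0 ≤ T x := fun x => mul_nonneg (hη0 x) (hθ0 x)
  have hT1 : ∀ x, T x ≤ 1 := fun x => mul_le_one₀ (hη1 x) (hθ0 x) (hθ1 x)
  have hτ := lipschitzWith_neg_rpow hq.le hT hT0 hT1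
  have hφ := hv.lipschitz_mul hτ (M := 1) (fun x => by
    rw [abs_neg, abs_of_nonneg (Real.rpow_nonneg (hT0 x) _)]
    exact Real.rpow_le_one (hT0 x) (hT1 x) (by linarith))
  set φ : 𝔼[n] → ℝ := fun x => -T x ^ q * v x with hφdef
  set dφ : 𝔼[n] → 𝔼[n] := fun x => (-T x ^ q) • dv x + v x • gradient (fun y => -T y ^ q) x
  have hsuppC : Function.support φ ⊆ C := by
    intro x hx
    by_contra hxC
    refine hx ?_
    simp [hφdef, hTdef, hηC x hxC, Real.zero_rpow (by linarith : q ≠ 0)]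
  have htC : tsupport φ ⊆ C := closure_minimal hsuppC hC.isClosed
  have htO : tsupport φ ⊆ Oᶜ := by
    refine closure_minimal (fun x hx hxO => hx ?_) hO.isClosed_compl
    simp [hφdef, hTdef, hθO x hxO, Real.zero_rpow (by linarith : q ≠ 0)]
  have hφc : IsCompact (tsupport φ) := hC.of_isClosed_subset isClosed_closure htC
  have hφΩ := htC.trans hCΩ
  have hmain := h.lintegral_le hQ hu hφ hφc hφΩ
  set S := tsupport φ with hS
  have hSm : MeasurableSet S := hφc.isClosed.measurableSet
  have hle : volume.restrict S ≤ volume.restrict Ω := Measure.restrict_mono hφΩ le_rfl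
  have hmono : ∀ {P : 𝔼[n] → Prop}, (∀ᵐ x ∂volume.restrict Ω, P x) → ∀ᵐ x ∂volume.restrict S, P x :=
    fun hP => hP.filter_mono (ae_mono hle)
  have hGm : AEMeasurable (fun x => ENNReal.ofReal (G x)) (volume.restrict S) :=
    (h.int.aestronglyMeasurable.aemeasurable.mono_measure hle).ennreal_ofReal
  set F : 𝔼[n] → ℝ≥0∞ := fun x => ENNReal.ofReal (f x (du x) + G x) with hF
  have hTm : Measurable T := hT.continuous.measurable
  have hθm : Measurable θ := hθ.continuous.measurable
  set D : Set 𝔼[n] := {x | x ∉ A ∨ T x ≠ 1} with hD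
  have hDm : MeasurableSet D := hA.compl.union (hTm (measurableSet_singleton 1)).compl
  set c : ℝ≥0∞ := ENNReal.ofReal (L * q ^ q) with hc
  -- the pointwise estimate
  have hpt : ∀ᵐ x ∂volume.restrict S, ENNReal.ofReal (f x (du x + dφ x) + G x) ≤
      D.indicator F x + (c * (‖v x‖ₑ ^ q * ‖gradient T x‖ₑ ^ q) +
        2 * A.indicator (fun x => ENNReal.ofReal (G x)) x) := by
    filter_upwards [hmono h.conv, hmono h.lower, hmono h.upper, hmono h.nonneg,
      ae_restrict_of_ae hT.ae_differentiableAt, ae_restrict_mem hSm] with x h1 h2 h3 h4 h5 h6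
    by_cases hx : x ∈ A
    · have e : dφ x = (-T x ^ q) • du x + v x • (-(q * T x ^ (q - 1)) • gradient T x) := by
        simp only [dφ]
        rw [hdu x ⟨htC h6, hx⟩, gradient_neg_rpow hq.le h5]
      have h7 := convex_competitor_le h1 hq h3 (hT0 x) (hT1 x) (hv0 x) hL h4 (du x) (gradient T x)
      rw [← e] at h7
      have hFnn : 0 ≤ f x (du x) + G x := by
        have := h2 (du x)
        have := Real.rpow_nonneg (norm_nonneg (du x)) p
        linarith
      have hTq0 := Real.rpow_nonneg (hT0 x) q
      have hTq1 := Real.rpow_le_one (hT0 x) (hT1 x) (by linarith : 0 ≤ q)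
      have hq0 : 0 ≤ q := by linarith
      refine (ENNReal.ofReal_le_ofReal h7).trans ?_
      refine ENNReal.ofReal_add_le.trans (add_le_add ?_ ?_)
      · by_cases hT' : T x = 1
        · simp [hT']
        · have : x ∈ D := Or.inr hT'
          rw [indicator_of_mem this]
          exact ENNReal.ofReal_le_ofReal (mul_le_of_le_one_left hFnn (by linarith))
      · refine ENNReal.ofReal_add_le.trans (add_le_add (le_of_eq ?_) (le_of_eq ?_))
        · have hqq : 0 ≤ L * q ^ q := mul_nonneg hL (Real.rpow_nonneg hq0 _)
          rw [ENNReal.ofReal_mul hqq,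
            ENNReal.ofReal_mul (Real.rpow_nonneg (hv0 x) _), ← ENNReal.ofReal_rpow_of_nonneg (hv0 x) hq0,
            ← ENNReal.ofReal_rpow_of_nonneg (norm_nonneg _) hq0, ofReal_norm,
            ← Real.enorm_of_nonneg (hv0 x)]
        · rw [indicator_of_mem hx, ENNReal.ofReal_mul (by norm_num)]; simp
    · have e : dφ x = 0 := by
        simp [dφ, hvA x hx, hdA x hx]
      have : x ∈ D := Or.inl hx
      rw [e, add_zero, indicator_of_mem this]
      exact le_self_add
  have hvm : AEMeasurable (fun x => ‖v x‖ₑ ^ q) := hv.int.aestronglyMeasurable.enorm.pow_const _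
  have hgm : ∀ τ : 𝔼[n] → ℝ, AEMeasurable (fun x => ‖gradient τ x‖ₑ ^ q) := fun τ =>
    ((measurable_gradient τ).enorm.pow_const _).aemeasurable
  -- the cost of the cutoff
  have hcost : ∫⁻ x, ‖v x‖ₑ ^ q * ‖gradient T x‖ₑ ^ q ≤
      2 ^ (q - 1) * ((∫⁻ x, ‖v x‖ₑ ^ q * ‖gradient η x‖ₑ ^ q) +
          ∫⁻ x, ‖v x‖ₑ ^ q * ‖gradient θ x‖ₑ ^ q) := by
    have h2 : (2 : ℝ≥0∞) ^ (q - 1) ≠ ∞ := ENNReal.rpow_ne_top_of_nonneg (by linarith) (by simp)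
    have h3 : AEMeasurable fun x => ‖v x‖ₑ ^ q * ‖gradient η x‖ₑ ^ q := hvm.mul (hgm η)
    rw [← lintegral_add_left' h3, ← lintegral_const_mul' _ _ h2]
    refine lintegral_mono_ae ?_
    filter_upwards [hη.ae_differentiableAt, hθ.ae_differentiableAt] with x h1 h2
    have := enorm_gradient_mul_le h1 h2 (hη0 x) (hη1 x) (hθ0 x) (hθ1 x) hq.le
    refine (mul_le_mul_right this _).trans (le_of_eq (by ring))
  -- the right hand side
  have hrhs : ∫⁻ x in S, ENNReal.ofReal (f x (du x + dφ x) + G x) ≤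
      (∫⁻ x in A ∩ (C \ C'), F x) + (∫⁻ x in C ∩ ((C \ A) \ O), F x) +
        (∫⁻ x in C ∩ (A ∩ {x | θ x ≠ 1}), F x) +
        c * 2 ^ (q - 1) * ((∫⁻ x, ‖v x‖ₑ ^ q * ‖gradient η x‖ₑ ^ q) +
          ∫⁻ x, ‖v x‖ₑ ^ q * ‖gradient θ x‖ₑ ^ q) +
        2 * ∫⁻ x in A ∩ C, ENNReal.ofReal (G x) := by
    refine (lintegral_mono_ae hpt).trans ?_
    rw [lintegral_add_right', lintegral_add_left', lintegral_const_mul' _ _ (by simp [hc]),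
      lintegral_const_mul' _ _ (by simp), lintegral_indicator hDm, lintegral_indicator hA,
      Measure.restrict_restrict hDm, Measure.restrict_restrict hA, ← add_assoc]
    · refine add_le_add (add_le_add ?_ ?_) ?_
      · calc ∫⁻ x in D ∩ S, F x ≤ ∫⁻ x in (A ∩ (C \ C') ∪ C ∩ ((C \ A) \ O)) ∪
              C ∩ (A ∩ {x | θ x ≠ 1}), F x := by
              refine lintegral_mono_set fun x hx => ?_
              have hxC := htC hx.2
              by_cases hxA : x ∈ A
              · by_cases hxC' : x ∈ C'
                · refine Or.inr ⟨hxC, hxA, fun hθx => ?_⟩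
                  rcases hx.1 with h | h
                  · exact h hxA
                  · refine h ?_
                    simp only [hTdef, hηC' x hxC', one_mul]; exact hθx
                · exact Or.inl (Or.inl ⟨hxA, hxC, hxC'⟩)
              · exact Or.inl (Or.inr ⟨hxC, ⟨hxC, hxA⟩, htO hx.2⟩)
          _ ≤ _ := (lintegral_union_le _ _ _).trans (add_le_add (lintegral_union_le _ _ _) le_rfl)
      · rw [mul_assoc]
        exact mul_le_mul_right ((setLIntegral_le_lintegral _ _).trans hcost) _
      · exact mul_le_mul_right (lintegral_mono_set (inter_subset_inter_right _ htC)) _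
    · exact ((hvm.mul (hgm T)).const_mul _).restrict
    · exact ((hvm.mul (hgm T)).const_mul _).restrict.add ((hGm.indicator hA).const_mul _)
  refine le_trans (lintegral_mono_set fun x hx => subset_tsupport _ ?_) (hmain.trans
    (mul_le_mul_right hrhs _))
  obtain ⟨⟨hxA, hxC'⟩, hxθ⟩ := hx
  have : T x = 1 := by
    simp only [hTdef, hηC' x hxC', one_mul]; exact hxθ
  simp [hφdef, this, (hvA' x hxA).ne']

/-- Exponents `t < p < q`, `p < m + 1`, with `W^{1,t}` embedding into `L^q` on the
`m`-dimensional sphere. -/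
structure AdmissibleExp (m : ℕ) (p q t : ℝ) : Prop where
  one_le_dim : 1 ≤ m
  one_le : 1 ≤ t
  t_lt : t < p
  p_lt : p < q
  sobolev : 1 / t - 1 / m ≤ 1 / q
  sub : t < m ∨ (t = 1 ∧ m = 1)
  p_lt_dim : p < (m + 1 : ℕ)

theorem qmin_shell_le {m : ℕ} {p q t : ℝ} (H : AdmissibleExp m p q t) {Ω : Set 𝔼[m + 1]}
    {L Q : ℝ} {f : 𝔼[m + 1] → 𝔼[m + 1] → ℝ}
    {G : 𝔼[m + 1] → ℝ} (h : HasPQGrowth Ω p q L f G) (hL : 0 ≤ L) (hQ : 1 ≤ Q)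
    {u : 𝔼[m + 1] → ℝ} {du : 𝔼[m + 1] → 𝔼[m + 1]} (hu : IsQMinimizer (m + 1) Ω f Q u du)
    {v : 𝔼[m + 1] → ℝ} {dv : 𝔼[m + 1] → 𝔼[m + 1]} (hv : HasWeakGrad v dv) (hv0 : ∀ x, 0 ≤ v x)
    (hvp : ∫⁻ x, ‖v x‖ₑ ^ p ≠ ∞) (hdvp : ∫⁻ x, ‖dv x‖ₑ ^ p ≠ ∞) {A : Set 𝔼[m + 1]}
    (hA : MeasurableSet A) (hAt : volume A ≠ ∞) (hvA : ∀ x, x ∉ A → v x = 0)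
    (hvA' : ∀ x ∈ A, 0 < v x) (hdA : ∀ x, x ∉ A → dv x = 0)
    {C C' : Set 𝔼[m + 1]} (hC : IsCompact C) (hCΩ : C ⊆ Ω) (hC' : C' ⊆ C)
    (hdu : ∀ x ∈ C ∩ A, dv x = du x)
    {η : 𝔼[m + 1] → ℝ} {K : ℝ≥0} (hη : LipschitzWith K η) (hη0 : ∀ x, 0 ≤ η x)
    (hη1 : ∀ x, η x ≤ 1) (hηC : ∀ x, x ∉ C → η x = 0) (hηC' : ∀ x ∈ C', η x = 1) :
    ∫⁻ x in A ∩ C', ENNReal.ofReal (f x (du x) + G x) ≤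
      ENNReal.ofReal Q * ((∫⁻ x in A ∩ (C \ C'), ENNReal.ofReal (f x (du x) + G x)) +
        ENNReal.ofReal (L * q ^ q) * 2 ^ (q - 1) * (∫⁻ x, ‖v x‖ₑ ^ q * ‖gradient η x‖ₑ ^ q) +
        2 * ∫⁻ x in A ∩ C, ENNReal.ofReal (G x)) := by
  have hq1 : 1 < q := by linarith [H.one_le, H.t_lt, H.p_lt]
  set F : 𝔼[m + 1] → ℝ≥0∞ := fun x => ENNReal.ofReal (f x (du x) + G x) with hF
  set c : ℝ≥0∞ := ENNReal.ofReal (L * q ^ q) * 2 ^ (q - 1) with hc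
  have hct : c ≠ ∞ := ENNReal.mul_ne_top (by simp)
    (ENNReal.rpow_ne_top_of_nonneg (by linarith) (by simp))
  have hFC : ∫⁻ x, F x ∂(volume.restrict C) ≠ ∞ := by
    have := ((hu.integrableOn h.open_dom hC hCΩ).add (h.int.mono_set hCΩ)).lintegral_lt_top
    exact this.ne
  have hrC : ∀ s, (volume.restrict C).restrict s = volume.restrict (s ∩ C) := fun s =>
    Measure.restrict_restrict' hC.measurableSet
  set E : ℝ≥0∞ := ENNReal.ofReal Q * (2 + c) + 1 with hE
  have hEt : E ≠ ∞ := by finiteness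
  refine ENNReal.le_of_forall_pos_le_add fun ε hε _ => ?_
  obtain ⟨e, he0, heE⟩ : ∃ e : ℝ≥0∞, e ≠ 0 ∧ e * E ≤ ε := by
    refine ⟨ε / E, ENNReal.div_ne_zero.2 ⟨by simpa using hε.ne', hEt⟩, (ENNReal.div_mul_cancel (by simp [hE]) hEt).le⟩
  obtain ⟨δ, hδ, hδF⟩ := exists_pos_setLIntegral_lt_of_measure_lt hFC he0
  have hδ1 : ∃ δ' : ℝ≥0∞, δ' ≠ 0 ∧ δ' < δ ∧ δ' ≤ e := by
    obtain ⟨δ', h1, h2⟩ := exists_between (lt_min hδ (pos_iff_ne_zero.2 he0))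
    exact ⟨δ', h1.ne', h2.trans_le (min_le_left _ _), h2.le.trans (min_le_right _ _)⟩
  obtain ⟨δ', hδ'0, hδ'δ, hδ'e⟩ := hδ1
  obtain ⟨θ, Λ, hθ, hθ0, hθ1, ⟨O, hO, hθO, hO'⟩, hθA, hθg⟩ := exists_theta H.one_le_dim H.one_le
    H.t_lt H.p_lt H.sobolev H.sub H.p_lt_dim hv hA hvA hdA hAt hvp hdvp hC.isBounded hδ'0
  have key := qmin_test_le h hL hQ hq1 hu hv hv0 hA hvA hvA' hdA hC hCΩ hO hdu hη hη0 hη1 hηC hηC'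
    hθ hθ0 hθ1 hθO
  have hsm : ∀ s : Set 𝔼[m + 1], volume s ≤ δ' → ∫⁻ x in C ∩ s, F x ≤ e := by
    intro s hs
    rw [inter_comm, ← hrC]
    exact (hδF s (((Measure.restrict_apply_le _ _).trans hs).trans_lt hδ'δ)).le
  have h1 := hsm _ hO'
  have h2 := hsm _ hθA
  have h3 : ∫⁻ x in A ∩ C', F x ≤ (∫⁻ x in A ∩ C' ∩ {x | θ x = 1}, F x) + e := by
    refine le_trans (lintegral_mono_set (t := A ∩ C' ∩ {x | θ x = 1} ∪ C ∩ (A ∩ {x | θ x ≠ 1}))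
      fun x hx => ?_) ((lintegral_union_le _ _ _).trans (by gcongr))
    by_cases hθx : θ x = 1
    · exact Or.inl ⟨hx, hθx⟩
    · exact Or.inr ⟨hC' hx.2, hx.1, hθx⟩
  refine h3.trans ?_
  calc _ ≤ ENNReal.ofReal Q * ((∫⁻ x in A ∩ (C \ C'), F x) + e + e +
        c * ((∫⁻ x, ‖v x‖ₑ ^ q * ‖gradient η x‖ₑ ^ q) + e) +
        2 * ∫⁻ x in A ∩ C, ENNReal.ofReal (G x)) + e := by
        refine add_le_add (key.trans ?_) le_rfl
        have := hθg.trans hδ'e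
        gcongr
    _ = ENNReal.ofReal Q * ((∫⁻ x in A ∩ (C \ C'), F x) +
        c * (∫⁻ x, ‖v x‖ₑ ^ q * ‖gradient η x‖ₑ ^ q) +
        2 * ∫⁻ x in A ∩ C, ENNReal.ofReal (G x)) + e * E := by rw [hE]; ring
    _ ≤ _ := by gcongr

theorem exists_hole_filling_const {ϑ γ : ℝ} (hϑ0 : 0 ≤ ϑ) (hϑ1 : ϑ < 1) (hγ : 0 < γ) :
    ∃ K : ℝ≥0, ∀ (Φ : ℝ → ℝ≥0∞) (X Y M : ℝ≥0∞) (ρ σ : ℝ), ρ < σ → M ≠ ∞ →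
      (∀ r, r ≤ σ → Φ r ≤ M) →
      (∀ r s, ρ ≤ r → r < s → s ≤ σ →
        Φ r ≤ ENNReal.ofReal ϑ * Φ s + (ENNReal.ofReal ((1 / (s - r)) ^ γ) * X + Y)) →
      Φ ρ ≤ K * (ENNReal.ofReal ((1 / (σ - ρ)) ^ γ) * X + Y) := by
  set ν : ℝ := (1 + ϑ) / 2 with hν
  have hν0 : 0 < ν := by rw [hν]; linarith
  have hν1 : ν < 1 := by rw [hν]; linarith
  have hϑν : ϑ / ν < 1 := by rw [div_lt_one hν0, hν]; linarith
  set l : ℝ := ν ^ (1 / γ) with hl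
  have hl0 : 0 < l := Real.rpow_pos_of_pos hν0 _
  have hl1 : l < 1 := Real.rpow_lt_one hν0.le hν1 (by positivity)
  have hlγ : l ^ γ = ν := by
    rw [hl, ← Real.rpow_mul hν0.le, one_div_mul_cancel hγ.ne', Real.rpow_one]
  set k1 : ℝ := (1 / (1 - l)) ^ γ with hk1
  have hk11 : 1 ≤ k1 := Real.one_le_rpow (by rw [le_div_iff₀] <;> linarith) hγ.le
  set k2 : ℝ := 1 / (1 - ϑ / ν) with hk2
  refine ⟨(k1 * k2).toNNReal, fun Φ X Y M ρ σ hρσ hM hb hΦ => ?_⟩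
  set d := σ - ρ with hd
  have hd0 : 0 < d := sub_pos.2 hρσ
  set Z : ℝ≥0∞ := ENNReal.ofReal ((1 / d) ^ γ) * X + Y with hZ
  set r : ℕ → ℝ := fun i => σ - l ^ i * d with hr
  have hrσ : ∀ i, r i ≤ σ := fun i => by have := mul_pos (pow_pos hl0 i) hd0; simp only [hr]; linarith
  have hstep : ∀ i, Φ (r i) ≤ ENNReal.ofReal ϑ * Φ (r (i + 1)) +
      ENNReal.ofReal (k1 * (1 / ν) ^ i) * Z := by
    intro i
    have hli := pow_pos hl0 i
    have hli1 : l ^ i ≤ 1 := pow_le_one₀ hl0.le hl1.le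
    have e1 : r (i + 1) - r i = l ^ i * (1 - l) * d := by simp only [hr]; ring
    have hpos : 0 < l ^ i * (1 - l) * d := by
      have : 0 < 1 - l := by linarith
      positivity
    refine (hΦ (r i) (r (i + 1)) ?_ (by linarith) (hrσ _)).trans (add_le_add le_rfl ?_)
    · simp only [hr]; nlinarith
    · have hνi : 1 ≤ (1 / ν) ^ i := one_le_pow₀ (by rw [le_div_iff₀ hν0]; linarith)
      have e2 : (1 / (r (i + 1) - r i)) ^ γ = k1 * (1 / ν) ^ i * (1 / d) ^ γ := by
        have hl' : 0 ≤ 1 / (1 - l) := by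
          have : 0 < 1 - l := by linarith
          positivity
        rw [e1, show 1 / (l ^ i * (1 - l) * d) = 1 / (1 - l) * (1 / l) ^ i * (1 / d) by
          rw [one_div_pow]; field_simp,
          Real.mul_rpow (by positivity) (by positivity), Real.mul_rpow hl' (by positivity), hk1]
        congr 2
        rw [← hlγ, one_div, one_div, inv_pow, inv_pow, Real.inv_rpow (by positivity),
          ← Real.rpow_natCast, ← Real.rpow_natCast, ← Real.rpow_mul hl0.le, ← Real.rpow_mul hl0.le,
          mul_comm]
      rw [e2, hZ, mul_add, ENNReal.ofReal_mul (by positivity), mul_assoc]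
      refine add_le_add le_rfl ?_
      refine le_mul_of_one_le_left zero_le ?_
      rw [ENNReal.one_le_ofReal]
      nlinarith
  have hind : ∀ N, Φ (r 0) ≤ ENNReal.ofReal (ϑ ^ N) * Φ (r N) +
      ENNReal.ofReal (k1 * ∑ i ∈ Finset.range N, (ϑ / ν) ^ i) * Z := by
    intro N
    induction N with
    | zero => simp
    | succ N ih =>
      refine ih.trans ?_
      have hϑN := pow_nonneg hϑ0 N
      have hsum : 0 ≤ ∑ i ∈ Finset.range N, (ϑ / ν) ^ i := Finset.sum_nonneg fun i _ => by positivity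
      calc _ ≤ ENNReal.ofReal (ϑ ^ N) * (ENNReal.ofReal ϑ * Φ (r (N + 1)) +
            ENNReal.ofReal (k1 * (1 / ν) ^ N) * Z) +
            ENNReal.ofReal (k1 * ∑ i ∈ Finset.range N, (ϑ / ν) ^ i) * Z := by
            gcongr; exact hstep N
        _ = _ := by
            have e3 : k1 * ∑ i ∈ Finset.range (N + 1), (ϑ / ν) ^ i =
                ϑ ^ N * (k1 * (1 / ν) ^ N) + k1 * ∑ i ∈ Finset.range N, (ϑ / ν) ^ i := by
              rw [Finset.sum_range_succ, div_pow, one_div_pow]; ring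
            rw [e3, ENNReal.ofReal_add (by positivity) (by positivity), ENNReal.ofReal_mul hϑN,
              pow_succ, ENNReal.ofReal_mul hϑN]
            ring
  have hlim : Filter.Tendsto (fun N : ℕ => ENNReal.ofReal (ϑ ^ N) * M) Filter.atTop (𝓝 0) := by
    have h1 : Filter.Tendsto (fun N : ℕ => ENNReal.ofReal (ϑ ^ N)) Filter.atTop (𝓝 0) := by
      rw [← ENNReal.ofReal_zero]
      exact ENNReal.tendsto_ofReal (tendsto_pow_atTop_nhds_zero_of_lt_one hϑ0 hϑ1)
    simpa using ENNReal.Tendsto.mul_const h1 (Or.inr hM) (b := M)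
  have hr0 : r 0 = ρ := by simp [hr, hd]
  rw [← hr0]
  have hbd : ∀ N : ℕ, Φ (r 0) ≤ ENNReal.ofReal (ϑ ^ N) * M + ENNReal.ofReal (k1 * k2) * Z := by
    intro N
    refine (hind N).trans ?_
    gcongr
    · exact hb _ (hrσ N)
    · rw [hk2, one_div, ← tsum_geometric_of_lt_one (by positivity) hϑν]
      exact (summable_geometric_of_lt_one (by positivity) hϑν).sum_le_tsum _
        fun i _ => by positivity
  have := ge_of_tendsto' (hlim.add_const (ENNReal.ofReal (k1 * k2) * Z)) hbd
  rw [zero_add] at this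
  exact this

theorem exists_cutoff_energy_const {m : ℕ} {p q t : ℝ} (H : AdmissibleExp m p q t) :
    ∃ C : ℝ≥0, ∀ (v : 𝔼[m + 1] → ℝ) (dv : 𝔼[m + 1] → 𝔼[m + 1]), HasWeakGrad v dv →
      ∀ A : Set 𝔼[m + 1], MeasurableSet A → (∀ x, x ∉ A → v x = 0) → (∀ x, x ∉ A → dv x = 0) →
      ∀ x₀ ρ σ, 0 ≤ ρ → ρ < σ → σ ≤ 1 →
      ∃ (η : 𝔼[m + 1] → ℝ) (K : ℝ≥0), LipschitzWith K η ∧ (∀ x, 0 ≤ η x) ∧ (∀ x, η x ≤ 1) ∧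
        (∀ x, cubeN x₀ x ≤ ρ → η x = 1) ∧ (∀ x, ¬ cubeN x₀ x ≤ σ → η x = 0) ∧
        ∫⁻ x, ‖v x‖ₑ ^ q * ‖gradient η x‖ₑ ^ q ≤
          C * (ENNReal.ofReal ((1 / (σ - ρ)) ^ (2 * q + q / t)) *
            (volume (A ∩ {x | cubeN x₀ x ≤ σ}) ^ (q * (1 / t - 1 / p)) *
            ((∫⁻ x in {x | cubeN x₀ x ≤ σ}, ‖dv x‖ₑ ^ p) +
              ∫⁻ x in {x | cubeN x₀ x ≤ σ}, ‖v x‖ₑ ^ p) ^ (q / p))) := by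
  obtain ⟨C, hC⟩ := exists_cutoff_const H.one_le_dim H.one_le H.t_lt H.p_lt H.sobolev H.sub
  have ht0 : 0 < t := by linarith [H.one_le]
  have hp1 : 1 ≤ p := by linarith [H.one_le, H.t_lt]
  have hp0 : 0 < p := by linarith
  have hq0 : 0 < q := by linarith [H.p_lt]
  have h2t : ((2 : ℝ≥0∞) ^ (p - 1)) ^ (q / p) * 2 ^ q ≠ ∞ :=
    ENNReal.mul_ne_top (ENNReal.rpow_ne_top_of_nonneg (by positivity)
      (ENNReal.rpow_ne_top_of_nonneg (by linarith) (by simp)))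
      (ENNReal.rpow_ne_top_of_nonneg hq0.le (by simp))
  refine ⟨C * (((2 : ℝ≥0∞) ^ (p - 1)) ^ (q / p) * 2 ^ q).toNNReal,
    fun v dv h A hA hvA hdA x₀ ρ σ hρ hρσ hσ => ?_⟩
  obtain ⟨η, K, h1, h2, h3, h4, h5, h6⟩ := hC v dv h A hA hvA hdA x₀ ρ σ hρ hρσ
  refine ⟨η, K, h1, h2, h3, h4, fun x hx => h5 x (by push Not at hx; linarith), h6.trans ?_⟩
  set d := σ - ρ with hd
  have hd0 : 0 < d := sub_pos.2 hρσ
  have hd1 : d ≤ 1 := by rw [hd]; linarith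
  set I : ℝ≥0∞ := (∫⁻ x in {x | cubeN x₀ x ≤ σ}, ‖dv x‖ₑ ^ p) +
              ∫⁻ x in {x | cubeN x₀ x ≤ σ}, ‖v x‖ₑ ^ p with hI
  set V : ℝ≥0∞ := volume (A ∩ {x | cubeN x₀ x ≤ σ}) ^ (q * (1 / t - 1 / p))
  set c : ℝ≥0∞ := ENNReal.ofReal (2 / d) with hc
  have hc1 : 1 ≤ c := by
    rw [hc, ENNReal.one_le_ofReal, le_div_iff₀ hd0]; linarith
  have hcp : 1 ≤ c ^ p := ENNReal.one_le_rpow hc1 hp0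
  have hInt : (∫⁻ x in {x | cubeN x₀ x ≤ σ}, (‖dv x‖ₑ + c * ‖v x‖ₑ) ^ p) ^ (q / p) ≤
      ((2 : ℝ≥0∞) ^ (p - 1)) ^ (q / p) * 2 ^ q * (ENNReal.ofReal ((1 / d) ^ q) * I ^ (q / p)) := by
    have e1 : ∫⁻ x in {x | cubeN x₀ x ≤ σ}, (‖dv x‖ₑ + c * ‖v x‖ₑ) ^ p ≤
        2 ^ (p - 1) * (c ^ p * I) := by
      refine (lintegral_add_mul_rpow_le h.int_grad.aestronglyMeasurable.enorm.restrict (by simp [hc])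
        hp1).trans (mul_le_mul_right ?_ _)
      rw [hI, mul_add]
      exact add_le_add (le_mul_of_one_le_left zero_le hcp) le_rfl
    refine (ENNReal.rpow_le_rpow e1 (by positivity)).trans (le_of_eq ?_)
    rw [ENNReal.mul_rpow_of_nonneg _ _ (by positivity), ENNReal.mul_rpow_of_nonneg _ _ (by positivity),
      ← ENNReal.rpow_mul c, mul_div_cancel₀ _ hp0.ne', hc, ENNReal.ofReal_rpow_of_nonneg
        (by positivity) hq0.le, div_eq_mul_one_div 2 d, Real.mul_rpow (by norm_num) (by positivity),
      ENNReal.ofReal_mul (by positivity), ← ENNReal.ofReal_rpow_of_pos (by norm_num : (0 : ℝ) < 2)]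
    simp only [ENNReal.ofReal_ofNat]
    ring
  have hreal : d * (1 / d) ^ q * (1 / d) ^ (q / t) * σ ^ (m * (1 / q - 1 / t + 1 / m) * q) ≤
      (1 / d) ^ (q + q / t) := by
    have hs : σ ^ (m * (1 / q - 1 / t + 1 / m) * q) ≤ 1 := by
      refine Real.rpow_le_one (by linarith) hσ ?_
      have := H.sobolev
      have : 0 ≤ 1 / q - 1 / t + 1 / m := by linarith
      positivity
    have hs0 : 0 ≤ σ ^ (m * (1 / q - 1 / t + 1 / m) * q) := Real.rpow_nonneg (by linarith) _
    rw [Real.rpow_add (by positivity)]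
    set a := (1 / d) ^ q
    set b := (1 / d) ^ (q / t)
    have ha : 0 ≤ a := by positivity
    have hb : 0 ≤ b := by positivity
    calc d * a * b * _ ≤ 1 * a * b * 1 := by gcongr
      _ = a * b := by ring
  have e3 : ENNReal.ofReal ((1 / d) ^ (2 * q + q / t)) =
      ENNReal.ofReal ((1 / d) ^ (q + q / t)) * ENNReal.ofReal ((1 / d) ^ q) := by
    rw [← ENNReal.ofReal_mul (by positivity), ← Real.rpow_add (by positivity)]
    congr 2; ring
  rw [e3, ENNReal.coe_mul, ENNReal.coe_toNNReal h2t]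
  calc _ ≤ C * ENNReal.ofReal ((1 / d) ^ (q + q / t)) * V * (((2 : ℝ≥0∞) ^ (p - 1)) ^ (q / p) * 2 ^ q *
        (ENNReal.ofReal ((1 / d) ^ q) * I ^ (q / p))) := by
        gcongr
    _ = _ := by ring

theorem exists_caccioppoli_const {m : ℕ} {p q t L Q : ℝ} (H : AdmissibleExp m p q t)
    (hL : 0 ≤ L) (hQ : 1 ≤ Q) :
    ∃ C : ℝ≥0, ∀ (Ω : Set 𝔼[m + 1]) (f : 𝔼[m + 1] → 𝔼[m + 1] → ℝ) (G : 𝔼[m + 1] → ℝ),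
      HasPQGrowth Ω p q L f G →
      ∀ (u : 𝔼[m + 1] → ℝ) (du : 𝔼[m + 1] → 𝔼[m + 1]), IsQMinimizer (m + 1) Ω f Q u du →
      ∀ (v : 𝔼[m + 1] → ℝ) (dv : 𝔼[m + 1] → 𝔼[m + 1]), HasWeakGrad v dv → (∀ x, 0 ≤ v x) →
      ∫⁻ x, ‖v x‖ₑ ^ p ≠ ∞ → ∫⁻ x, ‖dv x‖ₑ ^ p ≠ ∞ →
      ∀ A : Set 𝔼[m + 1], MeasurableSet A → volume A ≠ ∞ → (∀ x, x ∉ A → v x = 0) →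
      (∀ x ∈ A, 0 < v x) → (∀ x, x ∉ A → dv x = 0) →
      ∀ x₀ ρ σ, 0 ≤ ρ → ρ < σ → σ ≤ 1 → {x | cubeN x₀ x ≤ σ} ⊆ Ω →
      (∀ x ∈ A, cubeN x₀ x ≤ σ → dv x = du x) →
      ∫⁻ x in {x | cubeN x₀ x ≤ ρ}, ‖dv x‖ₑ ^ p ≤
        C * (ENNReal.ofReal ((1 / (σ - ρ)) ^ (2 * q + q / t)) *
            (volume (A ∩ {x | cubeN x₀ x ≤ σ}) ^ (q * (1 / t - 1 / p)) *
            ((∫⁻ x in {x | cubeN x₀ x ≤ σ}, ‖dv x‖ₑ ^ p) +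
              ∫⁻ x in {x | cubeN x₀ x ≤ σ}, ‖v x‖ₑ ^ p) ^ (q / p)) +
          ∫⁻ x in A ∩ {x | cubeN x₀ x ≤ σ}, ENNReal.ofReal (G x)) := by
  obtain ⟨C0, hC0⟩ := exists_cutoff_energy_const H
  have ht0 : 0 < t := by linarith [H.one_le]
  have hp0 : 0 < p := by linarith [H.t_lt]
  have hq0 : 0 < q := by linarith [H.p_lt]
  have hq1 : 1 < q := by linarith [H.p_lt, H.t_lt, H.one_le]
  have htp : 0 ≤ 1 / t - 1 / p := by
    have := one_div_le_one_div_of_le ht0 H.t_lt.le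
    linarith
  set ϑ : ℝ := Q / (1 + Q) with hϑ
  have hϑ0 : 0 ≤ ϑ := by positivity
  have hϑ1 : ϑ < 1 := by rw [hϑ, div_lt_one (by positivity)]; linarith
  obtain ⟨K, hK⟩ := exists_hole_filling_const (γ := 2 * q + q / t) hϑ0 hϑ1 (by positivity)
  set c : ℝ≥0∞ := ENNReal.ofReal (L * q ^ q) * 2 ^ (q - 1) with hc
  have hct : c ≠ ∞ := ENNReal.mul_ne_top (by simp)
    (ENNReal.rpow_ne_top_of_nonneg (by linarith) (by simp))
  refine ⟨K * (c.toNNReal * C0 + 2), fun Ω f G h u du hu v dv hv hv0 hvp hdvp A hA hAt hvA hvA' hdA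
    x₀ ρ σ hρ hρσ hσ hΩ hdu => ?_⟩
  set Cu : ℝ → Set 𝔼[m + 1] := fun r => {x | cubeN x₀ x ≤ r} with hCu
  have hCum : ∀ r, MeasurableSet (Cu r) := fun r => measurableSet_cube x₀ r
  have hCuc : ∀ r, IsCompact (Cu r) := fun r =>
    (isCompact_closedBall x₀ _).of_isClosed_subset (isClosed_le (continuous_cubeN x₀) continuous_const)
      (cube_subset_closedBall x₀ r)
  have hCumono : ∀ {r s}, r ≤ s → Cu r ⊆ Cu s := fun hrs x hx => le_trans hx hrs
  set F : 𝔼[m + 1] → ℝ≥0∞ := fun x => ENNReal.ofReal (f x (du x) + G x) with hF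
  set I : ℝ≥0∞ := (∫⁻ x in Cu σ, ‖dv x‖ₑ ^ p) + ∫⁻ x in Cu σ, ‖v x‖ₑ ^ p with hI
  set V : ℝ≥0∞ := volume (A ∩ Cu σ) ^ (q * (1 / t - 1 / p)) with hV
  set GG : ℝ≥0∞ := ∫⁻ x in A ∩ Cu σ, ENNReal.ofReal (G x) with hGG
  set Φ : ℝ → ℝ≥0∞ := fun r => ∫⁻ x in A ∩ Cu r, F x with hΦ
  have hM : ∫⁻ x in Cu σ, F x ≠ ∞ :=
    ((hu.integrableOn h.open_dom (hCuc σ) hΩ).add (h.int.mono_set hΩ)).lintegral_lt_top.ne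
  have hmain := hK Φ (c * C0 * (V * I ^ (q / p))) (2 * GG) (∫⁻ x in Cu σ, F x) ρ σ hρσ hM
    (fun r hr => lintegral_mono_set (inter_subset_right.trans (hCumono hr))) ?_
  · have hlow : ∫⁻ x in Cu ρ, ‖dv x‖ₑ ^ p ≤ Φ ρ := by
      have e1 : ∫⁻ x in Cu ρ, ‖dv x‖ₑ ^ p = ∫⁻ x in A ∩ Cu ρ, ‖dv x‖ₑ ^ p := by
        rw [← Measure.restrict_restrict hA, ← lintegral_indicator hA]
        refine lintegral_congr fun x => ?_
        by_cases hx : x ∈ A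
        · rw [indicator_of_mem hx]
        · rw [indicator_of_notMem hx, hdA x hx]; simp [hp0]
      rw [e1]
      refine lintegral_mono_ae ?_
      have hle : volume.restrict (A ∩ Cu ρ) ≤ volume.restrict Ω :=
        Measure.restrict_mono (inter_subset_right.trans ((hCumono hρσ.le).trans hΩ)) le_rfl
      filter_upwards [h.lower.filter_mono (ae_mono hle), ae_restrict_mem (hA.inter (hCum ρ))]
        with x hx1 hx2
      rw [hdu x hx2.1 (hCumono hρσ.le hx2.2), ← ofReal_norm, ENNReal.ofReal_rpow_of_nonneg
        (norm_nonneg _) hp0.le]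
      exact ENNReal.ofReal_le_ofReal (by have := hx1 (du x); linarith)
    refine hlow.trans (hmain.trans ?_)
    rw [ENNReal.coe_mul, mul_assoc (K : ℝ≥0∞)]
    refine mul_le_mul_right ?_ _
    rw [ENNReal.coe_add, ENNReal.coe_mul, ENNReal.coe_toNNReal hct, mul_add]
    refine add_le_add ?_ ?_
    · calc _ = c * C0 * (ENNReal.ofReal ((1 / (σ - ρ)) ^ (2 * q + q / t)) * (V * I ^ (q / p))) := by
            ring
        _ ≤ _ := mul_le_mul_left le_self_add _
    · exact mul_le_mul_left (le_add_of_nonneg_left zero_le) GG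
  · intro r s hr hrs hs
    obtain ⟨η, K', h1, h2, h3, h4, h5, h6⟩ := hC0 v dv hv A hA hvA hdA x₀ r s (hρ.trans hr) hrs
      (hs.trans hσ)
    have key := qmin_shell_le H h hL hQ hu hv hv0 hvp hdvp hA hAt hvA hvA' hdA (hCuc s)
      ((hCumono hs).trans hΩ) (hCumono hrs.le) (fun x hx => hdu x hx.2 (hCumono hs hx.1))
      h1 h2 h3 h5 h4
    set S : ℝ≥0∞ := ∫⁻ x in A ∩ (Cu s \ Cu r), F x with hS
    set X : ℝ≥0∞ := ENNReal.ofReal ((1 / (s - r)) ^ (2 * q + q / t)) with hX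
    have hsplit : Φ r + S = Φ s := by
      rw [hΦ, hS, ← lintegral_union (hA.inter ((hCum s).diff (hCum r))) ?_, ← inter_union_distrib_left,
        union_sdiff_cancel (hCumono hrs.le)]
      exact Set.disjoint_left.2 fun x hx1 hx2 => hx2.2.2 hx1.2
    have hcost : ∫⁻ x, ‖v x‖ₑ ^ q * ‖gradient η x‖ₑ ^ q ≤ C0 * (X * (V * I ^ (q / p))) := by
      refine h6.trans ?_
      have e1 : volume (A ∩ {x | cubeN x₀ x ≤ s}) ^ (q * (1 / t - 1 / p)) ≤ V :=
        ENNReal.rpow_le_rpow (measure_mono (inter_subset_inter_right _ (hCumono hs))) (by positivity)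
      have e2 : (∫⁻ x in {x | cubeN x₀ x ≤ s}, ‖dv x‖ₑ ^ p) +
              ∫⁻ x in {x | cubeN x₀ x ≤ s}, ‖v x‖ₑ ^ p ≤ I :=
        add_le_add (lintegral_mono_set (hCumono hs)) (lintegral_mono_set (hCumono hs))
      gcongr
    have hG' : ∫⁻ x in A ∩ Cu s, ENNReal.ofReal (G x) ≤ GG :=
      lintegral_mono_set (inter_subset_inter_right _ (hCumono hs))
    have hQt : ENNReal.ofReal Q ≠ ∞ := by simp
    have hΦrt : Φ r ≠ ∞ := ((lintegral_mono_set (inter_subset_right.trans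
      (hCumono (hrs.le.trans hs)))).trans_lt hM.lt_top).ne
    -- hole filling
    have hfill : ENNReal.ofReal (1 + Q) * Φ r ≤ ENNReal.ofReal Q *
        (Φ s + (X * (c * C0 * (V * I ^ (q / p))) + 2 * GG)) := by
      rw [ENNReal.ofReal_add (by norm_num) (by linarith), ENNReal.ofReal_one, add_mul, one_mul]
      calc Φ r + ENNReal.ofReal Q * Φ r ≤ ENNReal.ofReal Q * (S + c * (C0 * (X * (V * I ^ (q / p)))) +
            2 * GG) + ENNReal.ofReal Q * Φ r := by
            refine add_le_add (key.trans ?_) le_rfl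
            gcongr
        _ = ENNReal.ofReal Q * ((Φ r + S) + (X * (c * C0 * (V * I ^ (q / p))) + 2 * GG)) := by ring
        _ = _ := by rw [hsplit]
    have hQ1 : ENNReal.ofReal (1 + Q) ≠ 0 := by
      rw [Ne, ENNReal.ofReal_eq_zero, not_le]; linarith
    have e4 : ENNReal.ofReal ϑ = ENNReal.ofReal Q / ENNReal.ofReal (1 + Q) := by
      rw [hϑ, ENNReal.ofReal_div_of_pos (by linarith)]
    have e5 : Φ r ≤ ENNReal.ofReal ϑ * (Φ s + (X * (c * C0 * (V * I ^ (q / p))) + 2 * GG)) := by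
      rw [e4, div_eq_mul_inv, mul_right_comm, ← div_eq_mul_inv,
        ENNReal.le_div_iff_mul_le (Or.inl hQ1) (Or.inl (by simp)), mul_comm (Φ r)]
      exact hfill
    refine e5.trans ?_
    rw [mul_add]
    refine add_le_add le_rfl (mul_le_of_le_one_left zero_le ?_)
    rw [← ENNReal.ofReal_one]
    exact ENNReal.ofReal_le_ofReal hϑ1.le

theorem exists_sobolev_cube_star_const {n : ℕ} (R : ℝ) {p : ℝ} (hp : 1 ≤ p) (hpn : p < n) :
    ∃ C : ℝ≥0, ∀ (v : 𝔼[n] → ℝ) (dv : 𝔼[n] → 𝔼[n]), HasWeakGrad v dv →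
      ∀ x₀ a b, a < b → {x | cubeN x₀ x ≤ b} ⊆ closedBall 0 R →
        (∫⁻ x in {x | cubeN x₀ x ≤ a}, ‖v x‖ₑ ^ (1 / (1 / p - 1 / n))) ^ (1 / p - 1 / n) ≤
          C * (∫⁻ x in {x | cubeN x₀ x ≤ b},
            (‖dv x‖ₑ + ENNReal.ofReal (1 / (b - a)) * ‖v x‖ₑ) ^ p) ^ (1 / p) := by
  have hp0 : 0 < p := by linarith
  set e : ℝ := 1 / p - 1 / n with he
  have he0 : 0 < e := sub_pos.2 (one_div_lt_one_div_of_lt hp0 hpn)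
  obtain ⟨C, hC⟩ := exists_sobolev_const (n := n) (r := 1 / e) R hp hpn (by positivity)
    (by rw [one_div_one_div])
  refine ⟨C, fun v dv h x₀ a b hab hR => ?_⟩
  obtain ⟨w, dw, hw, hwv, -, hw0, hdw⟩ := h.exists_cut x₀ hab
  have h1 : ∫⁻ x in {x | cubeN x₀ x ≤ a}, ‖v x‖ₑ ^ (1 / e) ≤ ∫⁻ x, ‖w x‖ₑ ^ (1 / e) := by
    rw [← lintegral_indicator (measurableSet_cube _ _)]
    refine lintegral_mono fun x => ?_
    by_cases hx : cubeN x₀ x ≤ a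
    · simp [indicator, hx, hwv x hx]
    · simp [indicator, hx]
  have h2 : ∫⁻ x, ‖dw x‖ₑ ^ p ≤ ∫⁻ x in {x | cubeN x₀ x ≤ b},
            (‖dv x‖ₑ + ENNReal.ofReal (1 / (b - a)) * ‖v x‖ₑ) ^ p := by
    rw [← lintegral_indicator (measurableSet_cube _ _)]
    refine lintegral_mono fun x => ?_
    by_cases hx : cubeN x₀ x ≤ b
    · simp only [indicator, mem_ofPred_eq, hx, if_true]
      gcongr
      exact hdw x
    · simp [(hw0 x hx).2, hp0]
  have h3 := hC w dw hw fun x hx => hR (by by_contra hh; exact hx (hw0 x hh).1)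
  rw [one_div_one_div] at h3
  refine (ENNReal.rpow_le_rpow h1 he0.le).trans (h3.trans ?_)
  gcongr

/-- The weighted `W^{1,p}` energy of `v` on a cube. -/
def cubeEnergy {n : ℕ} (p : ℝ) (v : 𝔼[n] → ℝ) (dv : 𝔼[n] → 𝔼[n]) (x₀ : 𝔼[n]) (r Λ : ℝ) : ℝ≥0∞ :=
  (∫⁻ x in {x | cubeN x₀ x ≤ r}, ‖dv x‖ₑ ^ p) +
    ENNReal.ofReal (Λ ^ p) * ∫⁻ x in {x | cubeN x₀ x ≤ r}, ‖v x‖ₑ ^ p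

theorem lintegral_grad_add_le_cubeEnergy {n : ℕ} {p : ℝ} (hp : 1 ≤ p) {v : 𝔼[n] → ℝ}
    {dv : 𝔼[n] → 𝔼[n]} (h : HasWeakGrad v dv) (x₀ : 𝔼[n]) {r Λ S : ℝ} (hS : 1 ≤ S) (hΛ : 0 ≤ Λ) :
    (∫⁻ x in {x | cubeN x₀ x ≤ r}, (‖dv x‖ₑ + ENNReal.ofReal (S * Λ) * ‖v x‖ₑ) ^ p) ^ (1 / p) ≤
      ENNReal.ofReal (2 * S) * cubeEnergy p v dv x₀ r Λ ^ (1 / p) := by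
  have hp0 : 0 < p := by linarith
  have h1 : ∫⁻ x in {x | cubeN x₀ x ≤ r}, (‖dv x‖ₑ + ENNReal.ofReal (S * Λ) * ‖v x‖ₑ) ^ p ≤
      ENNReal.ofReal (2 * S) ^ p * cubeEnergy p v dv x₀ r Λ := by
    refine (lintegral_add_mul_rpow_le h.int_grad.aestronglyMeasurable.enorm.restrict (by simp)
      hp).trans ?_
    rw [ENNReal.ofReal_mul (by norm_num : (0 : ℝ) ≤ 2), ENNReal.mul_rpow_of_nonneg _ _ hp0.le, mul_assoc,
      ENNReal.ofReal_ofNat]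
    have h2 : (1 : ℝ≥0∞) ≤ ENNReal.ofReal S ^ p :=
      ENNReal.one_le_rpow (by rwa [ENNReal.one_le_ofReal]) hp0
    refine mul_le_mul' (ENNReal.rpow_le_rpow_of_exponent_le (by norm_num) (by linarith)) ?_
    rw [cubeEnergy, mul_add, ENNReal.ofReal_mul (by linarith), ENNReal.mul_rpow_of_nonneg _ _ hp0.le,
      ← ENNReal.ofReal_rpow_of_nonneg hΛ hp0.le, ← mul_assoc]
    exact add_le_add (le_mul_of_one_le_left zero_le h2) le_rfl
  refine (ENNReal.rpow_le_rpow h1 (by positivity)).trans (le_of_eq ?_)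
  rw [ENNReal.mul_rpow_of_nonneg _ _ (by positivity), ← ENNReal.rpow_mul, mul_one_div_cancel hp0.ne',
    ENNReal.rpow_one]

/-- A level-set estimate from the Sobolev inequality. -/
theorem exists_levelSet_const {n : ℕ} (ρ : ℝ) {p : ℝ} (hp : 1 ≤ p) (hpn : p < n) {S : ℝ}
    (hS : 1 ≤ S) :
    ∃ C : ℝ, 0 < C ∧ ∀ (v : 𝔼[n] → ℝ) (dv : 𝔼[n] → 𝔼[n]), HasWeakGrad v dv →
      ∀ x₀ r s Λ, 0 < Λ → s - r = 1 / (S * Λ) → {x | cubeN x₀ x ≤ s} ⊆ closedBall 0 ρ →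
      ∀ a y m : ℝ, 0 ≤ a → 0 < y → 0 < m → a ≤ y * m ^ (1 / p - 1 / n) →
        cubeEnergy p v dv x₀ s Λ ≤ ENNReal.ofReal (a ^ p) →
        volume ({x | C * y ≤ v x} ∩ {x | cubeN x₀ x ≤ r}) ≤ ENNReal.ofReal m := by
  have hp0 : 0 < p := by linarith
  obtain ⟨C, hC⟩ := exists_sobolev_cube_star_const ρ hp hpn
  set e : ℝ := 1 / p - 1 / n with he
  have he0 : 0 < e := sub_pos.2 (one_div_lt_one_div_of_lt hp0 hpn)
  refine ⟨C * (2 * S) + 1, by positivity, fun v dv h x₀ r s Λ hΛ hrs hsub a y m ha hy hm hay hE => ?_⟩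
  set Δ : ℝ := (C * (2 * S) + 1) * y with hΔ
  have hΔ0 : 0 < Δ := by positivity
  have h1 : (∫⁻ x in {x | cubeN x₀ x ≤ r}, ‖v x‖ₑ ^ (1 / e)) ^ e ≤ ENNReal.ofReal (Δ * m ^ e) := by
    refine (hC v dv h x₀ r s (by have : 0 < 1 / (S * Λ) := by positivity
                                 linarith) hsub).trans ?_
    rw [hrs, one_div_one_div]
    calc _ ≤ (C : ℝ≥0∞) * (ENNReal.ofReal (2 * S) * ENNReal.ofReal a) := by
          refine mul_le_mul_right ((lintegral_grad_add_le_cubeEnergy hp h x₀ hS hΛ.le).trans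
            (mul_le_mul_right ?_ _)) _
          refine (ENNReal.rpow_le_rpow hE (by positivity)).trans (le_of_eq ?_)
          rw [ENNReal.ofReal_rpow_of_nonneg (by positivity) (by positivity), ← Real.rpow_mul ha,
            mul_one_div_cancel hp0.ne', Real.rpow_one]
      _ = ENNReal.ofReal (C * (2 * S * a)) := by
          rw [ENNReal.ofReal_mul (NNReal.coe_nonneg C), ENNReal.ofReal_mul (by positivity : 0 ≤ 2 * S),
            ENNReal.ofReal_coe_nnreal]
      _ ≤ _ := by
          refine ENNReal.ofReal_le_ofReal ?_
          have hme : 0 < m ^ e := by positivity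
          calc (C : ℝ) * (2 * S * a) ≤ C * (2 * S * (y * m ^ e)) := by gcongr
            _ ≤ C * (2 * S * (y * m ^ e)) + y * m ^ e := by linarith [mul_pos hy hme]
            _ = _ := by rw [hΔ]; ring
  have h2 : ENNReal.ofReal (Δ ^ (1 / e)) * volume ({x | Δ ≤ v x} ∩ {x | cubeN x₀ x ≤ r}) ≤
      ∫⁻ x in {x | cubeN x₀ x ≤ r}, ‖v x‖ₑ ^ (1 / e) := by
    rw [← Measure.restrict_apply' (measurableSet_cube x₀ r)]
    refine le_trans ?_ (mul_meas_ge_le_lintegral₀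
      (h.int.aestronglyMeasurable.enorm.pow_const _).restrict (ENNReal.ofReal (Δ ^ (1 / e))))
    refine mul_le_mul_right (measure_mono fun x (hx : Δ ≤ v x) => ?_) _
    change ENNReal.ofReal (Δ ^ (1 / e)) ≤ ‖v x‖ₑ ^ (1 / e)
    rw [← ENNReal.ofReal_rpow_of_nonneg hΔ0.le (by positivity), Real.enorm_of_nonneg (hΔ0.le.trans hx)]
    gcongr
  have h3 : ∫⁻ x in {x | cubeN x₀ x ≤ r}, ‖v x‖ₑ ^ (1 / e) ≤
      ENNReal.ofReal (Δ ^ (1 / e)) * ENNReal.ofReal m := by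
    have := ENNReal.rpow_le_rpow h1 (by positivity : 0 ≤ 1 / e)
    rwa [← ENNReal.rpow_mul, mul_one_div_cancel he0.ne', ENNReal.rpow_one,
      ENNReal.ofReal_rpow_of_nonneg (by positivity) (by positivity), Real.mul_rpow hΔ0.le
      (by positivity), ← Real.rpow_mul hm.le, mul_one_div_cancel he0.ne', Real.rpow_one,
      ENNReal.ofReal_mul (by positivity)] at this
  refine (ENNReal.mul_le_mul_iff_right ?_ ?_).1 (h2.trans h3)
  · rw [Ne, ENNReal.ofReal_eq_zero, not_le]; positivity
  · simp

theorem le_mul_max_one_rpow {C x p : ℝ} (hp : 1 ≤ p) (hx : 0 ≤ x) :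
    C * x ^ p ≤ (max C 1 * x) ^ p := by
  have h1 : (1 : ℝ) ≤ max C 1 := le_max_right _ _
  rw [Real.mul_rpow (by linarith) hx]
  have h2 := Real.self_le_rpow_of_one_le h1 hp
  have := Real.rpow_nonneg hx p
  exact mul_le_mul_of_nonneg_right ((le_max_left _ _).trans h2) this

theorem exists_energy_step_const {m : ℕ} {p q t L Q : ℝ} (H : AdmissibleExp m p q t)
    (hL : 0 ≤ L) (hQ : 1 ≤ Q) (R : ℝ) {S : ℝ} (hS : 1 ≤ S) :
    ∃ C : ℝ, 1 ≤ C ∧ ∀ (Ω : Set 𝔼[m + 1]) (f : 𝔼[m + 1] → 𝔼[m + 1] → ℝ) (G : 𝔼[m + 1] → ℝ),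
      HasPQGrowth Ω p q L f G →
      ∀ (u : 𝔼[m + 1] → ℝ) (du : 𝔼[m + 1] → 𝔼[m + 1]), IsQMinimizer (m + 1) Ω f Q u du →
      ∀ (v' v : 𝔼[m + 1] → ℝ) (dv' dv : 𝔼[m + 1] → 𝔼[m + 1]), HasWeakGrad v' dv' →
      (∀ x, 0 ≤ v' x) → ∫⁻ x, ‖v' x‖ₑ ^ p ≠ ∞ → ∫⁻ x, ‖dv' x‖ₑ ^ p ≠ ∞ →
      (∀ x, ‖v' x‖ₑ ≤ ‖v x‖ₑ) → (∀ x, ‖dv' x‖ₑ ≤ ‖dv x‖ₑ) →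
      ∀ A : Set 𝔼[m + 1], MeasurableSet A → volume A ≠ ∞ → (∀ x, x ∉ A → v' x = 0) →
      (∀ x ∈ A, 0 < v' x) → (∀ x, x ∉ A → dv' x = 0) →
      ∀ x₀ r' r s Λ, 1 ≤ Λ → 0 ≤ r' → r - r' = 1 / (S * Λ) → r ≤ s → r ≤ 1 →
      {x | cubeN x₀ x ≤ r} ⊆ Ω → {x | cubeN x₀ x ≤ r} ⊆ closedBall 0 R →
      (∀ x ∈ A, cubeN x₀ x ≤ r → dv' x = du x) →
      ∀ a V h : ℝ, 0 ≤ a → 0 ≤ V → 0 ≤ h →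
        volume (A ∩ {x | cubeN x₀ x ≤ r}) ≤ ENNReal.ofReal V →
        ∫⁻ x in A ∩ {x | cubeN x₀ x ≤ r}, ENNReal.ofReal (G x) ≤ ENNReal.ofReal (h ^ p) →
        cubeEnergy p v dv x₀ s Λ ≤ ENNReal.ofReal (a ^ p) →
        cubeEnergy p v' dv' x₀ r' (2 * Λ) ≤ ENNReal.ofReal
          ((C * (Λ ^ ((2 * q + q / t) / p) * V ^ (q * (1 / t - 1 / p) / p) * a ^ (q / p) +
            Λ * V ^ (1 / ((m + 1 : ℕ) : ℝ)) * a + h)) ^ p) := by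
  have ht0 : 0 < t := by linarith [H.one_le]
  have hp1 : 1 ≤ p := by linarith [H.t_lt, H.one_le]
  have hp0 : 0 < p := by linarith
  have hq0 : 0 < q := by linarith [H.p_lt]
  obtain ⟨C1, hC1⟩ := exists_caccioppoli_const H hL hQ
  obtain ⟨C2, hC2⟩ := exists_sobolev_cube_const R hp1 H.p_lt_dim
  set γ : ℝ := 2 * q + q / t with hγ
  have hγ0 : 0 < γ := by positivity
  have htp : 0 < 1 / t - 1 / p := sub_pos.2 (one_div_lt_one_div_of_lt ht0 H.t_lt)
  set ε : ℝ := q * (1 / t - 1 / p) with hε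
  have hε0 : 0 < ε := by positivity
  set D : ℝ := max (C1 : ℝ) 1 * S ^ (γ / p) + 4 * S * C2 + max (C1 : ℝ) 1 with hD
  have hC11 : (1 : ℝ) ≤ max (C1 : ℝ) 1 := le_max_right _ _
  refine ⟨D, ?_, fun Ω f G hG u du hu v' v dv' dv hv' hv0 hvp hdvp hvv hdvv A hA hAt hvA hvA' hdA
    x₀ r' r s Λ hΛ hr' hrr' hrs hr1 hΩ hball hdu a V h ha hV hh hAV hGh hE => ?_⟩
  · have : 0 ≤ max (C1 : ℝ) 1 * S ^ (γ / p) := by positivity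
    have : 0 ≤ 4 * S * C2 := by positivity
    rw [hD]
    linarith
  have hΛ0 : 0 < Λ := by linarith
  have hS0 : 0 < S := by linarith
  have hr'r : r' < r := by
    have : 0 < 1 / (S * Λ) := by positivity
    linarith
  have hE' : cubeEnergy p v' dv' x₀ r Λ ≤ ENNReal.ofReal (a ^ p) := by
    refine le_trans (add_le_add ?_ ?_) hE
    · exact (lintegral_mono_set fun x (hx : cubeN x₀ x ≤ r) => hx.trans hrs).trans
        (lintegral_mono fun x => ENNReal.rpow_le_rpow (hdvv x) hp0.le)
    · exact mul_le_mul_right ((lintegral_mono_set fun x (hx : cubeN x₀ x ≤ r) => hx.trans hrs).trans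
        (lintegral_mono fun x => ENNReal.rpow_le_rpow (hvv x) hp0.le)) _
  -- gradient part
  have hgrad : ∫⁻ x in {x | cubeN x₀ x ≤ r'}, ‖dv' x‖ₑ ^ p ≤ ENNReal.ofReal
      ((max (C1 : ℝ) 1 * (S ^ (γ / p) * (Λ ^ (γ / p) * V ^ (ε / p) * a ^ (q / p)))) ^ p) +
      ENNReal.ofReal ((max (C1 : ℝ) 1 * h) ^ p) := by
    have e1 := hC1 Ω f G hG u du hu v' dv' hv' hv0 hvp hdvp A hA hAt hvA hvA' hdA x₀ r' r hr' hr'r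
      hr1 hΩ hdu
    rw [hrr', one_div_one_div] at e1
    have e2 : (∫⁻ x in {x | cubeN x₀ x ≤ r}, ‖dv' x‖ₑ ^ p) +
              ∫⁻ x in {x | cubeN x₀ x ≤ r}, ‖v' x‖ₑ ^ p ≤ ENNReal.ofReal (a ^ p) := by
      refine le_trans (add_le_add le_rfl (le_mul_of_one_le_left zero_le ?_)) hE'
      rw [ENNReal.one_le_ofReal]
      exact Real.one_le_rpow hΛ hp0.le
    refine e1.trans ?_
    rw [mul_add]
    refine add_le_add ?_ ?_
    · calc _ ≤ (C1 : ℝ≥0∞) * (ENNReal.ofReal ((S * Λ) ^ γ) * (ENNReal.ofReal V ^ ε *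
            ENNReal.ofReal (a ^ p) ^ (q / p))) := by gcongr
        _ = ENNReal.ofReal (C1 * ((S ^ (γ / p) * (Λ ^ (γ / p) * V ^ (ε / p) * a ^ (q / p))) ^ p)) := by
          have hSΛ : 0 ≤ S ^ (γ / p) * Λ ^ (γ / p) := by positivity
          have i1 : (S ^ (γ / p) * (Λ ^ (γ / p) * V ^ (ε / p) * a ^ (q / p))) ^ p =
              (S * Λ) ^ γ * (V ^ ε * (a ^ p) ^ (q / p)) := by
            rw [Real.mul_rpow (by positivity) (by positivity),
              Real.mul_rpow (by positivity) (by positivity),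
              Real.mul_rpow (by positivity) (by positivity), ← Real.rpow_mul hS0.le,
              ← Real.rpow_mul hΛ0.le, ← Real.rpow_mul hV, ← Real.rpow_mul ha, ← Real.rpow_mul ha,
              div_mul_cancel₀ _ hp0.ne', div_mul_cancel₀ _ hp0.ne', div_mul_cancel₀ _ hp0.ne',
              mul_div_cancel₀ _ hp0.ne', Real.mul_rpow hS0.le hΛ0.le]
            ring
          rw [i1, ENNReal.ofReal_mul (NNReal.coe_nonneg C1), ENNReal.ofReal_mul (by positivity),
            ENNReal.ofReal_mul (by positivity), ENNReal.ofReal_coe_nnreal,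
            ENNReal.ofReal_rpow_of_nonneg hV hε0.le,
            ENNReal.ofReal_rpow_of_nonneg (by positivity) (by positivity)]
        _ ≤ _ := ENNReal.ofReal_le_ofReal (le_mul_max_one_rpow hp1 (by positivity))
    · calc _ ≤ (C1 : ℝ≥0∞) * ENNReal.ofReal (h ^ p) := mul_le_mul_right hGh _
        _ = ENNReal.ofReal (C1 * h ^ p) := by
          rw [ENNReal.ofReal_mul (NNReal.coe_nonneg C1), ENNReal.ofReal_coe_nnreal]
        _ ≤ _ := ENNReal.ofReal_le_ofReal (le_mul_max_one_rpow hp1 hh)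
  -- lower order part
  have hlow : ENNReal.ofReal ((2 * Λ) ^ p) * ∫⁻ x in {x | cubeN x₀ x ≤ r'}, ‖v' x‖ₑ ^ p ≤
      ENNReal.ofReal ((4 * S * C2 * (Λ * V ^ (1 / ((m + 1 : ℕ) : ℝ)) * a)) ^ p) := by
    have e1 := hC2 v' dv' hv' A hA hvA hdA x₀ r' r hr'r hball
    rw [hrr', one_div_one_div] at e1
    have e2 : (∫⁻ x in {x | cubeN x₀ x ≤ r'}, ‖v' x‖ₑ ^ p) ^ (1 / p) ≤
        ENNReal.ofReal (C2 * V ^ (1 / ((m + 1 : ℕ) : ℝ)) * (2 * S * a)) := by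
      refine e1.trans ?_
      rw [ENNReal.ofReal_mul
          (by positivity : 0 ≤ (C2 : ℝ) * V ^ (1 / ((m + 1 : ℕ) : ℝ))),
        ENNReal.ofReal_mul (NNReal.coe_nonneg C2),
        ENNReal.ofReal_coe_nnreal, ENNReal.ofReal_mul (by positivity : 0 ≤ 2 * S),
        ← ENNReal.ofReal_rpow_of_nonneg hV (by positivity)]
      refine mul_le_mul' (mul_le_mul_right (ENNReal.rpow_le_rpow hAV (by positivity)) _) ?_
      refine (lintegral_grad_add_le_cubeEnergy hp1 hv' x₀ hS hΛ0.le).trans (mul_le_mul_right ?_ _)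
      refine (ENNReal.rpow_le_rpow hE' (by positivity)).trans (le_of_eq ?_)
      rw [ENNReal.ofReal_rpow_of_nonneg (by positivity) (by positivity), ← Real.rpow_mul ha,
        mul_one_div_cancel hp0.ne', Real.rpow_one]
    have e3 := ENNReal.rpow_le_rpow e2 hp0.le
    rw [← ENNReal.rpow_mul, one_div_mul_cancel hp0.ne', ENNReal.rpow_one] at e3
    refine (mul_le_mul_right e3 _).trans (le_of_eq ?_)
    rw [ENNReal.ofReal_rpow_of_nonneg (by positivity) hp0.le, ← ENNReal.ofReal_mul (by positivity),
      ← Real.mul_rpow (by positivity) (by positivity)]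
    congr 2
    ring
  refine (add_le_add hgrad hlow).trans ?_
  set X := Λ ^ (γ / p) * V ^ (ε / p) * a ^ (q / p) with hX
  set Y := Λ * V ^ (1 / ((m + 1 : ℕ) : ℝ)) * a with hY
  have hX0 : 0 ≤ X := by positivity
  have hY0 : 0 ≤ Y := by positivity
  have hx : 0 ≤ max (C1 : ℝ) 1 * (S ^ (γ / p) * X) := by positivity
  have hy : 0 ≤ 4 * S * C2 * Y := by positivity
  have hz : 0 ≤ max (C1 : ℝ) 1 * h := by positivity
  rw [← ENNReal.ofReal_add (by positivity) (by positivity), ← ENNReal.ofReal_add (by positivity)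
    (by positivity)]
  refine ENNReal.ofReal_le_ofReal ?_
  refine (add_le_add (Real.add_rpow_le_rpow_add hx hz hp1) le_rfl).trans
    ((Real.add_rpow_le_rpow_add (by positivity) hy hp1).trans ?_)
  refine Real.rpow_le_rpow (by positivity) ?_ hp0.le
  have hSγ : 0 ≤ max (C1 : ℝ) 1 * S ^ (γ / p) := by positivity
  have hSC : 0 ≤ 4 * S * C2 := by positivity
  have hm1 : 0 ≤ max (C1 : ℝ) 1 := by positivity
  rw [hD]
  nlinarith [mul_nonneg hSγ hY0, mul_nonneg hSγ hh, mul_nonneg hSC hX0, mul_nonneg hSC hh,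
    mul_nonneg hm1 hX0, mul_nonneg hm1 hY0]

/-- The majorant of the energies along the iteration. -/
def iterBound (θ e C b : ℝ) (h : ℕ → ℝ) : ℕ → ℝ
  | 0 => b
  | l + 1 => 1 / 2 * θ ^ e * iterBound θ e C b h l + C * h l

theorem iterBound_pos {θ e C b : ℝ} {h : ℕ → ℝ} (hθ : 0 < θ) (hC : 0 ≤ C) (hb : 0 < b)
    (hh : ∀ l, 0 ≤ h l) (l : ℕ) : 0 < iterBound θ e C b h l := by
  induction l with
  | zero => exact hb
  | succ l ih =>
    have := mul_nonneg hC (hh l)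
    have : 0 < 1 / 2 * θ ^ e * iterBound θ e C b h l := by positivity
    simp only [iterBound]
    linarith

theorem iterBound_div_succ {θ e C b m : ℝ} {h : ℕ → ℝ} (hθ : 0 < θ) (hm : 0 < m) (l : ℕ) :
    iterBound θ e C b h (l + 1) / (θ ^ (l + 1) * m) ^ e =
      1 / 2 * (iterBound θ e C b h l / (θ ^ l * m) ^ e) +
        C / θ ^ e * (h l / (θ ^ l * m) ^ e) := by
  have h1 : (θ ^ (l + 1) * m) ^ e = θ ^ e * (θ ^ l * m) ^ e := by
    rw [← Real.mul_rpow hθ.le (by positivity)]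
    congr 1
    ring
  have h2 : 0 < θ ^ e := by positivity
  have h3 : 0 < (θ ^ l * m) ^ e := by positivity
  rw [h1]
  simp only [iterBound]
  field_simp

theorem sum_iterBound_le {θ e C b m lam : ℝ} {h : ℕ → ℝ} (hθ : 0 < θ) (hm : 0 < m) (hC : 0 ≤ C)
    (hb : 0 < b)
    (hsum : ∀ N : ℕ, ∑ l ∈ Finset.range N, h l / (θ ^ l * m) ^ e ≤ lam) (N : ℕ) :
    ∑ l ∈ Finset.range N, iterBound θ e C b h l / (θ ^ l * m) ^ e ≤
      2 * (b / m ^ e + C / θ ^ e * lam) := by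
  have hD : 0 ≤ C / θ ^ e := by positivity
  have hlam : 0 ≤ lam := by simpa using hsum 0
  induction N with
  | zero =>
    have : 0 ≤ b / m ^ e := by positivity
    have := mul_nonneg hD hlam
    simp only [Finset.range_zero, Finset.sum_empty]
    linarith
  | succ N ih =>
    rw [Finset.sum_range_succ']
    simp only [iterBound_div_succ hθ hm]
    rw [Finset.sum_add_distrib, ← Finset.mul_sum, ← Finset.mul_sum]
    have := mul_le_mul_of_nonneg_left (hsum N) hD
    simp only [pow_zero, one_mul, iterBound]
    linarith

theorem iterBound_le {θ e C b m lam : ℝ} {h : ℕ → ℝ} (hθ : 0 < θ) (hθ1 : θ ≤ 1) (he : 0 ≤ e)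
    (hm : 0 < m) (hC : 0 ≤ C) (hb : 0 < b) (hh : ∀ l, 0 ≤ h l)
    (hsum : ∀ N : ℕ, ∑ l ∈ Finset.range N, h l / (θ ^ l * m) ^ e ≤ lam)
    (hlam : C / θ ^ e * lam * m ^ e ≤ b) (N : ℕ) :
    iterBound θ e C b h N ≤ 2 * b := by
  have hD : 0 ≤ C / θ ^ e := by positivity
  have hlam0 : 0 ≤ lam := by simpa using hsum 0
  have h1 : iterBound θ e C b h N / (θ ^ N * m) ^ e ≤
      b / m ^ e + C / θ ^ e * ∑ l ∈ Finset.range N, h l / (θ ^ l * m) ^ e := by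
    induction N with
    | zero => simp [iterBound]
    | succ N ih =>
      rw [iterBound_div_succ hθ hm, Finset.sum_range_succ, mul_add]
      have := iterBound_pos (e := e) hθ hC hb hh N
      have : 0 ≤ iterBound θ e C b h N / (θ ^ N * m) ^ e := by positivity
      linarith
  have h2 : iterBound θ e C b h N / (θ ^ N * m) ^ e ≤ b / m ^ e + C / θ ^ e * lam :=
    h1.trans (add_le_add le_rfl (mul_le_mul_of_nonneg_left (hsum N) hD))
  have hme : 0 < m ^ e := by positivity
  have h3 : (θ ^ N * m) ^ e ≤ m ^ e :=
    Real.rpow_le_rpow (by positivity) (mul_le_of_le_one_left hm.le (pow_le_one₀ hθ.le hθ1)) he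
  rw [div_le_iff₀ (by positivity)] at h2
  refine h2.trans ?_
  have h4 := mul_nonneg hD hlam0
  calc _ ≤ (b / m ^ e + C / θ ^ e * lam) * m ^ e := by gcongr
    _ = b + C / θ ^ e * lam * m ^ e := by field_simp
    _ ≤ 2 * b := by linarith

theorem eventually_mul_rpow_le {C s δ : ℝ} (hs : 0 < s) (hδ : 0 < δ) :
    ∀ᶠ x : ℝ in 𝓝[>] 0, C * x ^ s ≤ δ := by
  have h1 : Filter.Tendsto (fun x : ℝ => C * x ^ s) (𝓝 0) (𝓝 (C * 0 ^ s)) :=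
    ((Real.continuousAt_rpow_const 0 s (Or.inr hs.le)).const_mul C)
  rw [Real.zero_rpow hs.ne', mul_zero] at h1
  exact (h1.mono_left nhdsWithin_le_nhds).eventually_le_const hδ

theorem exists_ratio (g n : ℝ) {d : ℝ} (hd : 0 < d) (hn : 0 < n) :
    ∃ θ : ℝ, 0 < θ ∧ θ < 1 ∧ 2 ^ g * θ ^ d ≤ 1 ∧ 2 * θ ^ (1 / n) ≤ 1 := by
  have h : ∀ᶠ θ : ℝ in 𝓝[>] 0, θ ∈ Ioo (0 : ℝ) 1 := Ioo_mem_nhdsGT one_pos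
  obtain ⟨θ, h1, h2, h3⟩ := (h.and ((eventually_mul_rpow_le (C := 2 ^ g) hd one_pos).and
    (eventually_mul_rpow_le (C := 2) (by positivity : 0 < 1 / n) one_pos))).exists
  exact ⟨θ, h1.1, h1.2, h2, h3⟩

theorem pow_rpow_mul_le {B θ g d m : ℝ} (hB : 0 < B) (hθ : 0 < θ) (hm : 0 ≤ m)
    (h : B ^ g * θ ^ d ≤ 1) (l : ℕ) : (B ^ l) ^ g * (θ ^ l * m) ^ d ≤ m ^ d := by
  have e1 : (B ^ l) ^ g * (θ ^ l * m) ^ d = (B ^ g * θ ^ d) ^ l * m ^ d := by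
    rw [Real.mul_rpow (by positivity) hm, mul_pow, ← Real.rpow_natCast B l,
      ← Real.rpow_natCast θ l, ← Real.rpow_natCast (B ^ g) l, ← Real.rpow_natCast (θ ^ d) l,
      ← Real.rpow_mul hB.le, ← Real.rpow_mul hθ.le, ← Real.rpow_mul hB.le, ← Real.rpow_mul hθ.le,
      mul_comm g, mul_comm d]
    ring
  rw [e1]
  exact mul_le_of_le_one_left (by positivity) (pow_le_one₀ (by positivity) h)

theorem iterBound_step {θ e C b m g d n κ : ℝ} {h : ℕ → ℝ} (hθ : 0 < θ) (hm : 0 < m) (hC : 0 ≤ C)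
    (hκ : 1 ≤ κ) (h1 : 2 ^ g * θ ^ d ≤ 1) (h2 : 2 * θ ^ (1 / n) ≤ 1)
    (h3 : C * (m ^ d * (2 * b) ^ (κ - 1)) ≤ θ ^ e / 4) (h4 : C * m ^ (1 / n) ≤ θ ^ e / 4) (l : ℕ)
    (ha : 0 < iterBound θ e C b h l) (ha2 : iterBound θ e C b h l ≤ 2 * b) :
    C * ((2 ^ l) ^ g * (θ ^ l * m) ^ d * iterBound θ e C b h l ^ κ +
      2 ^ l * (θ ^ l * m) ^ (1 / n) * iterBound θ e C b h l + h l) ≤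
      iterBound θ e C b h (l + 1) := by
  set a := iterBound θ e C b h l with hadef
  have i1 := pow_rpow_mul_le two_pos hθ hm.le h1 l
  have i2 : (2 ^ l : ℝ) * (θ ^ l * m) ^ (1 / n) ≤ m ^ (1 / n) := by
    have := pow_rpow_mul_le (g := 1) two_pos hθ hm.le (by rwa [Real.rpow_one]) l
    rwa [Real.rpow_one] at this
  have i3 : a ^ κ ≤ (2 * b) ^ (κ - 1) * a := by
    have : a ^ κ = a ^ (κ - 1) * a := by
      rw [← Real.rpow_add_one ha.ne', sub_add_cancel]
    rw [this]
    exact mul_le_mul_of_nonneg_right (Real.rpow_le_rpow ha.le ha2 (by linarith)) ha.le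
  have j1 : C * ((2 ^ l) ^ g * (θ ^ l * m) ^ d * a ^ κ) ≤ θ ^ e / 4 * a := by
    calc _ ≤ C * (m ^ d * ((2 * b) ^ (κ - 1) * a)) := by gcongr
      _ = C * (m ^ d * (2 * b) ^ (κ - 1)) * a := by ring
      _ ≤ _ := by gcongr
  have j2 : C * (2 ^ l * (θ ^ l * m) ^ (1 / n) * a) ≤ θ ^ e / 4 * a := by
    calc _ ≤ C * (m ^ (1 / n) * a) := by gcongr
      _ = C * m ^ (1 / n) * a := by ring
      _ ≤ _ := by gcongr
  simp only [iterBound, ← hadef]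
  linarith

/-- Choice of the initial measure level in the iteration. -/
theorem exists_initial_level {θ e C n d κ D M : ℝ} (he : 0 < e) (hn : 0 < n) (hd : 0 < d)
    (hθ : 0 < θ) (hC : 0 ≤ C) (hD : 0 ≤ D) (hM : 0 < M) :
    ∃ K : ℝ, 0 < K ∧ ∀ b lam : ℝ, 0 < b → 0 ≤ lam → ∃ m : ℝ, 0 < m ∧ m ≤ M ∧
      C * (m ^ d * (2 * b) ^ (κ - 1)) ≤ θ ^ e / 4 ∧ C * m ^ (1 / n) ≤ θ ^ e / 4 ∧
      D * lam * m ^ e ≤ b ∧ b / m ^ e = K * (b + b ^ (1 + e * (κ - 1) / d)) + D * lam := by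
  have hδ : 0 < θ ^ e / 4 := by positivity
  have h : ∀ᶠ x : ℝ in 𝓝[>] 0, x ∈ Ioo (0 : ℝ) M := Ioo_mem_nhdsGT hM
  obtain ⟨m₁, h1, h2, h3⟩ := (h.and ((eventually_mul_rpow_le (C := C * 2 ^ (κ - 1)) hd hδ).and
    (eventually_mul_rpow_le (C := C) (by positivity : 0 < 1 / n) hδ))).exists
  have hm₁ := h1.1
  refine ⟨m₁ ^ (-e), by positivity, fun b lam hb hlam => ?_⟩
  set β := e * (κ - 1) / d with hβ
  set T := m₁ ^ (-e) * (1 + b ^ β) + D * lam / b with hT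
  have hK : 0 < m₁ ^ (-e) := by positivity
  have hbβ : 0 < b ^ β := by positivity
  have hDl : 0 ≤ D * lam / b := by positivity
  have hT0 : 0 < T := by positivity
  have key : ∀ z : ℝ, 0 < z → z ^ (-e) ≤ T → T ^ (-(1 / e)) ≤ z := by
    intro z hz hzT
    have := Real.rpow_le_rpow_of_nonpos (by positivity) hzT (by
      rw [neg_nonpos]; positivity : -(1 / e) ≤ 0)
    rwa [← Real.rpow_mul hz.le, neg_mul_neg, mul_one_div_cancel he.ne', Real.rpow_one] at this
  have hme : (T ^ (-(1 / e))) ^ e = T⁻¹ := by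
    rw [← Real.rpow_mul hT0.le, neg_mul, one_div_mul_cancel he.ne', Real.rpow_neg_one]
  have hm0 : 0 < T ^ (-(1 / e)) := by positivity
  have k1 : T ^ (-(1 / e)) ≤ m₁ := key _ hm₁ (by nlinarith)
  have k2 : T ^ (-(1 / e)) ≤ m₁ * b ^ (-(β / e)) := by
    refine key _ (by positivity) ?_
    rw [Real.mul_rpow hm₁.le (by positivity), ← Real.rpow_mul hb.le, neg_mul_neg,
      div_mul_cancel₀ _ he.ne']
    nlinarith
  refine ⟨T ^ (-(1 / e)), hm0, k1.trans h1.2.le, ?_, ?_, ?_, ?_⟩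
  · refine le_trans ?_ h2
    calc _ ≤ C * ((m₁ * b ^ (-(β / e))) ^ d * (2 * b) ^ (κ - 1)) := by gcongr
      _ = C * 2 ^ (κ - 1) * m₁ ^ d * (b ^ (-(β / e) * d) * b ^ (κ - 1)) := by
        rw [Real.mul_rpow hm₁.le (by positivity), ← Real.rpow_mul hb.le,
          Real.mul_rpow two_pos.le hb.le]
        ring
      _ = _ := by
        rw [← Real.rpow_add hb, hβ]
        have : -(e * (κ - 1) / d / e) * d + (κ - 1) = 0 := by
          field_simp
          ring
        rw [this, Real.rpow_zero, mul_one]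
  · refine le_trans ?_ h3
    gcongr
  · rw [hme, ← div_eq_mul_inv, div_le_iff₀ hT0]
    have : b * T = m₁ ^ (-e) * (1 + b ^ β) * b + D * lam := by
      rw [hT]
      field_simp
    rw [this]
    have : 0 ≤ m₁ ^ (-e) * (1 + b ^ β) * b := by positivity
    linarith
  · rw [hme, div_inv_eq_mul, hT, Real.rpow_add hb, Real.rpow_one]
    field_simp

set_option maxHeartbeats 1600000 in
theorem exists_cube_sup_const {m : ℕ} {p q t L Q : ℝ} (H : AdmissibleExp m p q t)
    (hL : 0 ≤ L) (hQ : 1 ≤ Q) (ρ : ℝ) {R M : ℝ} (hR0 : 0 < R) (hR1 : R ≤ 1) (hM : 0 < M) :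
    ∃ θ c : ℝ, 0 < θ ∧ θ < 1 ∧ 0 ≤ c ∧
      ∀ (Ω : Set 𝔼[m + 1]) (f : 𝔼[m + 1] → 𝔼[m + 1] → ℝ) (G : 𝔼[m + 1] → ℝ),
      HasPQGrowth Ω p q L f G →
      ∀ (u : 𝔼[m + 1] → ℝ) (du : 𝔼[m + 1] → 𝔼[m + 1]), IsQMinimizer (m + 1) Ω f Q u du →
      ∀ (w : 𝔼[m + 1] → ℝ) (dw : 𝔼[m + 1] → 𝔼[m + 1]), HasWeakGrad w dw → Measurable w →
      Function.support w ⊆ closedBall 0 ρ →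
      ∫⁻ x, ‖w x‖ₑ ^ p ≠ ∞ → ∫⁻ x, ‖dw x‖ₑ ^ p ≠ ∞ →
      ∀ x₀, {x | cubeN x₀ x ≤ R} ⊆ Ω → {x | cubeN x₀ x ≤ R} ⊆ closedBall 0 ρ →
      (∀ x, cubeN x₀ x ≤ R → dw x = du x) →
      ∀ Hf : ℝ → ℝ, (∀ s, 0 ≤ Hf s) →
      (∀ A, MeasurableSet A → A ⊆ {x | cubeN x₀ x ≤ R} → ∀ s, 0 < s → s ≤ M →
        volume A ≤ ENNReal.ofReal s → ∫⁻ x in A, ENNReal.ofReal (G x) ≤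
          ENNReal.ofReal (Hf s ^ p)) →
      ∀ lam : ℝ, (∀ s, 0 < s → s ≤ M → ∀ N : ℕ, ∑ l ∈ Finset.range N,
        Hf (θ ^ l * s) / (θ ^ l * s) ^ (1 / p - 1 / ((m + 1 : ℕ) : ℝ)) ≤ lam) →
      ∀ b : ℝ, 0 < b → cubeEnergy p (fun x => max (w x) 0) ({x | 0 < w x}.indicator dw) x₀ R 1 ≤
        ENNReal.ofReal (b ^ p) →
      ∀ᵐ x, cubeN x₀ x ≤ R / 2 → w x ≤ c * (b + b ^ (1 + (1 / p - 1 / ((m + 1 : ℕ) : ℝ)) *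
        (q / p - 1) / (q * (1 / t - 1 / p) / p)) + lam) := by
  have ht0 : 0 < t := by linarith [H.one_le]
  have hp1 : 1 ≤ p := by linarith [H.t_lt, H.one_le]
  have hp0 : 0 < p := by linarith
  have hq0 : 0 < q := by linarith [H.p_lt]
  have htp : 0 < 1 / t - 1 / p := sub_pos.2 (one_div_lt_one_div_of_lt ht0 H.t_lt)
  have hn0 : (0 : ℝ) < ((m + 1 : ℕ) : ℝ) := by positivity
  have he : 0 < 1 / p - 1 / ((m + 1 : ℕ) : ℝ) :=
    sub_pos.2 (one_div_lt_one_div_of_lt hp0 H.p_lt_dim)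
  set n : ℝ := ((m + 1 : ℕ) : ℝ) with hn
  set e : ℝ := 1 / p - 1 / n with he_def
  set d : ℝ := q * (1 / t - 1 / p) / p with hd_def
  set g : ℝ := (2 * q + q / t) / p with hg_def
  have hd : 0 < d := by positivity
  have hκ : 1 ≤ q / p := (one_le_div hp0).2 H.p_lt.le
  have hS : 1 ≤ 8 / R := by rw [one_le_div hR0]; linarith
  obtain ⟨C₁, hC₁1, hC₁⟩ := exists_energy_step_const H hL hQ ρ hS
  obtain ⟨C₂, hC₂0, hC₂⟩ := exists_levelSet_const (n := m + 1) ρ hp1 H.p_lt_dim hS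
  have hC₁0 : 0 ≤ C₁ := by linarith
  obtain ⟨θ, hθ, hθ1, hθg, hθn⟩ := exists_ratio g n hd hn0
  have hD : 0 ≤ C₁ / θ ^ e := by positivity
  obtain ⟨K, hK, hlevel⟩ := exists_initial_level (C := C₁) (κ := q / p) he hn0 hd hθ hC₁0 hD hM
  refine ⟨θ, 2 * C₂ * (K + 2 * (C₁ / θ ^ e)), hθ, hθ1, by positivity, fun Ω f G hG u du hu w dw hw
    hwm hwρ hwp hdwp x₀ hΩ hball hdu Hf hHf hHG lam hsum b hb hE => ?_⟩
  have hlam : 0 ≤ lam := by simpa using hsum M hM le_rfl 0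
  obtain ⟨m₀, hm₀, hm₀M, hm1, hm2, hm3, hm4⟩ := hlevel b lam hb hlam
  set a : ℕ → ℝ := iterBound θ e C₁ b fun l => Hf (θ ^ l * m₀) with ha
  have ha0 : ∀ l, 0 < a l := iterBound_pos hθ hC₁0 hb fun l => hHf _
  have ha2 : ∀ l, a l ≤ 2 * b :=
    iterBound_le hθ hθ1.le he.le hm₀ hC₁0 hb (fun l => hHf _) (hsum m₀ hm₀ hm₀M) hm3
  have hsuma := sum_iterBound_le (e := e) hθ hm₀ hC₁0 hb (hsum m₀ hm₀ hm₀M)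
  set y : ℕ → ℝ := fun l => a l / (θ ^ l * m₀) ^ e with hy
  have hml : ∀ l, 0 < θ ^ l * m₀ := fun l => by positivity
  have hmlM : ∀ l, θ ^ l * m₀ ≤ M := fun l =>
    (mul_le_of_le_one_left hm₀.le (pow_le_one₀ hθ.le hθ1.le)).trans hm₀M
  have hy0 : ∀ l, 0 < y l := fun l => div_pos (ha0 l) (Real.rpow_pos_of_pos (hml l) _)
  set k : ℕ → ℝ := fun l => C₂ * ∑ j ∈ Finset.range l, y j with hk
  have hk0 : ∀ l, 0 ≤ k l := fun l =>
    mul_nonneg hC₂0.le (Finset.sum_nonneg fun j _ => (hy0 j).le)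
  have hks : ∀ l, k (l + 1) = k l + C₂ * y l := fun l => by
    simp only [hk, Finset.sum_range_succ, mul_add]
  set r : ℕ → ℝ := fun l => R / 2 * (1 + (1 / 2) ^ l) with hr
  set r' : ℕ → ℝ := fun l => R / 2 * (1 + 3 / 4 * (1 / 2) ^ l) with hr'
  have hpow : ∀ l : ℕ, (0 : ℝ) < (1 / 2) ^ l ∧ ((1 : ℝ) / 2) ^ l ≤ 1 := fun l =>
    ⟨by positivity, pow_le_one₀ (by norm_num) (by norm_num)⟩
  have hgap : ∀ l : ℕ, 1 / (8 / R * 2 ^ l) = R / 8 * (1 / 2) ^ l := fun l => by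
    rw [one_div_pow]; field_simp
  have hrr' : ∀ l, r l - r' l = 1 / (8 / R * 2 ^ l) := fun l => by
    rw [hgap]; simp only [hr, hr']; ring
  have hr'r : ∀ l, r' l - r (l + 1) = 1 / (8 / R * 2 ^ l) := fun l => by
    rw [hgap]; simp only [hr, hr', pow_succ]; ring
  have hrR : ∀ l, r l ≤ R := fun l => by
    simp only [hr]; nlinarith [hpow l]
  have hr'le : ∀ l, r' l ≤ r l := fun l => by
    simp only [hr, hr']; nlinarith [hpow l, mul_pos hR0 (hpow l).1]
  have hrhalf : ∀ l, R / 2 ≤ r l := fun l => by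
    simp only [hr]; nlinarith [hpow l, mul_pos hR0 (hpow l).1]
  have hr'half : ∀ l, R / 2 ≤ r' l := fun l => by
    simp only [hr']; nlinarith [hpow l, mul_pos hR0 (hpow l).1]
  set v : ℕ → 𝔼[m + 1] → ℝ := fun l x => max (w x - k l) 0 with hv
  set A : ℕ → Set 𝔼[m + 1] := fun l => {x | k l < w x} with hA
  set dv : ℕ → 𝔼[m + 1] → 𝔼[m + 1] := fun l => (A l).indicator dw with hdv
  have hvg : ∀ l, HasWeakGrad (v l) (dv l) := fun l => hw.posPart (hk0 l)
  have hAm : ∀ l, MeasurableSet (A l) := fun l => measurableSet_lt measurable_const hwm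
  have hAt : ∀ l, volume (A l) ≠ ∞ := fun l => by
    refine ((measure_mono (fun x hx => hwρ ?_)).trans_lt
      (measure_closedBall_lt_top (x := (0 : 𝔼[m + 1])) (r := ρ))).ne
    have : k l < w x := hx
    exact Function.mem_support.2 ((hk0 l).trans_lt this).ne'
  have hvw : ∀ l x, ‖v l x‖ₑ ≤ ‖w x‖ₑ := fun l x => by
    rw [← ofReal_norm, ← ofReal_norm]
    refine ENNReal.ofReal_le_ofReal ?_
    rw [Real.norm_eq_abs, Real.norm_eq_abs, abs_of_nonneg (le_max_right _ _)]
    exact max_le (by linarith [le_abs_self (w x), hk0 l]) (abs_nonneg _)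
  have hdvw : ∀ l x, ‖dv l x‖ₑ ≤ ‖dw x‖ₑ := fun l x => by
    by_cases hx : x ∈ A l
    · simp [hdv, hx]
    · simp [hdv, hx]
  have hkmono : ∀ l, k l ≤ k (l + 1) := fun l => by
    rw [hks]; linarith [mul_pos hC₂0 (hy0 l)]
  have hvv : ∀ l x, ‖v (l + 1) x‖ₑ ≤ ‖v l x‖ₑ := fun l x => by
    rw [← ofReal_norm, ← ofReal_norm]
    refine ENNReal.ofReal_le_ofReal ?_
    rw [Real.norm_eq_abs, Real.norm_eq_abs, abs_of_nonneg (le_max_right _ _),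
      abs_of_nonneg (le_max_right _ _)]
    exact max_le_max (by linarith [hkmono l]) le_rfl
  have hdvv : ∀ l x, ‖dv (l + 1) x‖ₑ ≤ ‖dv l x‖ₑ := fun l x => by
    by_cases hx : x ∈ A (l + 1)
    · have hx' : x ∈ A l := (hkmono l).trans_lt hx
      simp [hdv, hx, hx']
    · simp [hdv, hx]
  have hvp : ∀ l, ∫⁻ x, ‖v l x‖ₑ ^ p ≠ ∞ := fun l =>
    ((lintegral_mono fun x => ENNReal.rpow_le_rpow (hvw l x) hp0.le).trans_lt
      (lt_top_iff_ne_top.2 hwp)).ne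
  have hdvp : ∀ l, ∫⁻ x, ‖dv l x‖ₑ ^ p ≠ ∞ := fun l =>
    ((lintegral_mono fun x => ENNReal.rpow_le_rpow (hdvw l x) hp0.le).trans_lt
      (lt_top_iff_ne_top.2 hdwp)).ne
  have hsub : ∀ s, s ≤ R → {x | cubeN x₀ x ≤ s} ⊆ {x : 𝔼[m + 1] | cubeN x₀ x ≤ R} :=
    fun s hs x (hx : cubeN x₀ x ≤ s) => hx.trans hs
  -- consequences of the energy bound
  have hlev : ∀ l, cubeEnergy p (v l) (dv l) x₀ (r l) (2 ^ l) ≤ ENNReal.ofReal (a l ^ p) →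
      volume (A (l + 1) ∩ {x | cubeN x₀ x ≤ r' l}) ≤ ENNReal.ofReal (θ ^ l * m₀) := by
    intro l hl
    have hme : 0 < (θ ^ l * m₀) ^ e := Real.rpow_pos_of_pos (hml l) _
    refine le_trans (measure_mono ?_) (hC₂ (v l) (dv l) (hvg l) x₀ (r' l) (r l) (2 ^ l)
      (by positivity) (hrr' l) ((hsub _ (hrR l)).trans hball) (a l) (y l) (θ ^ l * m₀) (ha0 l).le
      (hy0 l) (hml l) (by simp only [hy]; rw [div_mul_cancel₀ _ hme.ne']) hl)
    refine inter_subset_inter_left _ fun x hx => ?_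
    have hx' : k (l + 1) < w x := hx
    rw [hks] at hx'
    have h1 : C₂ * y l ≤ w x - k l := by linarith
    exact h1.trans (le_max_left _ _)
  have henergy : ∀ l, cubeEnergy p (v l) (dv l) x₀ (r l) (2 ^ l) ≤ ENNReal.ofReal (a l ^ p) := by
    intro l
    induction l with
    | zero =>
      have k0 : k 0 = 0 := by simp [hk]
      have e1 : v 0 = fun x => max (w x) 0 := by
        funext x
        simp only [hv, k0, sub_zero]
      have e2 : dv 0 = {x | 0 < w x}.indicator dw := by
        simp only [hdv, hA, k0]
      have e3 : r 0 = R := by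
        simp only [hr, pow_zero]
        ring
      rw [e1, e2, e3, pow_zero]
      exact hE
    | succ l ih =>
      have hstep := hC₁ Ω f G hG u du hu (v (l + 1)) (v l) (dv (l + 1)) (dv l) (hvg _)
        (fun x => le_max_right _ _) (hvp _) (hdvp _) (hvv l) (hdvv l) (A (l + 1)) (hAm _) (hAt _)
        (fun x hx => max_eq_right (by
          have : ¬ k (l + 1) < w x := hx
          linarith [not_lt.1 this]))
        (fun x hx => lt_max_of_lt_left (by
          have : k (l + 1) < w x := hx
          linarith))
        (fun x hx => by simp [hdv, hx]) x₀ (r (l + 1)) (r' l) (r l) (2 ^ l)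
        (one_le_pow₀ (by norm_num)) (by linarith [hrhalf (l + 1)]) (hr'r l) (hr'le l)
        (by linarith [hr'le l, hrR l]) ((hsub _ ((hr'le l).trans (hrR l))).trans hΩ)
        ((hsub _ ((hr'le l).trans (hrR l))).trans hball)
        (fun x hx hxr => by
          rw [← hdu x (hxr.trans ((hr'le l).trans (hrR l)))]
          simp [hdv, hx])
        (a l) (θ ^ l * m₀) (Hf (θ ^ l * m₀)) (ha0 l).le (hml l).le (hHf _) (hlev l ih)
        (hHG _ ((hAm _).inter (measurableSet_cube _ _))
          (inter_subset_right.trans (hsub _ ((hr'le l).trans (hrR l)))) _ (hml l)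
          (hmlM l) (hlev l ih)) ih
      rw [pow_succ, mul_comm]
      refine hstep.trans (ENNReal.ofReal_le_ofReal (Real.rpow_le_rpow ?_ ?_ hp0.le))
      · have := hHf (θ ^ l * m₀)
        have := (ha0 l).le
        positivity
      · exact iterBound_step hθ hm₀ hC₁0 hκ hθg hθn hm1 hm2 l (ha0 l) (ha2 l)
  set kk := C₂ * (2 * (b / m₀ ^ e + C₁ / θ ^ e * lam)) with hkk
  have hkle : ∀ l, k l ≤ kk := fun l => mul_le_mul_of_nonneg_left (hsuma l) hC₂0.le
  have hzero : volume {x | cubeN x₀ x ≤ R / 2 ∧ kk < w x} = 0 := by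
    have h1 : ∀ l : ℕ, volume {x | cubeN x₀ x ≤ R / 2 ∧ kk < w x} ≤
        ENNReal.ofReal (θ ^ l * m₀) := fun l => by
      refine le_trans (measure_mono fun x hx => ?_) (hlev l (henergy l))
      exact ⟨(hkle _).trans_lt hx.2, hx.1.trans (hr'half l)⟩
    have h2 : Filter.Tendsto (fun l : ℕ => ENNReal.ofReal (θ ^ l * m₀)) Filter.atTop (𝓝 0) := by
      have := (tendsto_pow_atTop_nhds_zero_of_lt_one hθ.le hθ1).mul_const m₀
      rw [zero_mul] at this
      simpa using ENNReal.tendsto_ofReal this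
    exact le_antisymm (ge_of_tendsto' h2 h1) zero_le
  filter_upwards [measure_eq_zero_iff_ae_notMem.1 hzero] with x hx hxR
  have h1 : w x ≤ kk := by
    by_contra h
    exact hx ⟨hxR, not_le.1 h⟩
  refine h1.trans ?_
  rw [hkk, hm4]
  have hb' : 0 ≤ b ^ (1 + e * (q / p - 1) / d) := by positivity
  have : 0 ≤ C₂ * (K * lam) := by positivity
  have : 0 ≤ C₂ * (C₁ / θ ^ e * (b + b ^ (1 + e * (q / p - 1) / d))) := by positivity
  linarith

/-- Every level of the distribution function of `h` is eventually attained. -/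
def HasSmallTails {n : ℕ} (h : 𝔼[n] → ℝ) : Prop :=
  ∀ s : ℝ, 0 < s → ∃ σ : ℝ, 0 < σ ∧ volume {x | σ < |h x|} ≤ ENNReal.ofReal s

theorem bddBelow_rearr_set {n : ℕ} (h : 𝔼[n] → ℝ) (s : ℝ) :
    BddBelow {σ : ℝ | 0 < σ ∧ volume {x | σ < |h x|} ≤ ENNReal.ofReal s} :=
  ⟨0, fun _ hσ => hσ.1.le⟩

theorem rearr_nonneg {n : ℕ} (h : 𝔼[n] → ℝ) (s : ℝ) : 0 ≤ rearr n h s :=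
  Real.sInf_nonneg fun _ hσ => hσ.1.le

theorem rearr_antitone {n : ℕ} {h : 𝔼[n] → ℝ} (hh : HasSmallTails h) {s τ : ℝ} (hs : 0 < s)
    (hsτ : s ≤ τ) : rearr n h τ ≤ rearr n h s :=
  csInf_le_csInf (bddBelow_rearr_set h τ) (hh s hs) fun _ hσ =>
    ⟨hσ.1, hσ.2.trans (ENNReal.ofReal_le_ofReal hsτ)⟩

theorem volume_rearr_lt_le {n : ℕ} {h : 𝔼[n] → ℝ} (hh : HasSmallTails h) {s : ℝ} (hs : 0 < s) :
    volume {x | rearr n h s < |h x|} ≤ ENNReal.ofReal s := by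
  have hne := hh s hs
  have key : ∀ k : ℕ, volume {x | rearr n h s + 1 / ((k : ℝ) + 1) < |h x|} ≤
      ENNReal.ofReal s := fun k => by
    have hk : 0 < 1 / ((k : ℝ) + 1) := by positivity
    obtain ⟨σ, hσ, hσk⟩ := exists_lt_of_csInf_lt hne
      (by rw [← rearr]; linarith : sInf {σ : ℝ | 0 < σ ∧ volume {x | σ < |h x|} ≤
        ENNReal.ofReal s} < rearr n h s + 1 / ((k : ℝ) + 1))
    exact (measure_mono fun x hx => hσk.trans hx).trans hσ.2
  have hU : {x | rearr n h s < |h x|} =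
      ⋃ k : ℕ, {x | rearr n h s + 1 / ((k : ℝ) + 1) < |h x|} := by
    ext x
    rw [mem_iUnion]
    constructor
    · intro hx
      have hx' : 0 < |h x| - rearr n h s := sub_pos.2 hx
      obtain ⟨k, hk⟩ := exists_nat_one_div_lt hx'
      refine ⟨k, ?_⟩
      have h1 : rearr n h s + 1 / ((k : ℝ) + 1) < |h x| := by linarith
      exact h1
    · rintro ⟨k, hk⟩
      have hk' : rearr n h s + 1 / ((k : ℝ) + 1) < |h x| := hk
      have : 0 < 1 / ((k : ℝ) + 1) := by positivity
      have h1 : rearr n h s < |h x| := by linarith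
      exact h1
  have hmono : Monotone fun k : ℕ => {x | rearr n h s + 1 / ((k : ℝ) + 1) < |h x|} := by
    intro j k hjk x hx
    have hx' : rearr n h s + 1 / ((j : ℝ) + 1) < |h x| := hx
    have : 1 / ((k : ℝ) + 1) ≤ 1 / ((j : ℝ) + 1) := Nat.one_div_le_one_div hjk
    have h1 : rearr n h s + 1 / ((k : ℝ) + 1) < |h x| := by linarith
    exact h1
  rw [hU, hmono.measure_iUnion]
  exact iSup_le key

theorem hasSmallTails_of_lintegral {n : ℕ} {h : 𝔼[n] → ℝ} (hm : AEMeasurable h volume) {p : ℝ}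
    (hp : 0 < p) (hInt : ∫⁻ x, ‖h x‖ₑ ^ p ≠ ∞) : HasSmallTails h := by
  intro s hs
  set I := (∫⁻ x, ‖h x‖ₑ ^ p).toReal with hI
  have hI0 : 0 ≤ I := ENNReal.toReal_nonneg
  set σ : ℝ := ((I + 1) / s) ^ (1 / p) with hσ
  have hσ0 : 0 < σ := by positivity
  have hσp : σ ^ p = (I + 1) / s := by
    rw [hσ, ← Real.rpow_mul (by positivity), one_div_mul_cancel hp.ne', Real.rpow_one]
  refine ⟨σ, hσ0, ?_⟩
  have h1 := mul_meas_ge_le_lintegral₀ (hm.enorm.pow_const p) (ENNReal.ofReal (σ ^ p))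
  have h2 : volume {x | σ < |h x|} ≤ volume {x | ENNReal.ofReal (σ ^ p) ≤ ‖h x‖ₑ ^ p} := by
    refine measure_mono fun x hx => ?_
    have hx' : σ < |h x| := hx
    show ENNReal.ofReal (σ ^ p) ≤ ‖h x‖ₑ ^ p
    rw [← ENNReal.ofReal_rpow_of_nonneg hσ0.le hp.le, ← ofReal_norm, Real.norm_eq_abs]
    exact ENNReal.rpow_le_rpow (ENNReal.ofReal_le_ofReal hx'.le) hp.le
  have h3 : ENNReal.ofReal (σ ^ p) * volume {x | σ < |h x|} ≤
      ENNReal.ofReal (σ ^ p) * ENNReal.ofReal s := by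
    calc _ ≤ ∫⁻ x, ‖h x‖ₑ ^ p := (mul_le_mul_right h2 _).trans h1
      _ = ENNReal.ofReal I := (ENNReal.ofReal_toReal hInt).symm
      _ ≤ ENNReal.ofReal (σ ^ p * s) := by
        refine ENNReal.ofReal_le_ofReal ?_
        rw [hσp, div_mul_cancel₀ _ hs.ne']
        linarith
      _ = _ := ENNReal.ofReal_mul (by positivity)
  have h4 : ENNReal.ofReal (σ ^ p) ≠ 0 := by
    rw [ne_eq, ENNReal.ofReal_eq_zero, not_le]
    positivity
  exact (ENNReal.mul_le_mul_iff_right h4 ENNReal.ofReal_ne_top).1 h3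

theorem lintegral_rpow_le_tsum_rearr {n : ℕ} {h : 𝔼[n] → ℝ} (hm : AEMeasurable h volume)
    (hh : HasSmallTails h) {p : ℝ} (hp : 0 < p) {θ s : ℝ} (hθ : 0 < θ) (hθ1 : θ < 1) (hs : 0 < s)
    {A : Set 𝔼[n]} (hA : MeasurableSet A) (hAs : volume A ≤ ENNReal.ofReal s) :
    ∫⁻ x in A, ‖h x‖ₑ ^ p ≤
      ∑' j : ℕ, ENNReal.ofReal (rearr n h (θ ^ (j + 1) * s) ^ p * (θ ^ j * s)) := by
  have hpos : ∀ j : ℕ, 0 < θ ^ j * s := fun j => by positivity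
  set D : ℕ → Set 𝔼[n] := fun j =>
    A ∩ ({x | j = 0 ∨ rearr n h (θ ^ j * s) < |h x|} ∩
      {x | |h x| ≤ rearr n h (θ ^ (j + 1) * s)}) with hD
  set Z : Set 𝔼[n] := {x | ∀ j : ℕ, rearr n h (θ ^ j * s) < |h x|} with hZ
  have hZ0 : volume Z = 0 := by
    have h1 : ∀ j : ℕ, volume Z ≤ ENNReal.ofReal (θ ^ j * s) := fun j => by
      refine (measure_mono fun x hx => ?_).trans (volume_rearr_lt_le hh (hpos j))
      have hx' : ∀ j : ℕ, rearr n h (θ ^ j * s) < |h x| := hx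
      exact hx' j
    have h2 : Filter.Tendsto (fun l : ℕ => ENNReal.ofReal (θ ^ l * s)) Filter.atTop (𝓝 0) := by
      have := (tendsto_pow_atTop_nhds_zero_of_lt_one hθ.le hθ1).mul_const s
      rw [zero_mul] at this
      simpa using ENNReal.tendsto_ofReal this
    exact le_antisymm (ge_of_tendsto' h2 h1) zero_le
  have hcover : A ⊆ Z ∪ ⋃ j, D j := by
    intro x hx
    by_cases hxZ : x ∈ Z
    · exact Or.inl hxZ
    right
    have hex : ∃ j : ℕ, |h x| ≤ rearr n h (θ ^ j * s) := by
      by_contra hcon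
      push Not at hcon
      exact hxZ hcon
    classical
    rw [mem_iUnion]
    rcases Nat.eq_zero_or_pos (Nat.find hex) with h0 | h0
    · refine ⟨0, hx, Or.inl rfl, ?_⟩
      have h1 := Nat.find_spec hex
      rw [h0] at h1
      refine h1.trans (rearr_antitone hh (hpos _) ?_)
      rw [pow_zero, zero_add, pow_one, one_mul]
      exact mul_le_of_le_one_left hs.le hθ1.le
    · obtain ⟨j, hj⟩ := Nat.exists_eq_succ_of_ne_zero h0.ne'
      refine ⟨j, hx, Or.inr ?_, ?_⟩
      · have := Nat.find_min hex (m := j) (by omega)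
        exact not_le.1 this
      · have := Nat.find_spec hex
        rwa [hj] at this
  have hDnull : ∀ j, NullMeasurableSet (D j) volume := by
    intro j
    have ham : AEMeasurable (fun x => |h x|) volume := hm.norm
    refine hA.nullMeasurableSet.inter (NullMeasurableSet.inter ?_
      (nullMeasurableSet_le ham aemeasurable_const))
    by_cases hj : j = 0
    · have : {x | j = 0 ∨ rearr n h (θ ^ j * s) < |h x|} = univ := by
        ext x
        simp [hj]
      rw [this]
      exact MeasurableSet.univ.nullMeasurableSet
    · have : {x | j = 0 ∨ rearr n h (θ ^ j * s) < |h x|} = {x | rearr n h (θ ^ j * s) < |h x|} := by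
        ext x
        simp [hj]
      rw [this]
      exact nullMeasurableSet_lt aemeasurable_const ham
  have hDvol : ∀ j, volume (D j) ≤ ENNReal.ofReal (θ ^ j * s) := by
    intro j
    rcases Nat.eq_zero_or_pos j with rfl | hj
    · rw [pow_zero, one_mul]
      exact (measure_mono inter_subset_left).trans hAs
    · refine (measure_mono fun x hx => ?_).trans (volume_rearr_lt_le hh (hpos j))
      exact hx.2.1.resolve_left hj.ne'
  have hDint : ∀ j, ∫⁻ x in D j, ‖h x‖ₑ ^ p ≤
      ENNReal.ofReal (rearr n h (θ ^ (j + 1) * s) ^ p * (θ ^ j * s)) := by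
    intro j
    calc _ ≤ ∫⁻ _ in D j, ENNReal.ofReal (rearr n h (θ ^ (j + 1) * s)) ^ p := by
          refine lintegral_mono_ae ?_
          filter_upwards [ae_restrict_mem₀ (hDnull j)] with x hx
          rw [← ofReal_norm, Real.norm_eq_abs]
          exact ENNReal.rpow_le_rpow (ENNReal.ofReal_le_ofReal hx.2.2) hp.le
      _ ≤ ENNReal.ofReal (rearr n h (θ ^ (j + 1) * s)) ^ p * ENNReal.ofReal (θ ^ j * s) := by
          rw [setLIntegral_const]
          exact mul_le_mul_right (hDvol j) _
      _ = _ := by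
          rw [ENNReal.ofReal_rpow_of_nonneg (rearr_nonneg _ _) hp.le,
            ENNReal.ofReal_mul (Real.rpow_nonneg (rearr_nonneg _ _) _)]
  calc _ ≤ ∫⁻ x in Z ∪ ⋃ j, D j, ‖h x‖ₑ ^ p := lintegral_mono_set hcover
    _ ≤ (∫⁻ x in Z, ‖h x‖ₑ ^ p) + ∫⁻ x in ⋃ j, D j, ‖h x‖ₑ ^ p := lintegral_union_le _ _ _
    _ ≤ 0 + ∑' j, ∫⁻ x in D j, ‖h x‖ₑ ^ p := by
        refine add_le_add (le_of_eq ?_) (lintegral_iUnion_le _ _)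
        exact setLIntegral_measure_zero _ _ hZ0
    _ ≤ _ := by
        rw [zero_add]
        exact ENNReal.tsum_le_tsum hDint

theorem ENNReal.tsum_rpow_le_rpow_tsum {p : ℝ} (hp : 1 ≤ p) (x : ℕ → ℝ≥0∞) :
    ∑' j, x j ^ p ≤ (∑' j, x j) ^ p := by
  have key : ∀ y : ℝ≥0∞, y ^ p = y * y ^ (p - 1) := fun y => by
    have := ENNReal.rpow_add_of_nonneg (x := y) 1 (p - 1) zero_le_one (by linarith)
    rwa [add_sub_cancel, ENNReal.rpow_one] at this
  calc _ ≤ ∑' j, x j * (∑' j, x j) ^ (p - 1) := by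
        refine ENNReal.tsum_le_tsum fun j => ?_
        rw [key]
        exact mul_le_mul_right (ENNReal.rpow_le_rpow (ENNReal.le_tsum j) (by linarith)) _
    _ = _ := by rw [ENNReal.tsum_mul_right, ← key]

/-- Dyadic majorant of the `L^p` norm of `h` over sets of measure at most `s`. -/
def dyadicTail (n : ℕ) (p θ : ℝ) (h : 𝔼[n] → ℝ) (s : ℝ) : ℝ≥0∞ :=
  ∑' j : ℕ, ENNReal.ofReal (rearr n h (θ ^ (j + 1) * s) * (θ ^ j * s) ^ (1 / p))

theorem lintegral_rpow_le_dyadicTail {n : ℕ} {h : 𝔼[n] → ℝ} (hm : AEMeasurable h volume)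
    (hh : HasSmallTails h) {p : ℝ} (hp : 1 ≤ p) {θ s : ℝ} (hθ : 0 < θ) (hθ1 : θ < 1) (hs : 0 < s)
    {A : Set 𝔼[n]} (hA : MeasurableSet A) (hAs : volume A ≤ ENNReal.ofReal s) :
    ∫⁻ x in A, ‖h x‖ₑ ^ p ≤ dyadicTail n p θ h s ^ p := by
  have hp0 : 0 < p := by linarith
  refine (lintegral_rpow_le_tsum_rearr hm hh hp0 hθ hθ1 hs hA hAs).trans ?_
  refine le_trans (ENNReal.tsum_le_tsum fun j => ?_) (ENNReal.tsum_rpow_le_rpow_tsum hp _)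
  have h1 : 0 ≤ rearr n h (θ ^ (j + 1) * s) := rearr_nonneg _ _
  rw [ENNReal.ofReal_rpow_of_nonneg (by positivity) hp0.le, Real.mul_rpow h1 (by positivity),
    ← Real.rpow_mul (by positivity), one_div_mul_cancel hp0.ne', Real.rpow_one]

theorem tsum_dyadicTail_le {n : ℕ} (h : 𝔼[n] → ℝ) {p e : ℝ} {θ s : ℝ} (hθ : 0 < θ) (hs : 0 < s) :
    ∑' l : ℕ, dyadicTail n p θ h (θ ^ l * s) * ENNReal.ofReal ((θ ^ l * s) ^ (-e)) ≤
      (1 - ENNReal.ofReal (θ ^ e))⁻¹ * ∑' k : ℕ, ENNReal.ofReal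
        (rearr n h (θ ^ (k + 1) * s) * (θ ^ k * s) ^ (1 / p - e)) := by
  set F : ℕ → ℝ≥0∞ := fun k => ENNReal.ofReal
    (rearr n h (θ ^ (k + 1) * s) * (θ ^ k * s) ^ (1 / p - e)) with hF
  have h1 : ∀ l : ℕ, dyadicTail n p θ h (θ ^ l * s) * ENNReal.ofReal ((θ ^ l * s) ^ (-e)) =
      ∑' j : ℕ, ENNReal.ofReal (θ ^ e) ^ j * F (j + l) := by
    intro l
    rw [dyadicTail, ← ENNReal.tsum_mul_right]
    congr 1
    funext j
    have h2 : 0 ≤ rearr n h (θ ^ (j + l + 1) * s) := rearr_nonneg _ _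
    have e1 : θ ^ (j + 1) * (θ ^ l * s) = θ ^ (j + l + 1) * s := by ring
    have e2 : θ ^ j * (θ ^ l * s) = θ ^ (j + l) * s := by ring
    have e3 : (θ ^ l * s) ^ (-e) = (θ ^ e) ^ j * (θ ^ (j + l) * s) ^ (-e) := by
      have : θ ^ (j + l) * s = θ ^ j * (θ ^ l * s) := by ring
      rw [this, Real.mul_rpow (x := θ ^ j) (by positivity) (by positivity), ← mul_assoc,
        ← Real.rpow_natCast θ j, ← Real.rpow_natCast (θ ^ e) j, ← Real.rpow_mul hθ.le,
        ← Real.rpow_mul hθ.le, ← Real.rpow_add hθ]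
      have : e * j + j * -e = 0 := by ring
      rw [this, Real.rpow_zero, one_mul]
    rw [e1, e2, e3, ← ENNReal.ofReal_mul (by positivity), ← ENNReal.ofReal_pow (by positivity), hF,
      ← ENNReal.ofReal_mul (by positivity), sub_eq_add_neg, Real.rpow_add (by positivity)]
    congr 1
    ring
  simp only [h1]
  rw [ENNReal.tsum_comm, ← ENNReal.tsum_geometric, ← ENNReal.tsum_mul_right]
  refine ENNReal.tsum_le_tsum fun j => ?_
  rw [ENNReal.tsum_mul_left]
  exact mul_le_mul_right (ENNReal.tsum_comp_le_tsum_of_injective (add_right_injective j) F) _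

theorem tsum_rearr_le_lintegral {n : ℕ} {h : 𝔼[n] → ℝ} (hh : HasSmallTails h) {θ s V : ℝ}
    (hθ : 0 < θ) (hθ1 : θ < 1) (hs : 0 < s) (hsV : s ≤ V) :
    ∑' k : ℕ, ENNReal.ofReal (rearr n h (θ ^ (k + 1) * s) * (θ ^ k * s) ^ (1 / (n : ℝ))) ≤
      ENNReal.ofReal ((θ ^ (2 / (n : ℝ)) * (1 - θ))⁻¹) *
        ∫⁻ t in Ioo 0 V, ENNReal.ofReal (t ^ (1 / (n : ℝ)) * rearr n h t / t) := by
  set I : ℕ → Set ℝ := fun k => Ioo (θ ^ (k + 2) * s) (θ ^ (k + 1) * s) with hI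
  have hpos : ∀ j : ℕ, 0 < θ ^ j * s := fun j => by positivity
  have hanti : ∀ j k : ℕ, j ≤ k → θ ^ k * s ≤ θ ^ j * s := fun j k hjk =>
    mul_le_mul_of_nonneg_right (pow_le_pow_of_le_one hθ.le hθ1.le hjk) hs.le
  have hdisj : Pairwise (Function.onFun Disjoint I) := by
    have key : ∀ j k : ℕ, j < k → Disjoint (I j) (I k) := by
      intro j k hjk
      rw [Set.disjoint_left]
      intro x hx hx'
      exact absurd (hx.1.trans hx'.2) (not_lt.2 (hanti _ _ (by omega)))
    intro j k hjk
    rcases lt_or_gt_of_ne hjk with h1 | h1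
    · exact key _ _ h1
    · exact (key _ _ h1).symm
  have hsub : (⋃ k, I k) ⊆ Ioo 0 V := by
    refine iUnion_subset fun k x hx => ⟨(hpos _).trans hx.1, hx.2.trans_le ?_⟩
    have := hanti 0 (k + 1) (by omega)
    rw [pow_zero, one_mul] at this
    exact this.trans hsV
  have hc : 0 < θ ^ (2 / (n : ℝ)) * (1 - θ) := by
    have : 0 < 1 - θ := by linarith
    positivity
  have hterm : ∀ k : ℕ, ENNReal.ofReal
      (rearr n h (θ ^ (k + 1) * s) * (θ ^ k * s) ^ (1 / (n : ℝ))) ≤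
      ENNReal.ofReal ((θ ^ (2 / (n : ℝ)) * (1 - θ))⁻¹) *
        ∫⁻ t in I k, ENNReal.ofReal (t ^ (1 / (n : ℝ)) * rearr n h t / t) := by
    intro k
    set τ := θ ^ (k + 1) * s with hτ
    have hτ0 : 0 < τ := hpos _
    have e1 : θ ^ (k + 2) * s = θ * τ := by rw [hτ]; ring
    have e2 : θ ^ k * s = τ / θ := by rw [hτ]; field_simp; ring
    have hr0 := rearr_nonneg h τ
    have h1 : ENNReal.ofReal ((θ * τ) ^ (1 / (n : ℝ)) * rearr n h τ / τ) *
        ENNReal.ofReal (τ - θ * τ) ≤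
        ∫⁻ t in I k, ENNReal.ofReal (t ^ (1 / (n : ℝ)) * rearr n h t / t) := by
      have : volume (I k) = ENNReal.ofReal (τ - θ * τ) := by
        simp only [hI]
        rw [Real.volume_Ioo, e1]
      rw [← this, ← setLIntegral_const]
      refine setLIntegral_mono' measurableSet_Ioo fun t ht => ENNReal.ofReal_le_ofReal ?_
      have ht1 : θ * τ < t := by rw [← e1]; exact ht.1
      have ht2 : t < τ := ht.2
      have ht0 : 0 < t := lt_trans (by positivity) ht1
      have := rearr_antitone hh ht0 ht2.le
      have := ht2.le
      have := rearr_nonneg h t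
      gcongr
    have h2 : rearr n h τ * (θ ^ k * s) ^ (1 / (n : ℝ)) = (θ ^ (2 / (n : ℝ)) * (1 - θ))⁻¹ *
        ((θ * τ) ^ (1 / (n : ℝ)) * rearr n h τ / τ * (τ - θ * τ)) := by
      have h3 : θ ^ (2 / (n : ℝ)) = θ ^ (1 / (n : ℝ)) * θ ^ (1 / (n : ℝ)) := by
        rw [← Real.rpow_add hθ]
        congr 1
        ring
      have h4 : 0 < θ ^ (1 / (n : ℝ)) := by positivity
      have h5 : 1 - θ ≠ 0 := by linarith
      rw [e2, Real.div_rpow hτ0.le hθ.le, Real.mul_rpow hθ.le hτ0.le, h3]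
      field_simp
    rw [h2, ENNReal.ofReal_mul (by positivity : 0 ≤ (θ ^ (2 / (n : ℝ)) * (1 - θ))⁻¹),
      ENNReal.ofReal_mul (by positivity : 0 ≤ (θ * τ) ^ (1 / (n : ℝ)) * rearr n h τ / τ)]
    exact mul_le_mul_right h1 _
  calc _ ≤ ∑' k : ℕ, ENNReal.ofReal ((θ ^ (2 / (n : ℝ)) * (1 - θ))⁻¹) *
        ∫⁻ t in I k, ENNReal.ofReal (t ^ (1 / (n : ℝ)) * rearr n h t / t) :=
        ENNReal.tsum_le_tsum hterm
    _ ≤ _ := by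
        rw [ENNReal.tsum_mul_left, ← lintegral_iUnion (fun k => measurableSet_Ioo) hdisj]
        exact mul_le_mul_right (lintegral_mono_set hsub) _

/-- Summability of the dyadic tails against the Lorentz quasinorm. -/
theorem exists_dyadicTail_const {n : ℕ} {p θ : ℝ} (hp : 1 ≤ p)
    (hpn : p < n) (hθ : 0 < θ) (hθ1 : θ < 1) :
    ∃ C : ℝ, 0 ≤ C ∧ ∀ (h : 𝔼[n] → ℝ) (B : Set 𝔼[n]), MeasurableSet B → volume B ≠ ∞ →
      AEMeasurable (B.indicator h) volume → ∫⁻ x in B, ‖h x‖ₑ ^ p ≠ ∞ → lorentzN1 n B h < ⊤ →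
      (∀ A, MeasurableSet A → A ⊆ B → ∀ s, 0 < s → s ≤ (volume B).toReal →
        volume A ≤ ENNReal.ofReal s → ∫⁻ x in A, ‖h x‖ₑ ^ p ≤
          ENNReal.ofReal ((dyadicTail n p θ (B.indicator h) s).toReal ^ p)) ∧
      ∀ s, 0 < s → s ≤ (volume B).toReal → ∀ N : ℕ, ∑ l ∈ Finset.range N,
        (dyadicTail n p θ (B.indicator h) (θ ^ l * s)).toReal /
          (θ ^ l * s) ^ (1 / p - 1 / (n : ℝ)) ≤ C * (lorentzN1 n B h).toReal := by
  have hp0 : 0 < p := by linarith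
  set e : ℝ := 1 / p - 1 / (n : ℝ) with he_def
  have he : 0 < e := sub_pos.2 (one_div_lt_one_div_of_lt hp0 hpn)
  set K₁ : ℝ≥0∞ := (1 - ENNReal.ofReal (θ ^ e))⁻¹ with hK₁
  set K₂ : ℝ := (θ ^ (2 / (n : ℝ)) * (1 - θ))⁻¹ with hK₂
  have hK₁t : K₁ ≠ ∞ := by
    rw [hK₁, ne_eq, ENNReal.inv_eq_top, tsub_eq_zero_iff_le, not_le, ENNReal.ofReal_lt_one]
    exact Real.rpow_lt_one hθ.le hθ1 he
  have hK₂0 : 0 ≤ K₂ := by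
    have : 0 < 1 - θ := by linarith
    positivity
  refine ⟨K₁.toReal * K₂, by positivity, fun h B hB hBt hm hInt hlor => ?_⟩
  have htails : HasSmallTails (B.indicator h) := by
    refine hasSmallTails_of_lintegral hm hp0 ?_
    have : ∀ x, ‖B.indicator h x‖ₑ ^ p = B.indicator (fun x => ‖h x‖ₑ ^ p) x := fun x => by
      by_cases hx : x ∈ B
      · simp [hx]
      · simp [hx, hp0]
    simp only [this]
    rwa [lintegral_indicator hB]
  have hsum : ∀ s, 0 < s → s ≤ (volume B).toReal →
      ∑' l : ℕ, dyadicTail n p θ (B.indicator h) (θ ^ l * s) *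
        ENNReal.ofReal ((θ ^ l * s) ^ (-e)) ≤ K₁ * (ENNReal.ofReal K₂ * lorentzN1 n B h) := by
    intro s hs hsB
    refine (tsum_dyadicTail_le (B.indicator h) hθ hs).trans (mul_le_mul_right ?_ _)
    have : 1 / p - e = 1 / (n : ℝ) := by rw [he_def]; ring
    rw [this]
    exact tsum_rearr_le_lintegral htails hθ hθ1 hs hsB
  have hfin : K₁ * (ENNReal.ofReal K₂ * lorentzN1 n B h) ≠ ∞ :=
    ENNReal.mul_ne_top hK₁t (ENNReal.mul_ne_top ENNReal.ofReal_ne_top hlor.ne)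
  have htail : ∀ s, 0 < s → s ≤ (volume B).toReal → ∀ l : ℕ,
      dyadicTail n p θ (B.indicator h) (θ ^ l * s) ≠ ∞ := by
    intro s hs hsB l htop
    have h1 := (ENNReal.le_tsum l).trans (hsum s hs hsB)
    rw [htop, ENNReal.top_mul] at h1
    · exact hfin (top_le_iff.1 h1)
    · rw [ne_eq, ENNReal.ofReal_eq_zero, not_le]
      positivity
  refine ⟨fun A hA hAB s hs hsB hAs => ?_, fun s hs hsB N => ?_⟩
  · have h0 := htail s hs hsB 0
    rw [pow_zero, one_mul] at h0
    rw [← ENNReal.ofReal_rpow_of_nonneg ENNReal.toReal_nonneg hp0.le, ENNReal.ofReal_toReal h0]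
    refine le_trans (le_of_eq ?_) (lintegral_rpow_le_dyadicTail hm htails hp hθ hθ1 hs hA hAs)
    refine setLIntegral_congr_fun hA fun x hx => ?_
    simp [hAB hx]
  · have h1 := (ENNReal.sum_le_tsum (Finset.range N)).trans (hsum s hs hsB)
    have h2 := ENNReal.toReal_mono hfin h1
    rw [ENNReal.toReal_sum (fun l _ => ENNReal.mul_ne_top (htail s hs hsB l)
      ENNReal.ofReal_ne_top), ENNReal.toReal_mul, ENNReal.toReal_mul,
      ENNReal.toReal_ofReal hK₂0, ← mul_assoc] at h2
    refine le_trans (Finset.sum_le_sum fun l _ => le_of_eq ?_) h2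
    rw [ENNReal.toReal_mul, ENNReal.toReal_ofReal (by positivity), Real.rpow_neg (by positivity),
      div_eq_mul_inv]

theorem HasWeakGrad.congr {n : ℕ} {w w' : 𝔼[n] → ℝ} {dw : 𝔼[n] → 𝔼[n]} (h : HasWeakGrad w dw)
    (hw : w =ᵐ[volume] w') : HasWeakGrad w' dw := by
  refine ⟨h.int.congr hw, h.int_grad, fun φ hφ hφc i => ?_⟩
  rw [← h.ibp φ hφ hφc i]
  refine integral_congr_ae ?_
  filter_upwards [hw] with x hx
  rw [hx]

theorem continuous_gradient_of_contDiff {n : ℕ} {χ : 𝔼[n] → ℝ} (hχ : ContDiff ℝ (⊤ : ℕ∞) χ) :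
    Continuous (gradient χ) :=
  (InnerProductSpace.toDual ℝ 𝔼[n]).symm.continuous.comp (hχ.continuous_fderiv (by simp))

theorem gradient_eq_zero_of_notMem_tsupport {n : ℕ} {χ : 𝔼[n] → ℝ} {x : 𝔼[n]}
    (hx : x ∉ tsupport χ) : gradient χ x = 0 := by
  rw [gradient, fderiv_of_notMem_tsupport ℝ hx, map_zero]

/-- Localizing a weakly differentiable function by a smooth cutoff. -/
theorem IsWeakGradOn.hasWeakGrad_cutoff {n : ℕ} {Ω : Set 𝔼[n]} {u : 𝔼[n] → ℝ} {du : 𝔼[n] → 𝔼[n]}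
    (h : IsWeakGradOn n Ω u du) (hu : LocallyIntegrableOn u Ω) (hdu : LocallyIntegrableOn du Ω)
    {χ : 𝔼[n] → ℝ} (hχ : ContDiff ℝ (⊤ : ℕ∞) χ) (hχc : HasCompactSupport χ)
    (hχΩ : tsupport χ ⊆ Ω) :
    HasWeakGrad (fun x => χ x * u x) (fun x => χ x • du x + u x • gradient χ x) := by
  set K := tsupport χ with hK
  have hKc : IsCompact K := hχc
  have huK : IntegrableOn u K := hu.integrableOn_compact_subset hχΩ hKc
  have hduK : IntegrableOn du K := hdu.integrableOn_compact_subset hχΩ hKc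
  have hgc := continuous_gradient_of_contDiff hχ
  have i1 : Integrable fun x => χ x * u x := by
    refine IntegrableOn.integrable_of_forall_notMem_eq_zero
      (huK.continuousOn_mul hχ.continuous.continuousOn hKc) fun x hx => ?_
    rw [image_eq_zero_of_notMem_tsupport hx, zero_mul]
  have i2 : Integrable fun x => χ x • du x := by
    refine IntegrableOn.integrable_of_forall_notMem_eq_zero
      (hduK.continuousOn_smul hχ.continuous.continuousOn hKc) fun x hx => ?_
    rw [image_eq_zero_of_notMem_tsupport hx, zero_smul]
  have i3 : Integrable fun x => u x • gradient χ x := by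
    refine IntegrableOn.integrable_of_forall_notMem_eq_zero
      (huK.smul_continuousOn hgc.continuousOn hKc) fun x hx => ?_
    rw [gradient_eq_zero_of_notMem_tsupport hx, smul_zero]
  refine ⟨i1, i2.add i3, fun φ hφ hφc i => ?_⟩
  have hψ : ContDiff ℝ (⊤ : ℕ∞) fun x => χ x * φ x := hχ.mul hφ
  have hts : tsupport (fun x => χ x * φ x) ⊆ K := tsupport_mul_subset_left
  have key := h _ hψ (hχc.mul_right) (hts.trans hχΩ) i
  have hdφ : Continuous fun x => fderiv ℝ φ x (EuclideanSpace.single i (1 : ℝ)) :=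
    (hφ.continuous_fderiv (by simp)).clm_apply continuous_const
  have hdχ : Continuous fun x => fderiv ℝ χ x (EuclideanSpace.single i (1 : ℝ)) :=
    (hχ.continuous_fderiv (by simp)).clm_apply continuous_const
  have hprod : ∀ x, fderiv ℝ (fun x => χ x * φ x) x (EuclideanSpace.single i (1 : ℝ)) =
      χ x * fderiv ℝ φ x (EuclideanSpace.single i (1 : ℝ)) +
        φ x * fderiv ℝ χ x (EuclideanSpace.single i (1 : ℝ)) := by
    intro x
    rw [fderiv_fun_mul (hχ.differentiable (by simp)).differentiableAt
      (hφ.differentiable (by simp)).differentiableAt]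
    simp
  have k1 : ∫ x in Ω, u x * fderiv ℝ (fun x => χ x * φ x) x (EuclideanSpace.single i (1 : ℝ)) =
      ∫ x, (χ x * u x * fderiv ℝ φ x (EuclideanSpace.single i (1 : ℝ)) +
        u x * gradient χ x i * φ x) := by
    rw [setIntegral_eq_integral_of_forall_compl_eq_zero]
    · refine integral_congr_ae (Filter.Eventually.of_forall fun x => ?_)
      simp only [hprod, gradient_apply_coord]
      ring
    · intro x hx
      rw [fderiv_of_notMem_tsupport ℝ fun hh => hx (hχΩ (hts hh))]
      simp
  have k2 : ∫ x in Ω, du x i * (χ x * φ x) = ∫ x, χ x * du x i * φ x := by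
    rw [setIntegral_eq_integral_of_forall_compl_eq_zero]
    · refine integral_congr_ae (Filter.Eventually.of_forall fun x => ?_)
      simp only
      ring
    · intro x hx
      rw [image_eq_zero_of_notMem_tsupport fun hh => hx (hχΩ hh)]
      simp
  obtain ⟨M₁, hM₁⟩ := hφc.exists_bound_of_continuous hφ.continuous
  have hφ'c : HasCompactSupport fun x => fderiv ℝ φ x (EuclideanSpace.single i (1 : ℝ)) :=
    hφc.fderiv_apply ℝ _
  obtain ⟨M₂, hM₂⟩ := hφ'c.exists_bound_of_continuous hdφ
  have j1 : Integrable fun x => χ x * u x * fderiv ℝ φ x (EuclideanSpace.single i (1 : ℝ)) :=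
    i1.mul_bdd hdφ.aestronglyMeasurable (Filter.Eventually.of_forall hM₂)
  have j2 : Integrable fun x => u x * gradient χ x i * φ x :=
    (integrable_coord i3 i).mul_bdd hφ.continuous.aestronglyMeasurable
      (Filter.Eventually.of_forall hM₁)
  have j3 : Integrable fun x => χ x * du x i * φ x :=
    (integrable_coord i2 i).mul_bdd hφ.continuous.aestronglyMeasurable
      (Filter.Eventually.of_forall hM₁)
  rw [k1, k2, integral_add j1 j2] at key
  have k3 : ∫ x, (χ x • du x + u x • gradient χ x) i * φ x =
      (∫ x, χ x * du x i * φ x) + ∫ x, u x * gradient χ x i * φ x := by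
    rw [← integral_add j3 j2]
    refine integral_congr_ae (Filter.Eventually.of_forall fun x => ?_)
    simp only [PiLp.add_apply, PiLp.smul_apply, smul_eq_mul]
    ring
  rw [k3]
  linarith

theorem memLp_ofReal_iff {α E : Type*} [MeasurableSpace α] {μ : Measure α} [NormedAddCommGroup E]
    {f : α → E} {p : ℝ} (hp : 0 < p) :
    MemLp f (ENNReal.ofReal p) μ ↔ AEStronglyMeasurable f μ ∧ ∫⁻ x, ‖f x‖ₑ ^ p ∂μ ≠ ∞ := by
  rw [MemLp, eLpNorm_lt_top_iff_lintegral_rpow_enorm_lt_top (by simpa using hp) (by simp),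
    ENNReal.toReal_ofReal hp.le, lt_top_iff_ne_top]

theorem IsQMinimizer.memLp_grad {n : ℕ} {Ω : Set 𝔼[n]} {p q L Q : ℝ} {f : 𝔼[n] → 𝔼[n] → ℝ}
    {G u : 𝔼[n] → ℝ} {du : 𝔼[n] → 𝔼[n]} (hp : 0 < p) (hf : HasPQGrowth Ω p q L f G)
    (hu : IsQMinimizer n Ω f Q u du) {K : Set 𝔼[n]} (hK : IsCompact K) (hKΩ : K ⊆ Ω) :
    MemLp du (ENNReal.ofReal p) (volume.restrict K) := by
  have hm : AEStronglyMeasurable du (volume.restrict K) :=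
    (hu.2.2.1.integrableOn_compact_subset hKΩ hK).aestronglyMeasurable
  have hi := (hu.integrableOn hf.open_dom hK hKΩ).add (hf.int.mono_set hKΩ)
  rw [← integrable_norm_rpow_iff hm (by simpa using hp) (by simp), ENNReal.toReal_ofReal hp.le]
  refine hi.mono' ((hm.norm.aemeasurable.pow_const p).aestronglyMeasurable) ?_
  filter_upwards [ae_restrict_of_ae_restrict_of_subset hKΩ hf.lower] with x hx
  rw [Real.norm_of_nonneg (by positivity)]
  have := hx (du x)
  simp only [Pi.add_apply]
  linarith

theorem memLp_cutoff {n : ℕ} {u χ : 𝔼[n] → ℝ} {du : 𝔼[n] → 𝔼[n]} {s : ℝ≥0∞}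
    (hχ : ContDiff ℝ (⊤ : ℕ∞) χ) (hχc : HasCompactSupport χ)
    (hu : MemLp u s (volume.restrict (tsupport χ)))
    (hdu : MemLp du s (volume.restrict (tsupport χ))) :
    MemLp (fun x => χ x * u x) s ∧ MemLp (fun x => χ x • du x + u x • gradient χ x) s := by
  have hgc := continuous_gradient_of_contDiff hχ
  have hms : MeasurableSet (tsupport χ) := (isClosed_tsupport χ).measurableSet
  obtain ⟨M₁, hM₁⟩ := hχc.exists_bound_of_continuous hχ.continuous
  have hg0 : HasCompactSupport (gradient χ) := by
    refine HasCompactSupport.intro hχc fun x hx => gradient_eq_zero_of_notMem_tsupport hx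
  obtain ⟨M₂, hM₂⟩ := hg0.exists_bound_of_continuous hgc
  have e1 : (fun x => χ x * u x) = (tsupport χ).indicator fun x => χ x * u x := by
    ext x
    by_cases hx : x ∈ tsupport χ
    · simp [hx]
    · simp [hx, image_eq_zero_of_notMem_tsupport hx]
  have e2 : (fun x => χ x • du x + u x • gradient χ x) =
      (tsupport χ).indicator fun x => χ x • du x + u x • gradient χ x := by
    ext x
    by_cases hx : x ∈ tsupport χ
    · simp [hx]
    · simp [hx, image_eq_zero_of_notMem_tsupport hx, gradient_eq_zero_of_notMem_tsupport hx]
  constructor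
  · rw [e1, memLp_indicator_iff_restrict hms]
    refine hu.of_le_mul (c := M₁) (hχ.continuous.aestronglyMeasurable.mul hu.1)
      (Filter.Eventually.of_forall fun x => ?_)
    rw [norm_mul]
    gcongr
    exact hM₁ x
  · rw [e2, memLp_indicator_iff_restrict hms]
    refine MemLp.add (f := fun x => χ x • du x) (g := fun x => u x • gradient χ x) ?_ ?_
    · refine hdu.of_le_mul (c := M₁) (hχ.continuous.aestronglyMeasurable.smul hdu.1)
        (Filter.Eventually.of_forall fun x => ?_)
      rw [norm_smul]
      gcongr
      exact hM₁ x
    · refine hu.of_le_mul (c := M₂) (hu.1.smul hgc.aestronglyMeasurable)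
        (Filter.Eventually.of_forall fun x => ?_)
      rw [norm_smul, mul_comm]
      gcongr
      exact hM₂ x

theorem memLp_of_memLp_grad {n : ℕ} {Ω : Set 𝔼[n]} {p R₀ : ℝ} {u : 𝔼[n] → ℝ} {du : 𝔼[n] → 𝔼[n]}
    (hpn : p < n) (h : IsWeakGradOn n Ω u du) (hu : LocallyIntegrableOn u Ω)
    (hdu : LocallyIntegrableOn du Ω) (hR : closedBall (0 : 𝔼[n]) R₀ ⊆ Ω)
    (hgrad : MemLp du (ENNReal.ofReal p) (volume.restrict (closedBall (0 : 𝔼[n]) R₀))) (j : ℕ) :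
    ∀ s ρ : ℝ, 0 < ρ → ρ < R₀ → 1 ≤ s → s ≤ p → 1 - (j : ℝ) / n ≤ 1 / s →
      MemLp u (ENNReal.ofReal s) (volume.restrict (closedBall (0 : 𝔼[n]) ρ)) := by
  induction j with
  | zero =>
    intro s ρ hρ hρR hs hsp hj
    have hs1 : s = 1 := by
      have : 1 ≤ 1 / s := by simpa using hj
      rw [le_div_iff₀ (by linarith)] at this
      linarith
    rw [hs1, ENNReal.ofReal_one, memLp_one_iff_integrable]
    exact hu.integrableOn_compact_subset ((closedBall_subset_closedBall hρR.le).trans hR)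
      (isCompact_closedBall _ _)
  | succ j ih =>
    intro s ρ hρ hρR hs hsp hj
    have hn0 : (0 : ℝ) < n := by linarith
    have hs0 : (0 : ℝ) < s := by linarith
    set a : ℝ := min 1 (1 / s + 1 / n) with ha
    have ha0 : 0 < a := lt_min one_pos (by positivity)
    have hs1 : (1 : ℝ) ≤ 1 / a := by
      rw [le_div_iff₀ ha0, one_mul]
      exact min_le_left _ _
    have has : 1 / s ≤ a := by
      refine le_min ?_ ?_
      · rw [div_le_iff₀ hs0]
        linarith
      · have : (0 : ℝ) < 1 / n := by positivity
        linarith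
    have hs2 : 1 / a ≤ s := by
      rw [div_le_iff₀ ha0]
      rw [div_le_iff₀ hs0] at has
      linarith
    have hja : 1 - (j : ℝ) / n ≤ a := by
      refine le_min ?_ ?_
      · have : (0 : ℝ) ≤ j / n := by positivity
        linarith
      · push_cast at hj
        rw [add_div] at hj
        linarith
    set ρ' : ℝ := (ρ + R₀) / 2 with hρ'
    let χ : ContDiffBump (0 : 𝔼[n]) := ⟨ρ, ρ', hρ, by rw [hρ']; linarith⟩
    have hχ : ContDiff ℝ (⊤ : ℕ∞) χ := χ.contDiff
    have hts : tsupport χ = closedBall (0 : 𝔼[n]) ρ' := χ.tsupport_eq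
    have hsubR : closedBall (0 : 𝔼[n]) ρ' ⊆ closedBall 0 R₀ :=
      closedBall_subset_closedBall (by rw [hρ']; linarith)
    have hu1 : MemLp u (ENNReal.ofReal (1 / a)) (volume.restrict (tsupport χ)) := by
      rw [hts]
      refine ih _ _ (by rw [hρ']; linarith) (by rw [hρ']; linarith) hs1 (hs2.trans hsp) ?_
      rwa [one_div_one_div]
    have hd1 : MemLp du (ENNReal.ofReal (1 / a)) (volume.restrict (tsupport χ)) := by
      rw [hts]
      have : IsFiniteMeasure (volume.restrict (closedBall (0 : 𝔼[n]) ρ')) :=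
        ⟨by simpa using measure_closedBall_lt_top⟩
      exact (hgrad.mono_measure (Measure.restrict_mono hsubR le_rfl)).mono_exponent
        (ENNReal.ofReal_le_ofReal (hs2.trans hsp))
    have hw := h.hasWeakGrad_cutoff hu hdu hχ χ.hasCompactSupport (hts ▸ hsubR.trans hR)
    obtain ⟨m1, m2⟩ := memLp_cutoff hχ χ.hasCompactSupport hu1 hd1
    obtain ⟨C, hC⟩ := exists_sobolev_const (n := n) ρ' hs1 (by linarith) hs0
      (by rw [one_div_one_div]; linarith [min_le_right 1 (1 / s + 1 / (n : ℝ))])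
    have hsup : (Function.support fun x => χ x * u x) ⊆ closedBall 0 ρ' := by
      intro x hx
      rw [← hts]
      exact subset_tsupport _ (left_ne_zero_of_mul hx)
    have key := hC _ _ hw hsup
    have hfin := ((memLp_ofReal_iff (by linarith)).1 m2).2
    have hmem : MemLp (fun x => χ x * u x) (ENNReal.ofReal s) := by
      refine (memLp_ofReal_iff hs0).2 ⟨m1.1, fun htop => ?_⟩
      rw [htop, ENNReal.top_rpow_of_pos (by positivity)] at key
      exact (ENNReal.mul_lt_top ENNReal.coe_lt_top
        (ENNReal.rpow_lt_top_of_nonneg (by positivity) hfin)).not_ge key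
    refine (hmem.restrict (closedBall (0 : 𝔼[n]) ρ)).ae_eq ?_
    filter_upwards [ae_restrict_mem isClosed_closedBall.measurableSet] with x hx
    rw [χ.one_of_mem_closedBall hx, one_mul]

/-- A `Q`-minimizer agrees near the half ball with a globally defined, compactly supported
Sobolev function. -/
theorem IsQMinimizer.exists_cutoff {n : ℕ} {Ω : Set 𝔼[n]} {p q L Q : ℝ} {f : 𝔼[n] → 𝔼[n] → ℝ}
    {G u : 𝔼[n] → ℝ} {du : 𝔼[n] → 𝔼[n]} (hp : 1 ≤ p) (hpn : p < n) (hf : HasPQGrowth Ω p q L f G)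
    (hu : IsQMinimizer n Ω f Q u du) (hB : closedBall (0 : 𝔼[n]) 1 ⊆ Ω) :
    MemLp u (ENNReal.ofReal p) (volume.restrict (closedBall (0 : 𝔼[n]) 1)) ∧
    MemLp du (ENNReal.ofReal p) (volume.restrict (closedBall (0 : 𝔼[n]) 1)) ∧
    ∃ (w : 𝔼[n] → ℝ) (dw : 𝔼[n] → 𝔼[n]), HasWeakGrad w dw ∧ Measurable w ∧
      Function.support w ⊆ closedBall 0 1 ∧ (∫⁻ x, ‖w x‖ₑ ^ p) ≠ ∞ ∧ (∫⁻ x, ‖dw x‖ₑ ^ p) ≠ ∞ ∧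
      (∀ x ∈ closedBall (0 : 𝔼[n]) (3 / 4), dw x = du x) ∧
      ∀ᵐ x, x ∈ closedBall (0 : 𝔼[n]) (3 / 4) → w x = u x := by
  have hp0 : 0 < p := by linarith
  obtain ⟨δ, hδ, hδΩ⟩ := (isCompact_closedBall (0 : 𝔼[n]) 1).exists_cthickening_subset_open
    hf.open_dom hB
  rw [cthickening_closedBall hδ.le zero_le_one] at hδΩ
  have hdu1 := hu.memLp_grad hp0 hf (isCompact_closedBall (0 : 𝔼[n]) (δ + 1)) hδΩ
  have hn0 : (0 : ℝ) < n := by linarith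
  have hu1 : MemLp u (ENNReal.ofReal p) (volume.restrict (closedBall (0 : 𝔼[n]) 1)) := by
    refine memLp_of_memLp_grad hpn hu.1 hu.2.1 hu.2.2.1 hδΩ hdu1 n p 1 one_pos (by linarith) hp
      le_rfl ?_
    rw [div_self hn0.ne', sub_self]
    positivity
  have hdu2 := hu.memLp_grad hp0 hf (isCompact_closedBall (0 : 𝔼[n]) 1) hB
  refine ⟨hu1, hdu2, ?_⟩
  let χ : ContDiffBump (0 : 𝔼[n]) := ⟨7 / 8, 1, by norm_num, by norm_num⟩
  have hχ : ContDiff ℝ (⊤ : ℕ∞) χ := χ.contDiff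
  have hts : tsupport χ = closedBall (0 : 𝔼[n]) 1 := χ.tsupport_eq
  have hw := hu.1.hasWeakGrad_cutoff hu.2.1 hu.2.2.1 hχ χ.hasCompactSupport (hts ▸ hB)
  obtain ⟨m1, m2⟩ := memLp_cutoff hχ χ.hasCompactSupport (hts.symm ▸ hu1) (hts.symm ▸ hdu2)
  have hχ1 : ∀ x ∈ closedBall (0 : 𝔼[n]) (3 / 4), χ x = 1 := fun x hx =>
    χ.one_of_mem_closedBall (closedBall_subset_closedBall (by norm_num : (3 / 4 : ℝ) ≤ 7 / 8) hx)
  set w : 𝔼[n] → ℝ := (closedBall (0 : 𝔼[n]) 1).indicator (m1.1.mk _) with hwdef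
  have hae : (fun x => χ x * u x) =ᵐ[volume] w := by
    filter_upwards [m1.1.ae_eq_mk] with x hx
    by_cases hxB : x ∈ closedBall (0 : 𝔼[n]) 1
    · rw [hwdef, indicator_of_mem hxB, ← hx]
    · have h0 : χ x = 0 := image_eq_zero_of_notMem_tsupport (hts.symm ▸ hxB)
      rw [hwdef, indicator_of_notMem hxB, h0, zero_mul]
  refine ⟨w, _, hw.congr hae,
    m1.1.stronglyMeasurable_mk.measurable.indicator isClosed_closedBall.measurableSet,
    support_indicator_subset, ?_, ((memLp_ofReal_iff hp0).1 m2).2, fun x hx => ?_, ?_⟩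
  · exact ((memLp_ofReal_iff hp0).1 (m1.ae_eq hae)).2
  · have hxb : x ∈ ball (0 : 𝔼[n]) χ.rIn :=
      closedBall_subset_ball (by norm_num : (3 / 4 : ℝ) < 7 / 8) hx
    have hg : gradient χ x = 0 := by
      rw [gradient, (χ.eventuallyEq_one_of_mem_ball hxb).fderiv_eq]
      simp
    simp only [hχ1 x hx, hg, one_smul, smul_zero, add_zero]
  · filter_upwards [hae] with x hx hxB
    rw [← hx, hχ1 x hxB, one_mul]

/-- The truncated energy on a small cube is controlled by the `W^{1,p}` norm of the positive part
on the ball. -/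
theorem cubeEnergy_le_of_ae_eq {n : ℕ} {p R : ℝ} (hp : 1 ≤ p) {w u : 𝔼[n] → ℝ} {dw du : 𝔼[n] → 𝔼[n]}
    (hw : Measurable w) {x₀ : 𝔼[n]} {B : Set 𝔼[n]} (hB : {x | cubeN x₀ x ≤ R} ⊆ B)
    (hu : MemLp u (ENNReal.ofReal p) (volume.restrict B))
    (hdu : MemLp du (ENNReal.ofReal p) (volume.restrict B))
    (hdw : ∀ x, cubeN x₀ x ≤ R → dw x = du x) (hwu : ∀ᵐ x, cubeN x₀ x ≤ R → w x = u x) :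
    cubeEnergy p (fun x => max (w x) 0) ({x | 0 < w x}.indicator dw) x₀ R 1 ≤
      ENNReal.ofReal ((∫ y in B, max (u y) 0 ^ p) + ∫ y in B ∩ {y | 0 < u y}, ‖du y‖ ^ p) := by
  have hp0 : 0 < p := by linarith
  have hpR : (ENNReal.ofReal p).toReal = p := ENNReal.toReal_ofReal hp0.le
  have hcm := measurableSet_cube x₀ R
  have hu' : MemLp (fun x => max (u x) 0) (ENNReal.ofReal p) (volume.restrict B) := by
    refine hu.mono (hu.1.sup aestronglyMeasurable_const)
      (Filter.Eventually.of_forall fun x => ?_)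
    rw [Real.norm_eq_abs, Real.norm_eq_abs, abs_of_nonneg (le_max_right _ _)]
    exact max_le (le_abs_self _) (abs_nonneg _)
  have i1 : IntegrableOn (fun y => max (u y) 0 ^ p) B := by
    have := hu'.integrable_norm_rpow (by simpa using hp0) (by simp)
    rw [hpR] at this
    refine this.congr (Filter.Eventually.of_forall fun x => ?_)
    simp only [Real.norm_eq_abs, abs_of_nonneg (le_max_right (u x) 0)]
  have i2 : IntegrableOn (fun y => ‖du y‖ ^ p) (B ∩ {y | 0 < u y}) := by
    have := hdu.integrable_norm_rpow (by simpa using hp0) (by simp)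
    rw [hpR] at this
    exact IntegrableOn.mono_set this inter_subset_left
  have hmax : ∀ y : ℝ, ‖max y 0‖ₑ ^ p = ENNReal.ofReal (max y 0 ^ p) := fun y => by
    rw [Real.enorm_eq_ofReal (le_max_right _ _), ENNReal.ofReal_rpow_of_nonneg (le_max_right _ _) hp0.le]
  have hnorm : ∀ y : 𝔼[n], ‖y‖ₑ ^ p = ENNReal.ofReal (‖y‖ ^ p) := fun y => by
    rw [← ofReal_norm, ENNReal.ofReal_rpow_of_nonneg (norm_nonneg _) hp0.le]
  rw [cubeEnergy, Real.one_rpow, ENNReal.ofReal_one, one_mul, add_comm,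
    ENNReal.ofReal_add (integral_nonneg fun x => by positivity) (integral_nonneg fun x => by positivity),
    ofReal_integral_eq_lintegral_ofReal i1 (Filter.Eventually.of_forall fun x => by positivity),
    ofReal_integral_eq_lintegral_ofReal i2 (Filter.Eventually.of_forall fun x => by positivity)]
  refine add_le_add ?_ ?_
  · calc (∫⁻ x in {x | cubeN x₀ x ≤ R}, ‖max (w x) 0‖ₑ ^ p)
        = ∫⁻ x in {x | cubeN x₀ x ≤ R}, ENNReal.ofReal (max (u x) 0 ^ p) := by
          refine setLIntegral_congr_fun_ae hcm ?_
          filter_upwards [hwu] with x hx hxc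
          rw [hmax, hx hxc]
      _ ≤ _ := lintegral_mono_set hB
  · have hm : MeasurableSet {x | 0 < w x} := measurableSet_lt measurable_const hw
    calc (∫⁻ x in {x | cubeN x₀ x ≤ R}, ‖{x | 0 < w x}.indicator dw x‖ₑ ^ p)
        = ∫⁻ x in {x | cubeN x₀ x ≤ R},
            {x | 0 < w x}.indicator (fun x => ENNReal.ofReal (‖du x‖ ^ p)) x := by
          refine setLIntegral_congr_fun hcm fun x hx => ?_
          by_cases hxw : 0 < w x
          · have h1 := hdw x hx
            simp [indicator, hxw, h1, hnorm]
          · simp [indicator, hxw, hp0]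
      _ = ∫⁻ x in {x | 0 < w x} ∩ {x | cubeN x₀ x ≤ R}, ENNReal.ofReal (‖du x‖ ^ p) := by
          rw [lintegral_indicator hm, Measure.restrict_restrict hm]
      _ ≤ _ := by
          refine lintegral_mono_set' ?_
          filter_upwards [hwu] with x hx hxc
          have h1 : 0 < w x := hxc.1
          have h2 : cubeN x₀ x ≤ R := hxc.2
          exact ⟨hB hxc.2, by rw [hx h2] at h1; exact h1⟩

theorem admissibleExp_of_pos {m : ℕ} {p q : ℝ} (hm : 1 ≤ m) (hp : 1 ≤ p) (hpq : p < q)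
    (hpm : p < (m + 1 : ℕ)) (hε : 0 < min (1 / q + 1 / (m : ℝ)) 1 - 1 / p) :
    AdmissibleExp m p q (1 / min (1 / q + 1 / (m : ℝ)) 1) := by
  have hm0 : (0 : ℝ) < m := by exact_mod_cast hm
  have hq0 : 0 < q := by linarith
  have hp0 : 0 < p := by linarith
  have h1q : 0 < 1 / q := by positivity
  set a := min (1 / q + 1 / (m : ℝ)) 1 with ha
  have ha0 : 0 < a := lt_min (by positivity) one_pos
  refine ⟨hm, ?_, ?_, hpq, ?_, ?_, hpm⟩
  · rw [le_div_iff₀ ha0, one_mul]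
    exact min_le_right _ _
  · rw [div_lt_iff₀ ha0]
    have : 1 / p < a := by linarith
    rw [div_lt_iff₀ hp0] at this
    linarith
  · rw [one_div_one_div]
    linarith [min_le_left (1 / q + 1 / (m : ℝ)) 1]
  · rcases hm.eq_or_lt with rfl | hm2
    · right
      refine ⟨?_, rfl⟩
      rw [ha, min_eq_right (by simpa using h1q.le), one_div_one]
    · left
      have hm2' : (1 : ℝ) < m := by exact_mod_cast hm2
      have h3 : 1 / (m : ℝ) < a :=
        lt_min (by linarith) (by rw [div_lt_one hm0]; exact hm2')
      rw [div_lt_iff₀ ha0]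
      rw [div_lt_iff₀ hm0] at h3
      linarith

/-- **Sup bound on `B_{1/2}` (estimate (3.16)).** Under `(p,q)`-growth with inhomogeneity
`g`, `B₁ ⋐ Ω`, `1 ≤ p < min{q,n}`, `ε := min{1/q + 1/(n−1), 1} − 1/p > 0` and
`g^{1/(p−1)} ∈ L^{n,1}(B₁)`, there is `c = c(L,n,p,q,Q) ≥ 1` such that every `Q`-minimizer
`u` (with weak gradient `du`) of `F[u,A] = ∫_A f(x,∇u)` satisfies
`sup_{B_{1/2}} u ≤ c (‖u₊‖_{W^{1,p}(B₁)} + ‖u₊‖_{W^{1,p}(B₁)}^{1+(1/p−1/n)(1−p/q)/ε}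
  + ‖g^{1/(p−1)}‖_{L^{n,1}(B₁)})`, where
`‖u₊‖_{W^{1,p}(B₁)}^p = ∫_{B₁} u₊^p + ∫_{B₁ ∩ {u>0}} |∇u|^p` and `sup` is the essential
supremum. -/
theorem sup_bound_on_half_ball
    (n : ℕ) (hn : 2 ≤ n)
    (p q L Q : ℝ) (hp : 1 ≤ p) (hpq : p < q) (hpn : p < (n : ℝ))
    (hL : 1 ≤ L) (hQ : 1 ≤ Q)
    (hε : 0 < min (1 / q + 1 / ((n : ℝ) - 1)) 1 - 1 / p) :
    ∃ c : ℝ, 1 ≤ c ∧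
      ∀ (Ω : Set (EuclideanSpace ℝ (Fin n))),
        IsOpen Ω → IsConnected Ω → Bornology.IsBounded Ω →
        closedBall (0 : EuclideanSpace ℝ (Fin n)) 1 ⊆ Ω →
      ∀ μ : ℝ, 0 ≤ μ →
      ∀ g : EuclideanSpace ℝ (Fin n) → ℝ,
        (∀ᵐ x ∂volume.restrict Ω, 0 ≤ g x) →
        AEMeasurable g (volume.restrict Ω) →
        IntegrableOn (fun x => g x ^ (p / (p - 1))) Ω →
        lorentzN1 n (ball (0 : EuclideanSpace ℝ (Fin n)) 1)
          (fun x => g x ^ (1 / (p - 1))) < ⊤ →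
      ∀ f : EuclideanSpace ℝ (Fin n) → EuclideanSpace ℝ (Fin n) → ℝ,
        (∀ z : EuclideanSpace ℝ (Fin n),
          AEMeasurable (fun x => f x z) (volume.restrict Ω)) →
        (∀ᵐ x ∂volume.restrict Ω, Continuous fun z => f x z) →
        (∀ᵐ x ∂volume.restrict Ω, ConvexOn ℝ univ fun z => f x z) →
        (∀ᵐ x ∂volume.restrict Ω, ∀ z : EuclideanSpace ℝ (Fin n),
          ‖z‖ ^ p - g x ^ (p / (p - 1)) ≤ f x z ∧
            f x z ≤ L * ‖z‖ ^ q + g x ^ (p / (p - 1))) →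
        (∀ᵐ x ∂volume.restrict Ω, ∀ z : EuclideanSpace ℝ (Fin n),
          f x (2 • z) ≤ μ + L * f x z) →
      ∀ (u : EuclideanSpace ℝ (Fin n) → ℝ)
        (du : EuclideanSpace ℝ (Fin n) → EuclideanSpace ℝ (Fin n)),
        IsQMinimizer n Ω f Q u du →
      ∀ᵐ x ∂volume.restrict (ball (0 : EuclideanSpace ℝ (Fin n)) (1 / 2)),
        u x ≤ c * ((((∫ y in ball (0 : EuclideanSpace ℝ (Fin n)) 1, max (u y) 0 ^ p) +
              ∫ y in ball (0 : EuclideanSpace ℝ (Fin n)) 1 ∩ {y | 0 < u y}, ‖du y‖ ^ p)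
              ^ (1 / p)) +
            (((∫ y in ball (0 : EuclideanSpace ℝ (Fin n)) 1, max (u y) 0 ^ p) +
              ∫ y in ball (0 : EuclideanSpace ℝ (Fin n)) 1 ∩ {y | 0 < u y}, ‖du y‖ ^ p)
              ^ (1 / p))
              ^ (1 + (1 / p - 1 / (n : ℝ)) * (1 - p / q) /
                  (min (1 / q + 1 / ((n : ℝ) - 1)) 1 - 1 / p)) +
            (lorentzN1 n (ball (0 : EuclideanSpace ℝ (Fin n)) 1)
              (fun x => g x ^ (1 / (p - 1)))).toReal) := by
  obtain ⟨m, rfl⟩ : ∃ m, n = m + 1 := ⟨n - 1, by omega⟩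
  have hm : 1 ≤ m := by omega
  have hcast : ((m + 1 : ℕ) : ℝ) - 1 = m := by push_cast; ring
  rw [hcast] at hε ⊢
  have hp0 : 0 < p := by linarith
  have hq0 : 0 < q := by linarith
  have hp1 : 0 < p - 1 := by
    have h1 : 1 / p < 1 := by linarith [min_le_right (1 / q + 1 / (m : ℝ)) 1]
    rw [div_lt_one hp0] at h1
    linarith
  have H := admissibleExp_of_pos hm hp hpq hpn hε
  set ε : ℝ := min (1 / q + 1 / (m : ℝ)) 1 - 1 / p with hεdef
  have hn0 : (0 : ℝ) < (m + 1 : ℕ) := by positivity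
  have hn1 : (1 : ℝ) ≤ (m + 1 : ℕ) := by exact_mod_cast Nat.succ_pos m
  set κ : ℝ := 1 + (1 / p - 1 / ((m + 1 : ℕ) : ℝ)) * (1 - p / q) / ε with hκdef
  have hκ0 : 0 < κ := by
    have h1 : 1 / ((m + 1 : ℕ) : ℝ) < 1 / p := one_div_lt_one_div_of_lt hp0 hpn
    have h2 : p / q < 1 := (div_lt_one hq0).2 hpq
    have h3 : 0 ≤ (1 / p - 1 / ((m + 1 : ℕ) : ℝ)) * (1 - p / q) / ε :=
      div_nonneg (mul_nonneg (by linarith) (by linarith)) hε.le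
    linarith
  set B : Set 𝔼[m + 1] := ball 0 1 with hBdef
  set R : ℝ := 1 / (4 * ((m + 1 : ℕ) : ℝ)) with hRdef
  have hR0 : 0 < R := by positivity
  have hnR : ((m + 1 : ℕ) : ℝ) * R = 1 / 4 := by
    rw [hRdef]
    field_simp
  have hR1 : R ≤ 1 := by nlinarith
  have hBfin : volume B ≠ ∞ := measure_ball_lt_top.ne
  have hM : 0 < (volume B).toReal :=
    ENNReal.toReal_pos (measure_ball_pos volume _ one_pos).ne' hBfin
  obtain ⟨θ, c, hθ, hθ1, hc, key⟩ := exists_cube_sup_const H (by linarith : 0 ≤ L) hQ 1 hR0 hR1 hM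
  obtain ⟨C, hC, tail⟩ := exists_dyadicTail_const (n := m + 1) hp hpn hθ hθ1
  refine ⟨c * (1 + C) + 1, by have := mul_nonneg hc (by linarith : 0 ≤ 1 + C); linarith, ?_⟩
  intro Ω hΩ _ _ hBΩ μ _ g hg0 hgm hgi hlor f hfm hfc hfconv hfgr _ u du hu
  have hf : HasPQGrowth Ω p q L f (fun x => g x ^ (p / (p - 1))) := by
    refine ⟨hΩ, hfm, hfc, hfconv, ?_, ?_, ?_, hgi⟩
    · filter_upwards [hfgr] with x hx z using (hx z).1
    · filter_upwards [hfgr] with x hx z using (hx z).2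
    · filter_upwards [hg0] with x hx using Real.rpow_nonneg hx _
  obtain ⟨hu1, hdu1, w, dw, hw, hwm, hws, hwp, hdwp, hdw, hwu⟩ := hu.exists_cutoff hp hpn hf hBΩ
  have hBsub : B ⊆ Ω := ball_subset_closedBall.trans hBΩ
  set h : 𝔼[m + 1] → ℝ := fun x => g x ^ (1 / (p - 1)) with hhdef
  have hGh : ∀ᵐ x ∂volume.restrict B, ENNReal.ofReal (g x ^ (p / (p - 1))) = ‖h x‖ₑ ^ p := by
    filter_upwards [ae_restrict_of_ae_restrict_of_subset hBsub hg0] with x hx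
    have h1 : 0 ≤ g x ^ (1 / (p - 1)) := Real.rpow_nonneg hx _
    rw [Real.enorm_eq_ofReal h1, ENNReal.ofReal_rpow_of_nonneg h1 hp0.le, ← Real.rpow_mul hx]
    congr 2
    ring
  obtain ⟨tail1, tail2⟩ := tail h B measurableSet_ball hBfin
    ((aemeasurable_indicator_iff measurableSet_ball).2
      ((hgm.mono_measure (Measure.restrict_mono hBsub le_rfl)).pow_const _))
    (by
      rw [← lintegral_congr_ae hGh]
      exact ((hgi.mono_set hBsub).lintegral_lt_top).ne) hlor
  set E : ℝ := (∫ y in B, max (u y) 0 ^ p) + ∫ y in B ∩ {y | 0 < u y}, ‖du y‖ ^ p with hEdef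
  have hE0 : 0 ≤ E := add_nonneg (integral_nonneg fun x => by positivity)
    (integral_nonneg fun x => by positivity)
  set N : ℝ := E ^ (1 / p) with hNdef
  have hN0 : 0 ≤ N := by positivity
  have hNE : N ^ p = E := by
    rw [hNdef, ← Real.rpow_mul hE0, one_div_mul_cancel hp0.ne', Real.rpow_one]
  set Λ : ℝ := (lorentzN1 (m + 1) B h).toReal with hΛdef
  have hexp : 1 + (1 / p - 1 / ((m + 1 : ℕ) : ℝ)) * (q / p - 1) /
      (q * (1 / (1 / min (1 / q + 1 / (m : ℝ)) 1) - 1 / p) / p) = κ := by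
    rw [one_div_one_div, ← hεdef, hκdef]
    have := hε.ne'
    field_simp
  have claim : ∀ b : ℝ, 0 < b → N ≤ b → ∀ x₀ ∈ closedBall (0 : 𝔼[m + 1]) (1 / 2),
      ∀ᵐ x, cubeN x₀ x ≤ R / 2 → w x ≤ c * (b + b ^ κ + C * Λ) := by
    intro b hb hNb x₀ hx₀
    have hcube : {x | cubeN x₀ x ≤ R} ⊆ closedBall (0 : 𝔼[m + 1]) (3 / 4) := by
      refine (cube_subset_closedBall x₀ R).trans (closedBall_subset_closedBall' ?_)
      rw [hnR]
      linarith [mem_closedBall.1 hx₀]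
    have hcB : {x | cubeN x₀ x ≤ R} ⊆ B := hcube.trans (closedBall_subset_ball (by norm_num))
    have hcB' := hcB.trans (ball_subset_closedBall : B ⊆ _)
    have res := key Ω f _ hf u du hu w dw hw hwm hws hwp hdwp x₀ (hcB.trans hBsub) hcB'
      (fun x hx => hdw x (hcube hx))
      (fun s => (dyadicTail (m + 1) p θ (B.indicator h) s).toReal)
      (fun s => ENNReal.toReal_nonneg)
      (fun A hA hAc s hs hsM hAs => by
        rw [lintegral_congr_ae (ae_restrict_of_ae_restrict_of_subset (hAc.trans hcB) hGh)]
        exact tail1 A hA (hAc.trans hcB) s hs hsM hAs)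
      (C * Λ) tail2 b hb ?_
    · rwa [hexp] at res
    · refine (cubeEnergy_le_of_ae_eq hp hwm hcB
        (hu1.mono_measure (Measure.restrict_mono ball_subset_closedBall le_rfl))
        (hdu1.mono_measure (Measure.restrict_mono ball_subset_closedBall le_rfl))
        (fun x hx => hdw x (hcube hx)) (hwu.mono fun x hx hxc => hx (hcube hxc))).trans
        (ENNReal.ofReal_le_ofReal ?_)
      rw [← hEdef, ← hNE]
      gcongr
  obtain ⟨T, hTs, hTf, hTc⟩ := (isCompact_closedBall (0 : 𝔼[m + 1]) (1 / 2)).finite_cover_balls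
    (half_pos hR0)
  have hall : ∀ᵐ x, ∀ x₀ ∈ T, ∀ k : ℕ, cubeN x₀ x ≤ R / 2 →
      w x ≤ c * ((N + 1 / ((k : ℝ) + 1)) + (N + 1 / ((k : ℝ) + 1)) ^ κ + C * Λ) := by
    refine (ae_ball_iff hTf.countable).2 fun x₀ hx₀ => ae_all_iff.2 fun k => ?_
    have hk : 0 < 1 / ((k : ℝ) + 1) := Nat.one_div_pos_of_nat
    exact claim _ (by linarith) (by linarith) x₀ (hTs hx₀)
  rw [ae_restrict_iff' measurableSet_ball]
  filter_upwards [hall, hwu] with x hx hxu hxB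
  have hxB' : x ∈ closedBall (0 : 𝔼[m + 1]) (1 / 2) := ball_subset_closedBall hxB
  obtain ⟨x₀, hx₀, hxx₀⟩ := mem_iUnion₂.1 (hTc hxB')
  have hxc : cubeN x₀ x ≤ R / 2 := (cubeN_le_dist x₀ x).trans (mem_ball.1 hxx₀).le
  rw [← hxu (closedBall_subset_closedBall (by norm_num) hxB')]
  have hlim : Filter.Tendsto
      (fun k : ℕ => c * ((N + 1 / ((k : ℝ) + 1)) + (N + 1 / ((k : ℝ) + 1)) ^ κ + C * Λ))
      Filter.atTop (𝓝 (c * (N + N ^ κ + C * Λ))) := by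
    have h1 : Filter.Tendsto (fun k : ℕ => N + 1 / ((k : ℝ) + 1)) Filter.atTop (𝓝 N) := by
      simpa using tendsto_one_div_add_atTop_nhds_zero_nat.const_add N
    exact ((h1.add (h1.rpow_const (Or.inr hκ0.le))).add_const _).const_mul c
  have hle : w x ≤ c * (N + N ^ κ + C * Λ) := ge_of_tendsto' hlim fun k => hx x₀ hx₀ k hxc
  have hκN : 0 ≤ N ^ κ := by positivity
  have hΛ0 : 0 ≤ Λ := ENNReal.toReal_nonneg
  have h1 : 0 ≤ c * C * (N + N ^ κ) := by positivity
  have h2 : 0 ≤ c * Λ := by positivity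
  calc w x ≤ c * (N + N ^ κ + C * Λ) := hle
    _ ≤ (c * (1 + C) + 1) * (N + N ^ κ + Λ) := by nlinarith
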